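/- There exists an absolute constant C > 0 such that for every δ > 0 and every integer d ≥ 1 there exist constants c = c(d,δ) > 0 and N = N(d,δ) with the following property. For every n ≥ N, every m, every d-local function f : {0,1}^m → {0,1}^n, and every set Ψ ⊆ {0,1,…,n} containing some element s with |s − n/2| ≤ c·n, there exists η ∈ [0,1] such that the mixture M = η·evens + (1−η)·odds satisfies dTV(f(U^m), M) ≤ C·dTV(f(U^m), D_Ψ) + δ. -/

import Mathlib

open Finset

noncomputable section

/-- Hamming weight of a Boolean string. -/
def hw {n : ℕ} (x : Fin n → Bool) : ℕ := (Finset.univ.filter fun i => x i = true).card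

/-- Uniform distribution on a finite set `C` (zero if `C` is empty). -/
def unifOn {α : Type} [Fintype α] [DecidableEq α] (C : Finset α) : α → ℝ :=
  fun x => if x ∈ C then (C.card : ℝ)⁻¹ else 0

/-- Total variation distance between two (mass functions of) distributions. -/
def tvd {α : Type} [Fintype α] (A B : α → ℝ) : ℝ := (∑ x, |A x - B x|) / 2

/-- Pushforward of a distribution along `f`. -/
def pushf {α β : Type} [Fintype α] [DecidableEq β] (f : α → β) (A : α → ℝ) : β → ℝ :=
  fun y => ∑ x ∈ Finset.univ.filter (fun x => f x = y), A x

/-- `f` is `d`-local: each output coordinate depends on at most `d` input coordinates. -/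
def IsLocal {m n : ℕ} (d : ℕ) (f : (Fin m → Bool) → (Fin n → Bool)) : Prop :=
  ∀ i : Fin n, ∃ T : Finset (Fin m), T.card ≤ d ∧
    ∀ x y : Fin m → Bool, (∀ j ∈ T, x j = y j) → f x i = f y i

/-- `D_Ψ`: uniform distribution on strings whose Hamming weight lies in `Ψ`. -/
def DPsi (n : ℕ) (Ψ : Finset ℕ) : (Fin n → Bool) → ℝ :=
  unifOn (Finset.univ.filter fun x => hw x ∈ Ψ)

/-- The weight distribution of `A`: probability that the Hamming weight equals `k`. -/
def wd {n : ℕ} (A : (Fin n → Bool) → ℝ) (k : ℕ) : ℝ :=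
  ∑ x ∈ Finset.univ.filter (fun x => hw x = k), A x

/-- Total variation distance between the weight distributions of `A` and `B`. -/
def tvW {n : ℕ} (A B : (Fin n → Bool) → ℝ) : ℝ :=
  (∑ k ∈ Finset.range (n + 1), |wd A k - wd B k|) / 2

/-- Symmetrization of the distribution `A`. -/
def symA {n : ℕ} (A : (Fin n → Bool) → ℝ) : (Fin n → Bool) → ℝ :=
  fun x => wd A (hw x) / (n.choose (hw x))

/-- Uniform distribution over strings of even Hamming weight. -/
def evens (n : ℕ) : (Fin n → Bool) → ℝ :=
  unifOn (Finset.univ.filter fun x : Fin n → Bool => Even (hw x))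

/-- Uniform distribution over strings of odd Hamming weight. -/
def odds (n : ℕ) : (Fin n → Bool) → ℝ :=
  unifOn (Finset.univ.filter fun x : Fin n → Bool => Odd (hw x))

/-! ### Averages over finite types and product structure of the cube -/

section Avg
variable {Ω Ω' R : Type*} [Fintype Ω] [Fintype Ω'] [Field R]

/-- The average of `g` over a finite type. -/
def Ex (g : Ω → R) : R := (∑ x, g x) / (Fintype.card Ω : R)

lemma Ex_add (g h : Ω → R) : Ex (fun x => g x + h x) = Ex g + Ex h := by
  simp [Ex, sum_add_distrib, add_div]

lemma Ex_sub (g h : Ω → R) : Ex (fun x => g x - h x) = Ex g - Ex h := by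
  simp [Ex, sum_sub_distrib, sub_div]

lemma Ex_neg (g : Ω → R) : Ex (fun x => - g x) = - Ex g := by
  simp [Ex, neg_div]

lemma Ex_mul_left (c : R) (g : Ω → R) : Ex (fun x => c * g x) = c * Ex g := by
  simp [Ex, ← mul_sum, mul_div_assoc]

lemma Ex_mul_right (c : R) (g : Ω → R) : Ex (fun x => g x * c) = Ex g * c := by
  simp_rw [mul_comm _ c]; exact Ex_mul_left c g

lemma Ex_div (c : R) (g : Ω → R) : Ex (fun x => g x / c) = Ex g / c := by
  simp_rw [div_eq_mul_inv]; exact Ex_mul_right _ g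

lemma Ex_sum {κ : Type*} (s : Finset κ) (g : κ → Ω → R) :
    Ex (fun x => ∑ k ∈ s, g k x) = ∑ k ∈ s, Ex (g k) := by
  simp only [Ex]; rw [sum_comm, sum_div]

lemma Ex_comm (F : Ω → Ω' → R) :
    Ex (fun x => Ex (fun y => F x y)) = Ex (fun y => Ex (fun x => F x y)) := by
  simp only [Ex]; rw [← sum_div, ← sum_div, sum_comm, div_right_comm]

lemma Ex_equiv (e : Ω ≃ Ω') (g : Ω' → R) : Ex (fun x => g (e x)) = Ex g := by
  simp only [Ex]; rw [Equiv.sum_comp e g, Fintype.card_congr e]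

variable [CharZero R]

lemma Ex_const [Nonempty Ω] (c : R) : Ex (fun _ : Ω => c) = c := by
  simp [Ex]

omit [CharZero R] in
lemma Ex_prod_type (F : Ω → Ω' → R) :
    Ex (fun p : Ω × Ω' => F p.1 p.2) = Ex (fun x => Ex (fun y => F x y)) := by
  simp only [Ex]; rw [← sum_div, Fintype.sum_prod_type, Fintype.card_prod, div_div]
  push_cast; rw [mul_comm]

end Avg

section AvgReal
variable {Ω Ω' : Type*} [Fintype Ω] [Fintype Ω']

lemma Ex_mono {g h : Ω → ℝ} (H : ∀ x, g x ≤ h x) : Ex g ≤ Ex h := by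
  unfold Ex; gcongr with x; exact H x

lemma Ex_nonneg {g : Ω → ℝ} (H : ∀ x, 0 ≤ g x) : 0 ≤ Ex g :=
  div_nonneg (sum_nonneg fun x _ => H x) (by positivity)

lemma abs_Ex_le (g : Ω → ℝ) : |Ex g| ≤ Ex (fun x => |g x|) := by
  unfold Ex; rw [abs_div, Nat.abs_cast]; gcongr; exact abs_sum_le_sum_abs _ _

lemma Ex_le_const [Nonempty Ω] {g : Ω → ℝ} {c : ℝ} (H : ∀ x, g x ≤ c) : Ex g ≤ c :=
  (Ex_mono H).trans (Ex_const c).le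

lemma const_le_Ex [Nonempty Ω] {g : Ω → ℝ} {c : ℝ} (H : ∀ x, c ≤ g x) : c ≤ Ex g :=
  (Ex_const c).ge.trans (Ex_mono H)

lemma Ex_mul_sq_le (g h : Ω → ℝ) :
    Ex (fun x => g x * h x) ^ 2 ≤ Ex (fun x => g x ^ 2) * Ex (fun x => h x ^ 2) := by
  unfold Ex; rw [div_pow, div_mul_div_comm, ← sq]; gcongr
  exact sum_mul_sq_le_sq_mul_sq _ _ _

lemma sq_Ex_le [Nonempty Ω] (g : Ω → ℝ) : Ex g ^ 2 ≤ Ex (fun x => g x ^ 2) := by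
  have := Ex_mul_sq_le g (fun _ => 1)
  simpa [Ex_const] using this

lemma abs_Ex_le_of [Nonempty Ω] {g : Ω → ℝ} {c : ℝ} (H : ∀ x, |g x| ≤ c) : |Ex g| ≤ c :=
  (abs_Ex_le g).trans (Ex_le_const H)

lemma Ex_eq_zero_of_nonneg [Nonempty Ω] {g : Ω → ℝ} (H : ∀ x, 0 ≤ g x) (h0 : Ex g = 0) (x : Ω) :
    g x = 0 := by
  unfold Ex at h0
  rw [div_eq_zero_iff, or_iff_left (by simp)] at h0
  exact (sum_eq_zero_iff_of_nonneg fun x _ => H x).1 h0 x (mem_univ x)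

end AvgReal

section Cube
variable {ι : Type*} [Fintype ι] [DecidableEq ι] {R : Type*}

/-- `g` depends only on the coordinates in `A`. -/
def DepOn {β : Type*} (A : Finset ι) (g : (ι → Bool) → β) : Prop :=
  ∀ x y : ι → Bool, (∀ i ∈ A, x i = y i) → g x = g y

/-- Overwrite the coordinates of `y` in `V` by those of `x`. -/
def ov (V : Finset ι) (x y : ι → Bool) : ι → Bool := fun i => if i ∈ V then x i else y i

/-- Indicator vector of `A`. -/
def ind (A : Finset ι) : ι → Bool := fun i => decide (i ∈ A)

omit [Fintype ι] [DecidableEq ι] in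
lemma DepOn.mono {β : Type*} {A B : Finset ι} {g : (ι → Bool) → β} (h : DepOn A g) (hAB : A ⊆ B) :
    DepOn B g := fun x y hxy => h x y fun i hi => hxy i (hAB hi)

omit [Fintype ι] [DecidableEq ι] in
lemma DepOn.comp {β γ : Type*} {A : Finset ι} {g : (ι → Bool) → β} (h : DepOn A g) (F : β → γ) :
    DepOn A (fun x => F (g x)) := fun x y hxy => by simp only [h x y hxy]

omit [Fintype ι] [DecidableEq ι] in
lemma DepOn.comp2 {β β' γ : Type*} {A : Finset ι} {g : (ι → Bool) → β} {h : (ι → Bool) → β'}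
    (hg : DepOn A g) (hh : DepOn A h) (F : β → β' → γ) :
    DepOn A (fun x => F (g x) (h x)) := fun x y hxy => by simp only [hg x y hxy, hh x y hxy]

omit [Fintype ι] in
lemma DepOn.prod {κ : Type*} [CommMonoid R] {s : Finset κ} {A : κ → Finset ι}
    {g : κ → (ι → Bool) → R} (h : ∀ k ∈ s, DepOn (A k) (g k)) :
    DepOn (s.biUnion A) (fun x => ∏ k ∈ s, g k x) := fun x y hxy =>
  prod_congr rfl fun k hk => h k hk x y fun i hi => hxy i (mem_biUnion.2 ⟨k, hk, hi⟩)

omit [Fintype ι] in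
lemma DepOn.sum {κ : Type*} [AddCommMonoid R] {s : Finset κ} {A : κ → Finset ι}
    {g : κ → (ι → Bool) → R} (h : ∀ k ∈ s, DepOn (A k) (g k)) :
    DepOn (s.biUnion A) (fun x => ∑ k ∈ s, g k x) := fun x y hxy =>
  sum_congr rfl fun k hk => h k hk x y fun i hi => hxy i (mem_biUnion.2 ⟨k, hk, hi⟩)

omit [Fintype ι] in
lemma DepOn.ov {β : Type*} {A V : Finset ι} {g : (ι → Bool) → β} (h : DepOn A g) (x : ι → Bool) :
    DepOn (A \ V) (fun y => g (ov V x y)) := fun y z hyz => h _ _ fun i hi => by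
  unfold _root_.ov
  split_ifs with hV
  · rfl
  · exact hyz i (mem_sdiff.2 ⟨hi, hV⟩)

omit [Fintype ι] in
lemma ov_of_mem {V : Finset ι} {x y : ι → Bool} {i : ι} (h : i ∈ V) : ov V x y i = x i := by
  simp [ov, h]

omit [Fintype ι] in
lemma ov_of_notMem {V : Finset ι} {x y : ι → Bool} {i : ι} (h : i ∉ V) : ov V x y i = y i := by
  simp [ov, h]

/-- The involution swapping the coordinates in `A` between two points. -/
def ovSwap (A : Finset ι) : ((ι → Bool) × (ι → Bool)) ≃ ((ι → Bool) × (ι → Bool)) where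
  toFun p := (ov A p.1 p.2, ov A p.2 p.1)
  invFun p := (ov A p.1 p.2, ov A p.2 p.1)
  left_inv p := by ext i <;> by_cases h : i ∈ A <;> simp [ov, h]
  right_inv p := by ext i <;> by_cases h : i ∈ A <;> simp [ov, h]

variable [Field R] [CharZero R]

omit [CharZero R] in
lemma Ex_ovSwap (A : Finset ι) (F : (ι → Bool) → (ι → Bool) → R) :
    Ex (fun x => Ex (fun y => F (ov A x y) (ov A y x))) = Ex (fun x => Ex (fun y => F x y)) := by
  rw [← Ex_prod_type, ← Ex_prod_type]
  exact Ex_equiv (ovSwap A) (fun p => F p.1 p.2)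

lemma Ex_ov (V : Finset ι) (F : (ι → Bool) → R) :
    Ex (fun x => Ex (fun y => F (ov V x y))) = Ex F := by
  rw [Ex_ovSwap V (fun x _ => F x)]
  simp [Ex_const]

lemma Ex_mul_of_disjoint {A B : Finset ι} {g h : (ι → Bool) → R} (hg : DepOn A g) (hh : DepOn B h)
    (hAB : Disjoint A B) : Ex (fun x => g x * h x) = Ex g * Ex h := by
  rw [← Ex_ov A (fun x => g x * h x)]
  have : ∀ x y, g (ov A x y) * h (ov A x y) = g x * h y := fun x y => by
    rw [hg (ov A x y) x fun i hi => ov_of_mem hi,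
      hh (ov A x y) y fun i hi => ov_of_notMem (disjoint_right.1 hAB hi)]
  simp_rw [this, Ex_mul_left, Ex_mul_right]

lemma Ex_prod_of_disjoint {κ : Type*} [DecidableEq κ] (s : Finset κ) {A : κ → Finset ι}
    {g : κ → (ι → Bool) → R} (h : ∀ k ∈ s, DepOn (A k) (g k))
    (hA : ∀ k ∈ s, ∀ l ∈ s, k ≠ l → Disjoint (A k) (A l)) :
    Ex (fun x => ∏ k ∈ s, g k x) = ∏ k ∈ s, Ex (g k) := by
  induction s using Finset.induction_on with
  | empty => simp [Ex_const]
  | insert a s ha ih =>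
    simp_rw [prod_insert ha]
    rw [Ex_mul_of_disjoint (h a (mem_insert_self _ _))
      (DepOn.prod fun k hk => h k (mem_insert_of_mem hk)), ih]
    · exact fun k hk => h k (mem_insert_of_mem hk)
    · exact fun k hk l hl => hA k (mem_insert_of_mem hk) l (mem_insert_of_mem hl)
    · rw [disjoint_biUnion_right]
      exact fun k hk => hA a (mem_insert_self _ _) k (mem_insert_of_mem hk)
        (fun h => ha (h ▸ hk))

/-- Flipping coordinate `i`. -/
def flipAt (i : ι) : (ι → Bool) ≃ (ι → Bool) where
  toFun x := Function.update x i (!x i)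
  invFun x := Function.update x i (!x i)
  left_inv x := by ext j; by_cases h : j = i <;> simp [h]
  right_inv x := by ext j; by_cases h : j = i <;> simp [h]

lemma Ex_coord (i : ι) (F : Bool → R) :
    Ex (fun x : ι → Bool => F (x i)) = (F true + F false) / 2 := by
  have h1 : Ex (fun x : ι → Bool => F (!x i)) = Ex (fun x : ι → Bool => F (x i)) := by
    rw [← Ex_equiv (flipAt i) (fun x : ι → Bool => F (x i))]
    simp [flipAt]
  have h2 : Ex (fun x : ι → Bool => F (x i) + F (!x i)) = F true + F false := by
    rw [← Ex_const (Ω := ι → Bool) (F true + F false)]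
    congr 1; ext x; cases x i <;> simp [add_comm]
  rw [Ex_add, h1] at h2
  rw [← h2]; ring

lemma Ex_pin (V : Finset ι) (b : ι → Bool) :
    Ex (fun x : ι → Bool => if ∀ i ∈ V, x i = b i then (1 : R) else 0) = (1 / 2) ^ V.card := by
  have : (fun x : ι → Bool => if ∀ i ∈ V, x i = b i then (1 : R) else 0)
      = fun x => ∏ i ∈ V, if x i = b i then (1 : R) else 0 := by
    ext x; rw [prod_ite_zero]; simp
  rw [this, Ex_prod_of_disjoint V (A := fun i => {i})]
  · rw [prod_congr rfl (g := fun _ => (1 / 2 : R)), prod_const]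
    intro i _
    rw [Ex_coord i (fun c => if c = b i then (1 : R) else 0)]
    cases b i <;> simp
  · intro i _ x y h; simp [h i (mem_singleton_self i)]
  · intro k _ l _ h; simpa using h

lemma Ex_of_depOn (V : Finset ι) {H : (ι → Bool) → R} (hH : DepOn V H) :
    Ex H = (1 / 2) ^ V.card * ∑ A ∈ V.powerset, H (ind A) := by
  have : H = fun x => ∑ A ∈ V.powerset, H (ind A) * (if ∀ i ∈ V, x i = ind A i then (1 : R) else 0) := by
    ext x
    rw [sum_eq_single (V.filter fun i => x i = true)]
    · rw [if_pos, mul_one]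
      · exact hH _ _ fun i hi => by simp [ind, hi]
      · intro i hi; simp [ind, hi]
    · intro A hA hne
      rw [if_neg, mul_zero]
      intro h
      apply hne
      ext i
      simp only [mem_filter]
      constructor
      · intro hi; refine ⟨mem_powerset.1 hA hi, ?_⟩; rw [h i (mem_powerset.1 hA hi)]; simp [ind, hi]
      · rintro ⟨hi, hx⟩; rw [h i hi] at hx; simpa [ind] using hx
    · intro h; simp at h
  conv_lhs => rw [this]
  rw [Ex_sum]
  simp_rw [Ex_mul_left, Ex_pin]
  rw [← sum_mul, mul_comm]

/-- An integer-valued function of the coordinates in `V` has average in `2^{-|V|} ℤ`. -/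
lemma one_le_abs_Ex_of_depOn {V : Finset ι} {H : (ι → Bool) → ℝ} (hH : DepOn V H)
    (hi : ∀ x, ∃ k : ℤ, H x = k) (h0 : Ex H ≠ 0) : (1 / 2 : ℝ) ^ V.card ≤ |Ex H| := by
  choose k hk using hi
  have h2 : Ex H = (1 / 2) ^ V.card * ((∑ A ∈ V.powerset, k (ind A) : ℤ) : ℝ) := by
    rw [Ex_of_depOn V hH]; push_cast; simp_rw [hk]
  rw [h2, abs_mul, abs_of_pos (by positivity)]
  have h3 : (∑ A ∈ V.powerset, k (ind A) : ℤ) ≠ 0 := by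
    intro h; apply h0; rw [h2, h]; simp
  have h4 : (1 : ℝ) ≤ |((∑ A ∈ V.powerset, k (ind A) : ℤ) : ℝ)| := by
    exact_mod_cast Int.one_le_abs h3
  nlinarith [pow_pos (show (0 : ℝ) < 1 / 2 by norm_num) V.card]

end Cube

/-! ### Fourier analysis on the cube -/

/-- The sign of a bit. -/
def sg (b : Bool) : ℝ := if b then -1 else 1

lemma sg_mul_self (b : Bool) : sg b * sg b = 1 := by cases b <;> simp [sg]

lemma sg_sq (b : Bool) : sg b ^ 2 = 1 := by rw [sq, sg_mul_self]

lemma sg_xor (a b : Bool) : sg (xor a b) = sg a * sg b := by cases a <;> cases b <;> simp [sg]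

section Fourier
variable {ι : Type} [Fintype ι] [DecidableEq ι]

/-- Characters of the cube. -/
def chi (S : Finset ι) (x : ι → Bool) : ℝ := ∏ i ∈ S, sg (x i)

/-- Fourier coefficients. -/
def fc (g : (ι → Bool) → ℝ) (S : Finset ι) : ℝ := Ex (fun x => g x * chi S x)

/-- Translation on the cube. -/
def bxor (x z : ι → Bool) : ι → Bool := fun i => xor (x i) (z i)

omit [Fintype ι] [DecidableEq ι] in
lemma chi_mul_self (S : Finset ι) (x : ι → Bool) : chi S x * chi S x = 1 := by
  simp [chi, ← prod_mul_distrib, sg_mul_self]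

omit [Fintype ι] [DecidableEq ι] in
lemma chi_sq (S : Finset ι) (x : ι → Bool) : chi S x ^ 2 = 1 := by rw [sq, chi_mul_self]

omit [Fintype ι] [DecidableEq ι] in
lemma abs_chi (S : Finset ι) (x : ι → Bool) : |chi S x| = 1 := by
  rw [← sq_eq_sq₀ (abs_nonneg _) zero_le_one, sq_abs, chi_sq, one_pow]

omit [Fintype ι] in
lemma chi_mul (S T : Finset ι) (x : ι → Bool) : chi S x * chi T x = chi (symmDiff S T) x := by
  have h1 : chi S x = chi (S \ T) x * chi (S ∩ T) x := by
    unfold chi; rw [← prod_union (disjoint_sdiff_inter S T), sdiff_union_inter]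
  have h2 : chi T x = chi (T \ S) x * chi (S ∩ T) x := by
    unfold chi
    rw [inter_comm, ← prod_union (disjoint_sdiff_inter T S), sdiff_union_inter]
  have h3 : chi (symmDiff S T) x = chi (S \ T) x * chi (T \ S) x := by
    unfold chi; rw [← prod_union disjoint_sdiff_sdiff]; rfl
  rw [h1, h2, h3]
  linear_combination chi (S \ T) x * chi (T \ S) x * chi_mul_self (S ∩ T) x

omit [Fintype ι] [DecidableEq ι] in
lemma chi_bxor (S : Finset ι) (x z : ι → Bool) : chi S (bxor x z) = chi S x * chi S z := by
  simp [chi, bxor, sg_xor, prod_mul_distrib]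

omit [Fintype ι] [DecidableEq ι] in
lemma depOn_chi (S : Finset ι) : DepOn S (chi S) := fun x y h =>
  prod_congr rfl fun i hi => by rw [h i hi]

lemma Ex_chi_mul {S : Finset ι} {a : ι} (ha : a ∈ S) {g : (ι → Bool) → ℝ}
    {B : Finset ι} (hg : DepOn B g) (haB : a ∉ B) : Ex (fun x => chi S x * g x) = 0 := by
  have : ∀ x : ι → Bool, chi S x * g x = sg (x a) * (chi (S.erase a) x * g x) := fun x => by
    rw [chi, ← mul_prod_erase S _ ha, chi, mul_assoc]
  simp_rw [this]
  rw [Ex_mul_of_disjoint (A := {a}) (B := S.erase a ∪ B), Ex_coord a sg]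
  · simp [sg]
  · intro x y h; simp only [h a (mem_singleton_self a)]
  · exact ((depOn_chi _).mono subset_union_left).comp2 (hg.mono subset_union_right) (· * ·)
  · simp [haB]

lemma Ex_chi (S : Finset ι) : Ex (chi S) = if S = ∅ then 1 else 0 := by
  split_ifs with h
  · subst h; exact Ex_const 1
  · obtain ⟨a, ha⟩ := nonempty_iff_ne_empty.2 h
    have := Ex_chi_mul ha (g := fun _ => 1) (B := ∅) (fun _ _ _ => rfl) (by simp)
    simpa using this

lemma sum_chi_mul_chi (x y : ι → Bool) :
    ∑ S : Finset ι, chi S x * chi S y = if x = y then (Fintype.card (ι → Bool) : ℝ) else 0 := by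
  have : ∑ S : Finset ι, chi S x * chi S y = ∏ i, (1 + sg (x i) * sg (y i)) := by
    rw [prod_one_add, powerset_univ]
    simp [chi, prod_mul_distrib]
  rw [this]
  split_ifs with h
  · subst h; simp [sg_mul_self]; norm_num
  · obtain ⟨i, hi⟩ := Function.ne_iff.1 h
    apply prod_eq_zero (mem_univ i)
    revert hi; cases x i <;> cases y i <;> simp [sg]

lemma fourier_inversion (g : (ι → Bool) → ℝ) (x : ι → Bool) : g x = ∑ S, fc g S * chi S x := by
  unfold fc
  simp_rw [← Ex_mul_right]
  rw [← Ex_sum]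
  simp_rw [mul_assoc, ← mul_sum]
  simp_rw [sum_chi_mul_chi]
  unfold Ex; simp

lemma parseval (g h : (ι → Bool) → ℝ) : Ex (fun x => g x * h x) = ∑ S, fc g S * fc h S := by
  conv_lhs => enter [1, x]; rw [fourier_inversion h x, mul_sum]
  rw [Ex_sum]
  refine sum_congr rfl fun S _ => ?_
  have : ∀ x, g x * (fc h S * chi S x) = fc h S * (g x * chi S x) := fun x => by ring
  simp_rw [this, Ex_mul_left]; rw [mul_comm]; rfl

lemma parseval_sq (g : (ι → Bool) → ℝ) : Ex (fun x => g x ^ 2) = ∑ S, fc g S ^ 2 := by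
  simp_rw [sq]; exact parseval g g

/-- `g` has Fourier degree at most `K`. -/
def FDeg (K : ℕ) (g : (ι → Bool) → ℝ) : Prop := ∀ S : Finset ι, K < S.card → fc g S = 0

/-- The fourth power of the `ℓ⁴` norm of the Fourier transform. -/
def fourNorm (g : (ι → Bool) → ℝ) : ℝ := ∑ S, fc g S ^ 4

lemma bonami_aux (V : Finset ι) : ∀ c : Finset ι → ℝ,
    Ex (fun x => (∑ S ∈ V.powerset, c S * chi S x) ^ 4)
      ≤ (∑ S ∈ V.powerset, 3 ^ S.card * c S ^ 2) ^ 2 := by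
  induction V using Finset.induction_on with
  | empty => intro c; simp [chi, Ex_const]; exact le_of_eq (by ring)
  | insert a V ha ih =>
    intro c
    set g0 : (ι → Bool) → ℝ := fun x => ∑ S ∈ V.powerset, c S * chi S x with hg0
    set g1 : (ι → Bool) → ℝ := fun x => ∑ S ∈ V.powerset, c (insert a S) * chi S x with hg1
    have hna : ∀ S ∈ V.powerset, a ∉ S := fun S hS h => ha (mem_powerset.1 hS h)
    have hsum : ∀ x, ∑ S ∈ (insert a V).powerset, c S * chi S x = g0 x + sg (x a) * g1 x := by
      intro x
      rw [sum_powerset_insert ha, hg0, hg1, mul_sum]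
      congr 1
      refine sum_congr rfl fun S hS => ?_
      rw [chi, prod_insert (hna S hS), chi]; ring
    have d0 : DepOn V g0 := fun x y h => sum_congr rfl fun S hS => by
      rw [(depOn_chi S).mono (mem_powerset.1 hS) x y h]
    have d1 : DepOn V g1 := fun x y h => sum_congr rfl fun S hS => by
      rw [(depOn_chi S).mono (mem_powerset.1 hS) x y h]
    have hodd : ∀ F : ℝ → ℝ → ℝ, Ex (fun x => sg (x a) * F (g0 x) (g1 x)) = 0 := by
      intro F
      have := Ex_chi_mul (mem_singleton_self a) (d0.comp2 d1 F) ha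
      simpa [chi] using this
    have hexp : Ex (fun x => (∑ S ∈ (insert a V).powerset, c S * chi S x) ^ 4)
        = Ex (fun x => g0 x ^ 4) + 6 * Ex (fun x => g0 x ^ 2 * g1 x ^ 2)
          + Ex (fun x => g1 x ^ 4) := by
      have h1 : ∀ x, (∑ S ∈ (insert a V).powerset, c S * chi S x) ^ 4
          = (g0 x ^ 4 + 6 * (g0 x ^ 2 * g1 x ^ 2) + g1 x ^ 4)
            + (sg (x a) * (4 * g0 x ^ 3 * g1 x + 4 * g0 x * g1 x ^ 3)) := by
        intro x
        rw [hsum]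
        have h2 := sg_sq (x a)
        have h3 : sg (x a) ^ 3 = sg (x a) := by rw [pow_succ, h2, one_mul]
        have h4 : sg (x a) ^ 4 = 1 := by rw [show 4 = 2 * 2 from rfl, pow_mul, h2, one_pow]
        linear_combination (6 * g0 x ^ 2 * g1 x ^ 2) * h2 + 4 * g0 x * g1 x ^ 3 * h3 + g1 x ^ 4 * h4
      rw [funext h1, Ex_add, hodd (fun u v => 4 * u ^ 3 * v + 4 * u * v ^ 3), add_zero, Ex_add, Ex_add, Ex_mul_left]
    have hs2 : ∑ S ∈ (insert a V).powerset, (3 : ℝ) ^ S.card * c S ^ 2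
        = ∑ S ∈ V.powerset, 3 ^ S.card * c S ^ 2
          + 3 * ∑ S ∈ V.powerset, 3 ^ S.card * c (insert a S) ^ 2 := by
      rw [sum_powerset_insert ha, mul_sum]
      congr 1
      refine sum_congr rfl fun S hS => ?_
      rw [card_insert_of_notMem (hna S hS)]; ring
    rw [hexp, hs2]
    set A := ∑ S ∈ V.powerset, (3 : ℝ) ^ S.card * c S ^ 2
    set B := ∑ S ∈ V.powerset, (3 : ℝ) ^ S.card * c (insert a S) ^ 2
    have hA : 0 ≤ A := sum_nonneg fun _ _ => by positivity
    have hB : 0 ≤ B := sum_nonneg fun _ _ => by positivity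
    have e0 : Ex (fun x => g0 x ^ 4) ≤ A ^ 2 := ih c
    have e1 : Ex (fun x => g1 x ^ 4) ≤ B ^ 2 := ih fun S => c (insert a S)
    have e2 : Ex (fun x => g0 x ^ 2 * g1 x ^ 2) ≤ A * B := by
      have := Ex_mul_sq_le (fun x => g0 x ^ 2) (fun x => g1 x ^ 2)
      simp_rw [← pow_mul] at this
      norm_num at this
      apply abs_le_of_sq_le_sq' _ (mul_nonneg hA hB) |>.2
      calc _ ≤ _ := this
        _ ≤ A ^ 2 * B ^ 2 := mul_le_mul e0 e1 (Ex_nonneg fun x => by positivity) (by positivity)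
        _ = _ := by ring
    nlinarith [mul_nonneg hB hB]

lemma bonami {K : ℕ} (c : Finset ι → ℝ) (hc : ∀ S, K < S.card → c S = 0) :
    Ex (fun x => (∑ S, c S * chi S x) ^ 4) ≤ 9 ^ K * (∑ S, c S ^ 2) ^ 2 := by
  have h := bonami_aux univ c
  rw [powerset_univ] at h
  refine h.trans ?_
  have : ∑ S, (3 : ℝ) ^ S.card * c S ^ 2 ≤ 3 ^ K * ∑ S, c S ^ 2 := by
    rw [mul_sum]
    refine sum_le_sum fun S _ => ?_
    rcases le_or_gt S.card K with h | h
    · gcongr; norm_num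
    · simp [hc S h]
  calc _ ≤ (3 ^ K * ∑ S, c S ^ 2) ^ 2 := by
        gcongr
    _ = _ := by rw [mul_pow, ← pow_mul, mul_comm K 2, pow_mul]; norm_num

lemma Ex_bxor (z : ι → Bool) (F : (ι → Bool) → ℝ) : Ex (fun x => F (bxor x z)) = Ex F :=
  Ex_equiv (⟨fun x => bxor x z, fun x => bxor x z, fun x => by ext i; simp [bxor],
    fun x => by ext i; simp [bxor]⟩ : (ι → Bool) ≃ (ι → Bool)) F

omit [Fintype ι] [DecidableEq ι] in
lemma bxor_comm (x z : ι → Bool) : bxor x z = bxor z x := by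
  ext i; simp [bxor, Bool.xor_comm]

/-- Multiplicative derivative. -/
def mder (g : (ι → Bool) → ℝ) (z x : ι → Bool) : ℝ := g x * g (bxor x z)

lemma Ex_sq_eq_mder (g : (ι → Bool) → ℝ) :
    Ex g ^ 2 = Ex (fun z => Ex (fun x => mder g z x)) := by
  rw [Ex_comm]
  unfold mder
  have : ∀ x, Ex (fun z => g x * g (bxor x z)) = g x * Ex g := fun x => by
    rw [Ex_mul_left]; simp_rw [bxor_comm x]; rw [Ex_bxor]
  simp_rw [this]; rw [Ex_mul_right, sq]

lemma fc_mder (q : (ι → Bool) → ℝ) (z : ι → Bool) (T : Finset ι) :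
    fc (mder q z) T = ∑ S, (fc q S * fc q (symmDiff S T)) * chi S z := by
  unfold fc mder
  have : ∀ x, q x * q (bxor x z) * chi T x
      = ∑ S, (fc q S * chi S z) * (q x * chi (symmDiff S T) x) := by
    intro x
    rw [fourier_inversion q (bxor x z), mul_sum, sum_mul]
    refine sum_congr rfl fun S _ => ?_
    rw [chi_bxor, ← chi_mul]; ring
  simp_rw [this]
  rw [Ex_sum]
  refine sum_congr rfl fun S _ => ?_
  rw [Ex_mul_left]; unfold fc; ring

omit [Fintype ι] in
lemma card_symmDiff_ge (S T : Finset ι) : T.card ≤ S.card + (symmDiff S T).card := by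
  calc T.card ≤ (S ∪ symmDiff S T).card := by
        apply card_le_card; intro i hi
        by_cases h : i ∈ S <;> simp [h, hi, mem_symmDiff]
    _ ≤ _ := card_union_le _ _

lemma FDeg.mder {K : ℕ} {q : (ι → Bool) → ℝ} (hq : FDeg K q) (z : ι → Bool) :
    FDeg (2 * K) (mder q z) := by
  intro T hT
  rw [fc_mder]
  refine sum_eq_zero fun S _ => ?_
  rcases le_or_gt S.card K with h | h
  · rw [hq (symmDiff S T) (by have := card_symmDiff_ge S T; omega)]; ring
  · rw [hq S h]; ring

lemma sum_symmDiff (T : Finset ι) (F : Finset ι → ℝ) : ∑ S, F (symmDiff S T) = ∑ S, F S :=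
  Equiv.sum_comp (⟨fun S => symmDiff S T, fun S => symmDiff S T,
    fun _ => symmDiff_symmDiff_cancel_right _ _, fun _ => symmDiff_symmDiff_cancel_right _ _⟩ :
    Finset ι ≃ Finset ι) F

lemma Ex_fourNorm_mder {K : ℕ} {q : (ι → Bool) → ℝ} (hq : FDeg K q) :
    Ex (fun z => fourNorm (mder q z)) ≤ 9 ^ K * fourNorm q * Ex (fun x => q x ^ 2) ^ 2 := by
  unfold fourNorm
  rw [Ex_sum]
  set b : Finset ι → ℝ := fun T => ∑ S, fc q S ^ 2 * fc q (symmDiff S T) ^ 2 with hb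
  have hb0 : ∀ T, 0 ≤ b T := fun T => sum_nonneg fun _ _ => by positivity
  have h1 : ∀ T, Ex (fun z => fc (mder q z) T ^ 4) ≤ 9 ^ K * b T ^ 2 := by
    intro T
    simp_rw [fc_mder]
    refine (bonami (K := K) _ ?_).trans_eq ?_
    · intro S hS; rw [hq S hS, zero_mul]
    · simp_rw [mul_pow]; rfl
  have h2 : ∀ T, b T ≤ ∑ S, fc q S ^ 4 := by
    intro T
    have : ∀ S, fc q S ^ 2 * fc q (symmDiff S T) ^ 2
        ≤ (fc q S ^ 4) / 2 + (fc q (symmDiff S T) ^ 4) / 2 := fun S => by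
      nlinarith [sq_nonneg (fc q S ^ 2 - fc q (symmDiff S T) ^ 2)]
    calc b T ≤ ∑ S, ((fc q S ^ 4) / 2 + (fc q (symmDiff S T) ^ 4) / 2) :=
          sum_le_sum fun S _ => this S
      _ = _ := by
          rw [sum_add_distrib, sum_symmDiff T (fun S => fc q S ^ 4 / 2), ← sum_div]; ring
  have h3 : ∑ T, b T = Ex (fun x => q x ^ 2) ^ 2 := by
    rw [parseval_sq, hb, sum_comm, sq, sum_mul]
    refine sum_congr rfl fun S _ => ?_
    rw [← mul_sum]
    congr 1
    simp_rw [symmDiff_comm S]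
    exact sum_symmDiff S (fun T => fc q T ^ 2)
  calc _ ≤ ∑ T, 9 ^ K * b T ^ 2 := sum_le_sum fun T _ => h1 T
    _ ≤ ∑ T, 9 ^ K * ((∑ S, fc q S ^ 4) * b T) := by
        gcongr with T
        rw [sq]; exact mul_le_mul_of_nonneg_right (h2 T) (hb0 T)
    _ = _ := by rw [← mul_sum, ← mul_sum, h3]; ring

/-! ### Sign-valued polynomials and low-degree functions with small Fourier coefficients -/

/-- Sign-valued functions all of whose `(d+1)`-fold multiplicative derivatives are trivial. -/
def SignPoly : ℕ → ((ι → Bool) → ℝ) → Prop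
  | 0, p => (∀ x, p x = 1) ∨ (∀ x, p x = -1)
  | d + 1, p => (∀ x, p x = 1 ∨ p x = -1) ∧ ∀ z, SignPoly d (mder p z)

omit [Fintype ι] [DecidableEq ι] in
lemma SignPoly.sign {d : ℕ} {p : (ι → Bool) → ℝ} (h : SignPoly d p) (x : ι → Bool) :
    p x = 1 ∨ p x = -1 := by
  cases d with
  | zero => exact h.imp (· x) (· x)
  | succ d => exact h.1 x

lemma sign_mul_sign {a b : ℝ} (ha : a = 1 ∨ a = -1) (hb : b = 1 ∨ b = -1) : a * b = 1 ∨ a * b = -1 := by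
  rcases ha with rfl | rfl <;> rcases hb with rfl | rfl <;> simp

omit [Fintype ι] [DecidableEq ι] in
lemma SignPoly.succ {d : ℕ} : ∀ {p : (ι → Bool) → ℝ}, SignPoly d p → SignPoly (d + 1) p := by
  induction d with
  | zero =>
    intro p h
    refine ⟨h.sign, fun z => Or.inl fun x => ?_⟩
    rcases h with h | h <;> simp [mder, h]
  | succ d ih => intro p h; exact ⟨h.1, fun z => ih (h.2 z)⟩

omit [Fintype ι] [DecidableEq ι] in
lemma SignPoly.mono {d e : ℕ} (hde : d ≤ e) {p : (ι → Bool) → ℝ} (h : SignPoly d p) : SignPoly e p := by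
  induction hde with
  | refl => exact h
  | step _ ih => exact ih.succ

omit [Fintype ι] [DecidableEq ι] in
lemma mder_mul (p q : (ι → Bool) → ℝ) (z : ι → Bool) :
    mder (fun x => p x * q x) z = fun x => mder p z x * mder q z x := by
  ext x; unfold mder; ring

omit [Fintype ι] [DecidableEq ι] in
lemma SignPoly.mul {d : ℕ} : ∀ {p q : (ι → Bool) → ℝ}, SignPoly d p → SignPoly d q →
    SignPoly d (fun x => p x * q x) := by
  induction d with
  | zero =>
    intro p q hp hq
    rcases hp with hp | hp <;> rcases hq with hq | hq <;> simp [SignPoly, hp, hq]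
  | succ d ih =>
    intro p q hp hq
    refine ⟨fun x => sign_mul_sign (hp.1 x) (hq.1 x), fun z => ?_⟩
    rw [mder_mul]
    exact ih (hp.2 z) (hq.2 z)

omit [Fintype ι] [DecidableEq ι] in
lemma signPoly_one (d : ℕ) : SignPoly d (fun _ : ι → Bool => (1 : ℝ)) :=
  SignPoly.mono (Nat.zero_le d) (Or.inl fun _ => rfl)

omit [Fintype ι] [DecidableEq ι] in
lemma SignPoly.prod {d : ℕ} {κ : Type*} [DecidableEq κ] (s : Finset κ) {p : κ → (ι → Bool) → ℝ}
    (h : ∀ k ∈ s, SignPoly d (p k)) : SignPoly d (fun x => ∏ k ∈ s, p k x) := by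
  induction s using Finset.induction_on with
  | empty => simpa using signPoly_one d
  | insert a s ha ih =>
    simp_rw [prod_insert ha]
    exact (h a (mem_insert_self _ _)).mul (ih fun k hk => h k (mem_insert_of_mem hk))

/-- `R` on the half-cube `x a = b` and `1` on the other half. -/
def gate (a : ι) (b : Bool) (R : (ι → Bool) → ℝ) (x : ι → Bool) : ℝ := if x a = b then R x else 1

omit [Fintype ι] [DecidableEq ι] in
lemma SignPoly.gate {d : ℕ} (a : ι) : ∀ (b : Bool) {R : (ι → Bool) → ℝ}, SignPoly d R →
    SignPoly (d + 1) (gate a b R) := by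
  induction d with
  | zero =>
    intro b R hR
    refine ⟨fun x => ?_, fun z => ?_⟩
    · unfold _root_.gate; split_ifs
      · exact hR.sign x
      · exact Or.inl rfl
    · rcases hR with hR | hR
      · left; intro x; simp [mder, _root_.gate, hR]
      · cases hz : z a
        · left; intro x; simp [mder, _root_.gate, hR, bxor, hz]; split_ifs <;> norm_num
        · right; intro x; simp only [mder, _root_.gate, hR, bxor, hz]
          cases x a <;> cases b <;> simp
  | succ d ih =>
    intro b R hR
    refine ⟨fun x => ?_, fun z => ?_⟩
    · unfold _root_.gate; split_ifs
      · exact hR.sign x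
      · exact Or.inl rfl
    · cases hz : z a
      · have : mder (_root_.gate a b R) z = _root_.gate a b (mder R z) := by
          ext x; simp only [mder, _root_.gate, bxor, hz, Bool.xor_false]
          split_ifs <;> simp
        rw [this]; exact ih b (hR.2 z)
      · have : mder (_root_.gate a b R) z = fun x => R x * _root_.gate a (!b) (mder R z) x := by
          ext x
          simp only [mder, _root_.gate, bxor, hz]
          have hs : R x * R x = 1 := by rcases hR.sign x with h | h <;> simp [h]
          cases x a <;> cases b <;> simp [← mul_assoc, hs]
        rw [this]; exact hR.mul (ih (!b) (hR.2 z))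

omit [Fintype ι] in
lemma signPoly_of_depOn (T : Finset ι) : ∀ {p : (ι → Bool) → ℝ}, DepOn T p →
    (∀ x, p x = 1 ∨ p x = -1) → SignPoly T.card p := by
  induction T using Finset.induction_on with
  | empty =>
    intro p hp hs
    have h0 : ∀ x, p x = p (fun _ => false) := fun x => hp _ _ (by simp)
    rcases hs (fun _ => false) with h | h
    · left; intro x; rw [h0, h]
    · right; intro x; rw [h0, h]
  | insert a T ha ih =>
    intro p hp hs
    set p0 : (ι → Bool) → ℝ := fun x => p (Function.update x a false) with hp0
    set p1 : (ι → Bool) → ℝ := fun x => p (Function.update x a true) with hp1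
    have hd : ∀ b, DepOn T (fun x => p (Function.update x a b)) := by
      intro b x y h
      apply hp
      intro i hi
      by_cases hia : i = a
      · subst hia; simp
      · simp [hia, h i ((mem_insert.1 hi).resolve_left hia)]
    have i0 : SignPoly T.card p0 := ih (hd false) fun x => hs _
    have i1 : SignPoly T.card p1 := ih (hd true) fun x => hs _
    have : p = fun x => p0 x * _root_.gate a true (fun x => p0 x * p1 x) x := by
      ext x
      have hsq : p0 x * p0 x = 1 := by rcases i0.sign x with h | h <;> simp [h]
      unfold _root_.gate
      split_ifs with h
      · rw [← mul_assoc, hsq, one_mul, hp1]; simp only; rw [← h, Function.update_eq_self]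
      · rw [mul_one, hp0]; simp only
        rw [show false = x a by simpa using (Bool.eq_false_iff.2 h).symm, Function.update_eq_self]
    rw [this, card_insert_of_notMem ha]
    exact i0.succ.mul ((i0.mul i1).gate a true)

end Fourier

/-- A bounded low-degree function with small Fourier `ℓ⁴` norm is nearly orthogonal to
sign polynomials of bounded degree. -/
lemma gowers_type (d : ℕ) : ∀ (K : ℕ) (M η : ℝ), 0 < M → 0 < η → ∃ γ > 0,
    ∀ (ι : Type) [Fintype ι] [DecidableEq ι] (p q : (ι → Bool) → ℝ), SignPoly d p → FDeg K q →
      Ex (fun x => q x ^ 2) ≤ M → fourNorm q ≤ γ → |Ex (fun x => p x * q x)| ≤ η := by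
  induction d with
  | zero =>
    intro K M η hM hη
    refine ⟨η ^ 4, by positivity, ?_⟩
    intro ι _ _ p q hp hq hqM hA
    have h1 : |Ex (fun x => p x * q x)| = |fc q ∅| := by
      unfold fc
      rcases hp with hp | hp <;> simp [hp, chi, Ex_neg]
    rw [h1]
    have h2 : fc q ∅ ^ 4 ≤ η ^ 4 := by
      refine le_trans ?_ hA
      exact single_le_sum (f := fun S => fc q S ^ 4) (fun S _ => by positivity) (mem_univ ∅)
    rw [← abs_of_pos hη]
    by_contra! hlt
    exact absurd (pow_lt_pow_left₀ hlt (abs_nonneg _) (n := 4) (by norm_num))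
      (not_lt.2 (by rwa [Even.pow_abs (by decide), Even.pow_abs (by decide)]))
  | succ d ih =>
    intro K M η hM hη
    set r : ℝ := 4 * M ^ 2 / η ^ 2 + 1 with hr
    have hr0 : 0 < r := by positivity
    obtain ⟨γ', hγ', H⟩ := ih (2 * K) (r ^ 2) (η ^ 2 / 2) (by positivity) (by positivity)
    refine ⟨γ' * η ^ 2 / (4 * (r * 9 ^ K * M ^ 2)), by positivity, ?_⟩
    intro ι _ _ p q hp hq hqM hA
    have hE0 : 0 ≤ Ex (fun x => q x ^ 2) := Ex_nonneg fun x => by positivity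
    have hpsq : ∀ x, p x ^ 2 = 1 := fun x => by rcases hp.sign x with h | h <;> simp [h]
    set s : (ι → Bool) → ℝ := fun z => Ex (fun x => mder q z x ^ 2) with hs
    have hs0 : ∀ z, 0 ≤ s z := fun z => Ex_nonneg fun x => by positivity
    have hfn0 : ∀ z, 0 ≤ fourNorm (mder q z) := fun z => sum_nonneg fun _ _ => by positivity
    have hz : ∀ z, |Ex (fun x => mder p z x * mder q z x)|
        ≤ η ^ 2 / 2 + (s z / r + r / γ' * fourNorm (mder q z)) := by
      intro z
      have hcs : |Ex (fun x => mder p z x * mder q z x)| ≤ √(s z) := by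
        apply Real.abs_le_sqrt
        refine (Ex_mul_sq_le _ _).trans ?_
        have : ∀ x, mder p z x ^ 2 = 1 := fun x => by simp [mder, mul_pow, hpsq]
        simp_rw [this]; rw [Ex_const, one_mul]
      have hf : 0 ≤ r / γ' * fourNorm (mder q z) := mul_nonneg (by positivity) (hfn0 z)
      have hsr : 0 ≤ s z / r := div_nonneg (hs0 z) hr0.le
      by_cases hb1 : s z ≤ r ^ 2
      · by_cases hb2 : fourNorm (mder q z) ≤ γ'
        · have := H ι (mder p z) (mder q z) (hp.2 z) (hq.mder z) hb1 hb2
          linarith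
        · push Not at hb2
          have h1 : √(s z) ≤ r := Real.sqrt_le_iff.2 ⟨hr0.le, hb1⟩
          have h2 : r ≤ r / γ' * fourNorm (mder q z) := by
            rw [div_mul_eq_mul_div, le_div_iff₀ hγ']; nlinarith
          nlinarith [sq_nonneg η]
      · push Not at hb1
        have h1 : r ≤ √(s z) := Real.le_sqrt_of_sq_le hb1.le
        have h2 : √(s z) ≤ s z / r := by
          rw [le_div_iff₀ hr0]
          nlinarith [Real.mul_self_sqrt (hs0 z), Real.sqrt_nonneg (s z)]
        nlinarith [sq_nonneg η]
    have hmain : Ex (fun x => p x * q x) ^ 2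
        ≤ η ^ 2 / 2 + (M ^ 2 / r + r / γ' * (9 ^ K * fourNorm q * M ^ 2)) := by
      rw [Ex_sq_eq_mder]
      simp_rw [mder_mul]
      refine (le_abs_self _).trans ((abs_Ex_le _).trans ((Ex_mono hz).trans ?_))
      rw [Ex_add, Ex_const, Ex_add, Ex_div, Ex_mul_left]
      have e1 : Ex s = Ex (fun x => q x ^ 2) ^ 2 := by
        rw [Ex_sq_eq_mder]; simp only [hs]
        congr 1; ext z; congr 1; ext x; unfold mder; ring
      have e2 : Ex s ≤ M ^ 2 := by rw [e1]; gcongr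
      have e3 := Ex_fourNorm_mder hq
      have e4 : 9 ^ K * fourNorm q * Ex (fun x => q x ^ 2) ^ 2 ≤ 9 ^ K * fourNorm q * M ^ 2 := by
        have : 0 ≤ fourNorm q := sum_nonneg fun _ _ => by positivity
        gcongr
      gcongr
      exact e3.trans e4
    have f1 : M ^ 2 / r ≤ η ^ 2 / 4 := by
      rw [div_le_iff₀ hr0, hr]; field_simp; nlinarith [sq_nonneg η]
    have f2 : r / γ' * (9 ^ K * fourNorm q * M ^ 2) ≤ η ^ 2 / 4 := by
      calc _ ≤ r / γ' * (9 ^ K * (γ' * η ^ 2 / (4 * (r * 9 ^ K * M ^ 2))) * M ^ 2) := by gcongr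
        _ = η ^ 2 / 4 := by field_simp
    rw [← abs_of_pos hη]
    apply sq_le_sq.1
    linarith

/-! ### Low-degree functions and moments of the normalized weight -/

section Degree
variable {ι : Type} [Fintype ι] [DecidableEq ι]

lemma FDeg.mono {K L : ℕ} (h : K ≤ L) {g : (ι → Bool) → ℝ} (hg : FDeg K g) : FDeg L g :=
  fun S hS => hg S (by omega)

lemma fc_add (g h : (ι → Bool) → ℝ) (S : Finset ι) :
    fc (fun x => g x + h x) S = fc g S + fc h S := by
  unfold fc; simp_rw [add_mul]; rw [Ex_add]

lemma fc_sum {κ : Type*} (s : Finset κ) (g : κ → (ι → Bool) → ℝ) (S : Finset ι) :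
    fc (fun x => ∑ k ∈ s, g k x) S = ∑ k ∈ s, fc (g k) S := by
  unfold fc; simp_rw [sum_mul]; rw [Ex_sum]

lemma fc_mul_left (c : ℝ) (g : (ι → Bool) → ℝ) (S : Finset ι) :
    fc (fun x => c * g x) S = c * fc g S := by
  unfold fc; simp_rw [mul_assoc]; rw [Ex_mul_left]

lemma fc_mul (g h : (ι → Bool) → ℝ) (S : Finset ι) :
    fc (fun x => g x * h x) S = ∑ T, fc g T * fc h (symmDiff S T) := by
  have : fc (fun x => g x * h x) S = Ex (fun x => g x * (h x * chi S x)) := by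
    unfold fc; simp_rw [mul_assoc]
  rw [this, parseval]
  refine sum_congr rfl fun T _ => ?_
  congr 1
  unfold fc; simp_rw [mul_assoc, chi_mul]

lemma FDeg.mul {K L : ℕ} {g h : (ι → Bool) → ℝ} (hg : FDeg K g) (hh : FDeg L h) :
    FDeg (K + L) (fun x => g x * h x) := by
  intro S hS
  rw [fc_mul]
  refine sum_eq_zero fun T _ => ?_
  rcases le_or_gt T.card K with h | h
  · rw [hh _ (by have := card_symmDiff_ge T S; rw [symmDiff_comm T S] at this; omega), mul_zero]
  · rw [hg T h, zero_mul]

lemma fc_of_depOn {T S : Finset ι} {g : (ι → Bool) → ℝ} (hg : DepOn T g) (h : ¬ S ⊆ T) :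
    fc g S = 0 := by
  obtain ⟨a, ha, haT⟩ := not_subset.1 h
  unfold fc; simp_rw [mul_comm (g _)]; exact Ex_chi_mul ha hg haT

lemma FDeg.of_depOn {T : Finset ι} {g : (ι → Bool) → ℝ} (hg : DepOn T g) : FDeg T.card g :=
  fun _ hS => fc_of_depOn hg fun h => absurd (card_le_card h) (by omega)

lemma FDeg.sum {κ : Type*} {s : Finset κ} {g : κ → (ι → Bool) → ℝ} {K : ℕ}
    (h : ∀ k ∈ s, FDeg K (g k)) : FDeg K (fun x => ∑ k ∈ s, g k x) := fun S hS => by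
  rw [fc_sum]; exact sum_eq_zero fun k hk => h k hk S hS

lemma FDeg.const_mul {K : ℕ} (c : ℝ) {g : (ι → Bool) → ℝ} (hg : FDeg K g) :
    FDeg K (fun x => c * g x) := fun S hS => by rw [fc_mul_left, hg S hS, mul_zero]

lemma fDeg_const (c : ℝ) : FDeg 0 (fun _ : ι → Bool => c) :=
  FDeg.of_depOn (T := ∅) fun _ _ _ => rfl

lemma FDeg.pow {K : ℕ} {g : (ι → Bool) → ℝ} (hg : FDeg K g) (k : ℕ) :
    FDeg (k * K) (fun x => g x ^ k) := by
  induction k with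
  | zero => simpa using (fDeg_const (1 : ℝ) : FDeg 0 (fun _ : ι → Bool => (1 : ℝ)))
  | succ k ih => simp_rw [pow_succ]; rw [Nat.succ_mul]; exact ih.mul hg

lemma fc_empty (g : (ι → Bool) → ℝ) : fc g ∅ = Ex g := by
  unfold fc; simp [chi]

end Degree

section Moments
variable {n : ℕ}

/-- Normalized signed weight. -/
def Yv (y : Fin n → Bool) : ℝ := (∑ i, sg (y i)) / √n

/-- Moments of the normalized weight of a uniform string. -/
def mom (n k : ℕ) : ℝ := Ex (fun y : Fin n → Bool => Yv y ^ k)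

lemma fDeg_Yv : FDeg 1 (Yv (n := n)) := by
  have : Yv (n := n) = fun y => (√n)⁻¹ * ∑ i, sg (y i) := by
    ext y; rw [Yv, div_eq_inv_mul]
  rw [this]
  refine FDeg.const_mul _ (FDeg.sum fun i _ => ?_)
  have := FDeg.of_depOn (T := {i}) (g := fun y : Fin n → Bool => sg (y i))
    (fun x y h => by simp only [h i (mem_singleton_self i)])
  simpa using this

lemma Ex_exp_Yv (l : ℝ) : Ex (fun y : Fin n → Bool => Real.exp (l * Yv y)) ≤ Real.exp (l ^ 2 / 2) := by
  have h1 : ∀ y : Fin n → Bool, Real.exp (l * Yv y) = ∏ i, Real.exp (l / √n * sg (y i)) := by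
    intro y; rw [← Real.exp_sum, ← mul_sum, Yv]; congr 1; ring
  simp_rw [h1]
  rw [Ex_prod_of_disjoint univ (A := fun i => {i})]
  · have h2 : ∀ i : Fin n, Ex (fun y : Fin n → Bool => Real.exp (l / √n * sg (y i)))
        ≤ Real.exp ((l / √n) ^ 2 / 2) := by
      intro i
      rw [Ex_coord i (fun b => Real.exp (l / √n * sg b))]
      refine le_trans (le_of_eq ?_) (Real.cosh_le_exp_half_sq _)
      rw [Real.cosh_eq]; simp [sg]; ring
    refine (prod_le_prod (fun i _ => Ex_nonneg fun y => (Real.exp_pos _).le)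
      (fun i _ => h2 i)).trans ?_
    rw [prod_const, ← Real.exp_nat_mul, Real.exp_le_exp]
    rcases Nat.eq_zero_or_pos n with rfl | hn
    · simp; positivity
    · have hn' : (0 : ℝ) < n := by exact_mod_cast hn
      rw [div_pow, Real.sq_sqrt hn'.le]; simp; field_simp; exact le_rfl
  · intro i _ x y h; simp only [h i (mem_singleton_self i)]
  · intro k _ l _ h; simpa using h

lemma mom_even_le (k : ℕ) {l : ℝ} (hl : 0 < l) :
    mom n (2 * k) ≤ 2 * (2 * k).factorial / l ^ (2 * k) * Real.exp (l ^ 2 / 2) := by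
  have hp : ∀ y : Fin n → Bool, Yv y ^ (2 * k)
      ≤ (2 * k).factorial / l ^ (2 * k) * (Real.exp (l * Yv y) + Real.exp (-l * Yv y)) := by
    intro y
    have h1 := Real.pow_div_factorial_le_exp (x := |l * Yv y|) (abs_nonneg _) (2 * k)
    rw [Even.pow_abs (by simp), mul_pow] at h1
    have h2 : Real.exp |l * Yv y| ≤ Real.exp (l * Yv y) + Real.exp (-l * Yv y) := by
      rcases abs_choice (l * Yv y) with h | h <;> rw [h]
      · linarith [Real.exp_pos (-l * Yv y)]
      · rw [neg_mul]; linarith [Real.exp_pos (l * Yv y)]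
    have h3 := h1.trans h2
    rw [div_mul_eq_mul_div, le_div_iff₀ (by positivity)]
    rw [div_le_iff₀ (by positivity)] at h3
    linarith
  refine (Ex_mono hp).trans ?_
  rw [Ex_mul_left, Ex_add]
  have e1 := Ex_exp_Yv (n := n) l
  have e2 := Ex_exp_Yv (n := n) (-l)
  rw [neg_sq] at e2
  have : (0 : ℝ) ≤ (2 * k).factorial / l ^ (2 * k) := by positivity
  calc _ ≤ ((2 * k).factorial / l ^ (2 * k) : ℝ) * (Real.exp (l ^ 2 / 2) + Real.exp (l ^ 2 / 2)) := by
        gcongr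
    _ = _ := by ring

lemma mom_even_nonneg (k : ℕ) : 0 ≤ mom n (2 * k) :=
  Ex_nonneg fun y => by rw [pow_mul]; positivity

/-- A bound on the even moments which is uniform in `n`. -/
def momB (k : ℕ) : ℝ := 2 * (2 * k).factorial * Real.exp (1 / 2)

lemma mom_even_le_momB (k : ℕ) : mom n (2 * k) ≤ momB k := by
  have := mom_even_le (n := n) k one_pos
  simpa [momB] using this

lemma momB_pos (k : ℕ) : 0 < momB k := by unfold momB; positivity

lemma Ex_chi_univ_Yv_pow {k : ℕ} (hk : k < n) :
    Ex (fun y : Fin n → Bool => chi univ y * Yv y ^ k) = 0 := by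
  have := (fDeg_Yv (n := n)).pow k univ (by simpa using hk)
  rw [fc] at this
  rw [← this]; congr 1; ext y; ring

lemma abs_fc_Yv_pow_le (k : ℕ) {T : Finset (Fin n)} (hT : T.Nonempty) :
    |fc (fun y => Yv y ^ k) T| ≤ 2 * k * (1 + momB k) / √n := by
  obtain ⟨a, ha⟩ := hT
  have hn : 0 < n := a.pos
  set g : (Fin n → Bool) → ℝ := fun y => Yv y ^ k with hg
  have hchi : ∀ y, chi T (flipAt a y) = - chi T y := by
    intro y
    rw [chi, ← mul_prod_erase T _ ha, chi, ← mul_prod_erase T _ ha]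
    have : ∏ i ∈ T.erase a, sg (flipAt a y i) = ∏ i ∈ T.erase a, sg (y i) :=
      prod_congr rfl fun i hi => by simp [flipAt, ne_of_mem_erase hi]
    rw [this]
    have : sg (flipAt a y a) = - sg (y a) := by simp [flipAt]; cases y a <;> simp [sg]
    rw [this]; ring
  have hY : ∀ y, |Yv y - Yv (flipAt a y)| ≤ 2 / √n := by
    intro y
    have : Yv y - Yv (flipAt a y) = (2 * sg (y a)) / √n := by
      rw [Yv, Yv, ← sub_div, ← sum_sub_distrib, sum_eq_single a]
      · simp [flipAt]; cases y a <;> simp [sg] <;> ring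
      · intro i _ hi; simp [flipAt, hi]
      · simp
    rw [this, abs_div, abs_of_nonneg (Real.sqrt_nonneg _)]
    gcongr
    cases y a <;> simp [sg]
  have h1 : fc g T = Ex (fun y => (g y - g (flipAt a y)) * chi T y) / 2 := by
    have e1 : fc g T = - Ex (fun y => g (flipAt a y) * chi T y) := by
      rw [fc, ← Ex_equiv (flipAt a), ← Ex_neg]
      simp_rw [hchi]; congr 1; ext y; ring
    simp_rw [sub_mul]
    rw [Ex_sub]
    have e2 : fc g T = Ex (fun y => g y * chi T y) := rfl
    linarith
  have hpt : ∀ y, |(g y - g (flipAt a y)) * chi T y|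
      ≤ 2 / √n * (k * ((1 + Yv y ^ (2 * k)) + (1 + Yv (flipAt a y) ^ (2 * k)))) := by
    intro y
    rw [abs_mul, abs_chi, mul_one]
    have hb : ∀ u : ℝ, |u| ^ (k - 1) ≤ 1 + u ^ (2 * k) := by
      intro u
      rw [← Even.pow_abs (by simp : Even (2 * k))]
      rcases le_total |u| 1 with h | h
      · linarith [pow_le_one₀ (n := k - 1) (abs_nonneg u) h, pow_nonneg (abs_nonneg u) (2 * k)]
      · linarith [pow_le_pow_right₀ h (show k - 1 ≤ 2 * k by omega)]
    refine (abs_pow_sub_pow_le _ _ k).trans ?_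
    have hm : max |Yv y| |Yv (flipAt a y)| ^ (k - 1)
        ≤ (1 + Yv y ^ (2 * k)) + (1 + Yv (flipAt a y) ^ (2 * k)) := by
      have h0 : ∀ u : ℝ, 0 ≤ 1 + u ^ (2 * k) := fun u => by rw [pow_mul]; positivity
      rcases max_choice |Yv y| |Yv (flipAt a y)| with h | h <;> rw [h]
      · linarith [hb (Yv y), h0 (Yv (flipAt a y))]
      · linarith [hb (Yv (flipAt a y)), h0 (Yv y)]
    rw [← mul_assoc]
    exact mul_le_mul (mul_le_mul_of_nonneg_right (hY y) (by positivity)) hm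
      (by positivity) (by positivity)
  have h2 : |Ex (fun y => (g y - g (flipAt a y)) * chi T y)|
      ≤ 2 / √n * (k * ((1 + mom n (2 * k)) + (1 + mom n (2 * k)))) := by
    refine (abs_Ex_le _).trans ((Ex_mono hpt).trans_eq ?_)
    rw [Ex_mul_left, Ex_mul_left, Ex_add, Ex_equiv (flipAt a) (fun y => 1 + Yv y ^ (2 * k)),
      Ex_add, Ex_const]; rfl
  rw [h1, abs_div, abs_two, div_le_div_iff₀ two_pos (by positivity)]
  have hs : (0 : ℝ) < √n := by positivity
  calc _ ≤ 2 / √n * (k * ((1 + mom n (2 * k)) + (1 + mom n (2 * k)))) * √n := by gcongr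
    _ = 4 * k * (1 + mom n (2 * k)) := by field_simp; ring
    _ ≤ 4 * k * (1 + momB k) := by gcongr; exact mom_even_le_momB k
    _ = _ := by ring

end Moments

/-! ### Second moment tools -/

section Cheb
variable {Ω : Type*} [Fintype Ω]

lemma Ex_sq_sum {κ : Type*} [DecidableEq κ] (s : Finset κ) (h : κ → Ω → ℝ)
    (h0 : ∀ i ∈ s, ∀ j ∈ s, i ≠ j → Ex (fun x => h i x * h j x) = 0) :
    Ex (fun x => (∑ i ∈ s, h i x) ^ 2) = ∑ i ∈ s, Ex (fun x => h i x ^ 2) := by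
  simp_rw [sq, sum_mul_sum]
  rw [Ex_sum]
  refine sum_congr rfl fun i hi => ?_
  rw [Ex_sum, sum_eq_single i]
  · intro j hj hji; exact h0 i hi j hj hji.symm
  · intro h; exact absurd hi h

lemma Ex_ite_le_div {P : Ω → Prop} [DecidablePred P] {g : Ω → ℝ} {t : ℝ} (ht : 0 < t)
    (hg : ∀ x, 0 ≤ g x) (hP : ∀ x, P x → t ≤ g x) :
    Ex (fun x => if P x then (1 : ℝ) else 0) ≤ Ex g / t := by
  rw [← Ex_div]
  apply Ex_mono; intro x
  split_ifs with h
  · rw [le_div_iff₀ ht, one_mul]; exact hP x h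
  · exact div_nonneg (hg x) ht.le

end Cheb

section CubeCov
variable {ι : Type*} [Fintype ι] [DecidableEq ι]

/-- Centred functions of disjoint sets of coordinates: second moment of the sum. -/
lemma Ex_sq_sum_centred {κ : Type*} [DecidableEq κ] (s : Finset κ) {B : κ → Finset ι}
    {g : κ → (ι → Bool) → ℝ} (hg : ∀ k ∈ s, DepOn (B k) (g k))
    (hB : ∀ k ∈ s, ∀ l ∈ s, k ≠ l → Disjoint (B k) (B l)) :
    Ex (fun x => (∑ k ∈ s, (g k x - Ex (g k))) ^ 2) ≤ ∑ k ∈ s, Ex (fun x => g k x ^ 2) := by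
  rw [Ex_sq_sum]
  · refine sum_le_sum fun k hk => ?_
    have : ∀ x, (g k x - Ex (g k)) ^ 2 = g k x ^ 2 - (2 * Ex (g k)) * g k x + Ex (g k) ^ 2 :=
      fun x => by ring
    simp_rw [this]
    rw [Ex_add, Ex_sub, Ex_mul_left, Ex_const]
    nlinarith [sq_nonneg (Ex (g k))]
  · intro i hi j hj hij
    rw [Ex_mul_of_disjoint ((hg i hi).comp fun u => u - Ex (g i))
      ((hg j hj).comp fun u => u - Ex (g j)) (hB i hi j hj hij), Ex_sub, Ex_const]
    simp

end CubeCov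

/-! ### Sunflowers -/

lemma exists_sunflower (r D : ℕ) : ∃ R : ℕ,
    ∀ (ι : Type) [DecidableEq ι] {κ : Type} [DecidableEq κ] (F : Finset κ) (N : κ → Finset ι), (∀ t ∈ F, (N t).card ≤ D) →
      R ≤ F.card → ∃ (V : Finset ι) (F' : Finset κ), V.card ≤ D ∧ F' ⊆ F ∧ r ≤ F'.card ∧
        ∀ t ∈ F', ∀ u ∈ F', t ≠ u → Disjoint (N t \ V) (N u \ V) := by
  induction D with
  | zero =>
    refine ⟨r, fun ι _ κ _ F N hN hF => ⟨∅, F, by simp, Subset.rfl, hF, fun t ht u _ _ => ?_⟩⟩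
    have := hN t ht
    rw [Nat.le_zero, card_eq_zero] at this
    simp [this]
  | succ D ih =>
    obtain ⟨R, hR⟩ := ih
    refine ⟨r + (r * (D + 1)) * R + 1, fun ι _ κ _ F N hN hF => ?_⟩
    set 𝒮 := F.powerset.filter fun G => ∀ t ∈ G, ∀ u ∈ G, t ≠ u → Disjoint (N t) (N u) with h𝒮
    have hne : 𝒮.Nonempty := ⟨∅, by simp [h𝒮]⟩
    obtain ⟨G, hG, hmax⟩ := exists_max_image 𝒮 card hne
    rw [h𝒮, mem_filter, mem_powerset] at hG
    rcases le_or_gt r G.card with hr | hr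
    · exact ⟨∅, G, by simp, hG.1, hr, fun t ht u hu htu => by simpa using hG.2 t ht u hu htu⟩
    set X := G.biUnion N with hX
    have hXc : X.card ≤ r * (D + 1) := by
      refine card_biUnion_le.trans ((sum_le_card_nsmul _ _ (D + 1) fun t ht => hN t (hG.1 ht)).trans ?_)
      rw [smul_eq_mul]; exact Nat.mul_le_mul_right _ hr.le
    have hmeet : ∀ t ∈ F \ G, ∃ v ∈ X, v ∈ N t := by
      intro t ht
      rw [mem_sdiff] at ht
      by_contra! hcon
      have hd : ∀ u ∈ G, Disjoint (N t) (N u) := fun u hu =>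
        disjoint_left.2 fun v hv hvu => hcon v (mem_biUnion.2 ⟨u, hu, hvu⟩) hv
      have : insert t G ∈ 𝒮 := by
        rw [h𝒮, mem_filter, mem_powerset]
        refine ⟨insert_subset ht.1 hG.1, fun a ha b hb hab => ?_⟩
        rcases mem_insert.1 ha with rfl | ha' <;> rcases mem_insert.1 hb with rfl | hb'
        · exact absurd rfl hab
        · exact hd b hb'
        · exact (hd a ha').symm
        · exact hG.2 a ha' b hb' hab
      have := hmax _ this
      rw [card_insert_of_notMem ht.2] at this
      omega
    have hcov : F \ G ⊆ X.biUnion fun v => (F \ G).filter fun t => v ∈ N t := by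
      intro t ht
      obtain ⟨v, hv, hvt⟩ := hmeet t ht
      exact mem_biUnion.2 ⟨v, hv, mem_filter.2 ⟨ht, hvt⟩⟩
    have hFG : (r * (D + 1)) * R < (F \ G).card := by
      have := le_card_sdiff G F; omega
    obtain ⟨v, hv, hvR⟩ : ∃ v ∈ X, R ≤ ((F \ G).filter fun t => v ∈ N t).card := by
      by_contra! hcon
      have h1 := (card_le_card hcov).trans (card_biUnion_le.trans
        (sum_le_card_nsmul _ _ R fun v hv => (hcon v hv).le))
      rw [smul_eq_mul] at h1
      have := Nat.mul_le_mul_right R hXc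
      omega
    obtain ⟨V, F', hV, hF', hr', hdis⟩ := hR ι ((F \ G).filter fun t => v ∈ N t)
      (fun t => (N t).erase v) (fun t ht => by
        rw [mem_filter, mem_sdiff] at ht
        rw [card_erase_of_mem ht.2]
        have := hN t ht.1.1; omega) hvR
    refine ⟨insert v V, F', (card_insert_le _ _).trans (by omega),
      fun t ht => (mem_sdiff.1 (mem_filter.1 (hF' ht)).1).1, hr', fun t ht u hu htu => ?_⟩
    have := hdis t ht u hu htu
    have he : ∀ W : Finset ι, W \ insert v V = W.erase v \ V := fun W => by
      ext i; simp only [mem_sdiff, mem_insert, mem_erase]; tauto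
    rwa [he, he]

/-! ### Dichotomy: small correlations with moments, or a restriction living on a small set -/

section Law
variable {ι : Type} [Fintype ι] [DecidableEq ι] {n : ℕ}

/-- Locality with an explicit choice of neighbourhoods. -/
def Loc (d : ℕ) (f : (ι → Bool) → (Fin n → Bool)) : Prop :=
  ∃ T : Fin n → Finset ι, (∀ i, (T i).card ≤ d) ∧ ∀ i, DepOn (T i) (fun x => f x i)

/-- The probability mass function of `f` at a uniform input. -/
def law (f : (ι → Bool) → (Fin n → Bool)) (y : Fin n → Bool) : ℝ :=
  Ex (fun x => if f x = y then (1 : ℝ) else 0)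

omit [Fintype ι] in
lemma Loc.ov {d : ℕ} {f : (ι → Bool) → (Fin n → Bool)} (h : Loc d f) (V : Finset ι)
    (x : ι → Bool) : Loc d (fun y => f (ov V x y)) := by
  obtain ⟨T, hT, hf⟩ := h
  exact ⟨fun i => T i \ V, fun i => (card_le_card sdiff_subset).trans (hT i),
    fun i => (hf i).ov x⟩

lemma law_nonneg (f : (ι → Bool) → (Fin n → Bool)) (y : Fin n → Bool) : 0 ≤ law f y :=
  Ex_nonneg fun x => by split_ifs <;> norm_num

lemma sum_law_mul (f : (ι → Bool) → (Fin n → Bool)) (τ : (Fin n → Bool) → ℝ) :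
    ∑ y, law f y * τ y = Ex (fun x => τ (f x)) := by
  unfold law
  simp_rw [← Ex_mul_right]
  rw [← Ex_sum]; simp

lemma Ex_cond (V : Finset ι) (F : (ι → Bool) → ℝ) :
    Ex F = (1 / 2) ^ V.card * ∑ A ∈ V.powerset, Ex (fun y => F (ov V (ind A) y)) := by
  rw [← Ex_ov V F]
  refine Ex_of_depOn V (H := fun x => Ex (fun y => F (ov V x y))) fun x x' h => ?_
  have : ∀ y, ov V x y = ov V x' y := fun y => by
    funext i
    unfold ov; split_ifs with hi
    · exact h i hi
    · rfl
  simp only [this]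

omit [Fintype ι] in
lemma depOn_chi_comp {f : (ι → Bool) → (Fin n → Bool)} {N : Fin n → Finset ι}
    (hN : ∀ i, DepOn (N i) (fun x => f x i)) (T : Finset (Fin n)) :
    DepOn (T.biUnion N) (fun x => chi T (f x)) := by
  unfold chi
  exact DepOn.prod fun i _ => (hN i).comp sg

lemma card_div_eq_Ex (E : Finset (Fin n → Bool)) :
    (E.card : ℝ) / 2 ^ n = Ex (fun y => if y ∈ E then (1 : ℝ) else 0) := by
  unfold Ex; simp

omit [Fintype ι] [DecidableEq ι] in
lemma chi_int (T : Finset ι) (x : ι → Bool) : ∃ k : ℤ, chi T x = k := by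
  rcases (abs_eq zero_le_one).1 (abs_chi T x) with h | h
  · exact ⟨1, by simp [h]⟩
  · exact ⟨-1, by simp [h]⟩

/-- Many nonvanishing independent output characters give a test distinguishing `f` from uniform. -/
lemma exists_test_of_disjoint {D : ℕ} {f : (ι → Bool) → (Fin n → Bool)} {N : Fin n → Finset ι}
    (hN : ∀ i, DepOn (N i) (fun x => f x i)) {F : Finset (Finset (Fin n))}
    (hcard : ∀ T ∈ F, (T.biUnion N).card ≤ D)
    (hdis : ∀ T ∈ F, ∀ T' ∈ F, T ≠ T' → Disjoint (T.biUnion N) (T'.biUnion N))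
    (hnz : ∀ T ∈ F, Ex (fun x => chi T (f x)) ≠ 0) (hF : F.Nonempty) :
    ∃ E : Finset (Fin n → Bool),
      Ex (fun x => if f x ∈ E then (0 : ℝ) else 1) ≤ 4 ^ (D + 1) / F.card ∧
      (E.card : ℝ) / 2 ^ n ≤ 4 ^ (D + 1) / F.card := by
  set σ : Finset (Fin n) → ℝ := fun T => if 0 < Ex (fun x => chi T (f x)) then 1 else -1 with hσ
  have hσ2 : ∀ T, σ T * σ T = 1 := fun T => by simp only [hσ]; split_ifs <;> norm_num
  set Z : (Fin n → Bool) → ℝ := fun y => ∑ T ∈ F, σ T * chi T y with hZ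
  have hF0 : (0 : ℝ) < F.card := by exact_mod_cast hF.card_pos
  set a : ℝ := F.card * (1 / 2) ^ D / 2 with ha
  have ha0 : 0 < a := by positivity
  have hval : (F.card : ℝ) / a ^ 2 = 4 ^ (D + 1) / F.card := by
    have h4 : (4 : ℝ) ^ D = 2 ^ D * 2 ^ D := by rw [← mul_pow]; norm_num
    rw [ha, one_div, inv_pow, pow_succ 4, h4]; field_simp; norm_num
  refine ⟨univ.filter fun y => a ≤ Z y, ?_, ?_⟩
  · have hg : ∀ T ∈ F, DepOn (T.biUnion N) (fun x => σ T * chi T (f x)) := fun T _ =>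
      (depOn_chi_comp hN T).comp (σ T * ·)
    have hmean : ∀ T ∈ F, (1 / 2 : ℝ) ^ D ≤ Ex (fun x => σ T * chi T (f x)) := by
      intro T hT
      have h1 := one_le_abs_Ex_of_depOn (depOn_chi_comp hN T) (fun x => chi_int T _) (hnz T hT)
      have h2 : (1 / 2 : ℝ) ^ D ≤ (1 / 2) ^ (T.biUnion N).card :=
        pow_le_pow_of_le_one (by norm_num) (by norm_num) (hcard T hT)
      rw [Ex_mul_left]
      refine (h2.trans h1).trans_eq ?_
      simp only [hσ]
      split_ifs with h
      · rw [abs_of_pos h, one_mul]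
      · rw [abs_of_nonpos (not_lt.1 h)]; ring
    have hvar := Ex_sq_sum_centred F hg hdis
    have hv2 : ∑ T ∈ F, Ex (fun x => (σ T * chi T (f x)) ^ 2) = F.card := by
      have : ∀ T x, (σ T * chi T (f x)) ^ 2 = 1 := fun T x => by
        rw [mul_pow, chi_sq, sq, hσ2, one_mul]
      simp_rw [this]; simp [Ex_const]
    have hmean' : 2 * a ≤ ∑ T ∈ F, Ex (fun x => σ T * chi T (f x)) := by
      have := card_nsmul_le_sum F _ _ hmean
      rw [nsmul_eq_mul] at this; rw [ha]; linarith
    have := Ex_ite_le_div (P := fun x => ¬ a ≤ Z (f x)) (pow_pos ha0 2)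
      (g := fun x => (∑ T ∈ F, (σ T * chi T (f x) - Ex (fun x => σ T * chi T (f x)))) ^ 2)
      (fun x => sq_nonneg _) (fun x hx => by
        rw [not_le] at hx
        rw [sum_sub_distrib]
        have : ∑ T ∈ F, σ T * chi T (f x) < a := hx
        nlinarith)
    rw [← hval]
    have e : (fun x => if f x ∈ univ.filter (fun y => a ≤ Z y) then (0 : ℝ) else 1)
        = fun x => if ¬ a ≤ Z (f x) then (1 : ℝ) else 0 := by
      ext x; simp only [mem_filter, mem_univ, true_and]; split_ifs <;> simp_all
    rw [e]
    refine this.trans ?_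
    gcongr
    exact hvar.trans_eq hv2
  · rw [card_div_eq_Ex, ← hval]
    simp only [mem_filter, mem_univ, true_and]
    refine (Ex_ite_le_div (P := fun y => a ≤ Z y) (pow_pos ha0 2) (g := fun y => Z y ^ 2)
      (fun y => sq_nonneg _) (fun y hy => by gcongr)).trans ?_
    gcongr
    rw [hZ, Ex_sq_sum]
    · have : ∀ T (x : Fin n → Bool), (σ T * chi T x) ^ 2 = 1 := fun T x => by
        rw [mul_pow, chi_sq, sq, hσ2, one_mul]
      simp_rw [this]; simp [Ex_const]
    · intro T _ T' _ hTT'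
      have : ∀ y : Fin n → Bool, σ T * chi T y * (σ T' * chi T' y)
          = (σ T * σ T') * chi (symmDiff T T') y := fun y => by rw [← chi_mul]; ring
      simp_rw [this]
      rw [Ex_mul_left, Ex_chi, if_neg, mul_zero]
      rwa [← bot_eq_empty, symmDiff_eq_bot]

lemma FDeg.comp_local {d : ℕ} {f : (ι → Bool) → (Fin n → Bool)} (h : Loc d f) (k : ℕ) :
    FDeg (k * d) (fun x => Yv (f x) ^ k) := by
  obtain ⟨T, hT, hf⟩ := h
  refine FDeg.pow ?_ k
  have : (fun x => Yv (f x)) = fun x => (√n)⁻¹ * ∑ i, sg (f x i) := by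
    ext y; rw [Yv, div_eq_inv_mul]
  rw [this]
  exact FDeg.const_mul _ (FDeg.sum fun i _ => (FDeg.of_depOn ((hf i).comp sg)).mono (hT i))

end Law

/-- Either all Fourier coefficients of the centred moments are small, or after fixing boundedly
many input bits `f` lives on a small set. -/
lemma good_or_test (d k1 : ℕ) {γ θ : ℝ} (hγ : 0 < γ) (hθ : 0 < θ) : ∃ N : ℕ, ∀ n, N ≤ n →
    ∀ (ι : Type) [Fintype ι] [DecidableEq ι] (f : (ι → Bool) → (Fin n → Bool)), Loc d f →
    (∀ k ≤ k1, ∀ S, |fc (fun x => Yv (f x) ^ k - mom n k) S| ≤ γ) ∨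
    ∃ (V A : Finset ι) (E : Finset (Fin n → Bool)), V.card ≤ 2 * k1 * d ∧ A ⊆ V ∧
      Ex (fun x => if f (ov V (ind A) x) ∈ E then (0 : ℝ) else 1) ≤ θ ∧
      (E.card : ℝ) / 2 ^ n ≤ θ := by
  set D := k1 * d with hD
  obtain ⟨r, hr⟩ := exists_nat_gt ((4 : ℝ) ^ (D + 1) / θ)
  have hr0 : 0 < r := by
    have : (0 : ℝ) < r := lt_trans (by positivity) hr
    exact_mod_cast this
  set s := 2 * k1 * d with hs
  obtain ⟨Cm, hCm0, hCm⟩ : ∃ Cm : ℝ, 0 < Cm ∧ ∀ k ≤ k1, 2 * k * (1 + momB k) ≤ Cm := by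
    refine ⟨∑ k ∈ range (k1 + 1), 2 * k * (1 + momB k) + 1, ?_, fun k hk => ?_⟩
    · have : 0 ≤ ∑ k ∈ range (k1 + 1), 2 * (k : ℝ) * (1 + momB k) :=
        sum_nonneg fun k _ => by have := momB_pos k; positivity
      linarith
    · have := single_le_sum (f := fun k : ℕ => 2 * (k : ℝ) * (1 + momB k)) (s := range (k1 + 1))
        (fun k _ => by have := momB_pos k; positivity) (mem_range.2 (Nat.lt_succ_of_le hk))
      linarith
  obtain ⟨R, hR⟩ := exists_sunflower (2 ^ s * r) D
  obtain ⟨N0, hN0⟩ := exists_nat_gt ((R * Cm / γ) ^ 2)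
  refine ⟨N0 + 1, fun n hn ι _ _ f hf => ?_⟩
  by_contra! hcon
  obtain ⟨⟨k, hk, S, hS⟩, hcon⟩ := hcon
  have hn0 : (0 : ℝ) < n := by exact_mod_cast (show 0 < n by omega)
  have hsq : R * Cm / γ < √n := by
    apply Real.lt_sqrt_of_sq_lt
    refine hN0.trans_le ?_
    exact_mod_cast (show N0 ≤ n by omega)
  have hScard : S.card ≤ D := by
    by_contra! h
    have h1 : FDeg D (fun x => Yv (f x) ^ k + (-1) * mom n k) := fun S' hS' => by
      rw [fc_add, (FDeg.comp_local hf k).mono (Nat.mul_le_mul_right d hk) S' hS',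
        (fDeg_const ((-1) * mom n k)) S' (by omega), add_zero]
    have h2 := h1 S h
    simp_rw [neg_one_mul, ← sub_eq_add_neg] at h2
    rw [h2, abs_zero] at hS
    linarith
  obtain ⟨T, hT, hfT⟩ := hf
  set a : Finset (Fin n) → ℝ := fc (fun y => Yv y ^ k) with ha
  set e : Finset (Fin n) → ℝ := fun W => Ex (fun x => chi S x * chi W (f x)) with he
  have hexp : fc (fun x => Yv (f x) ^ k - mom n k) S = ∑ W ∈ univ.erase ∅, a W * e W := by
    have h1 : ∀ x, Yv (f x) ^ k - mom n k = ∑ W ∈ univ.erase ∅, a W * chi W (f x) := by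
      intro x
      have h2 := fourier_inversion (fun y : Fin n → Bool => Yv y ^ k) (f x)
      rw [← add_sum_erase _ _ (mem_univ ∅), fc_empty] at h2
      rw [h2]; simp [chi, mom, ha]
    unfold fc
    simp_rw [h1, sum_mul]
    rw [Ex_sum]
    refine sum_congr rfl fun W _ => ?_
    rw [he, ← Ex_mul_left]; congr 1; ext x; ring
  set F : Finset (Finset (Fin n)) := univ.filter fun W => W ≠ ∅ ∧ a W ≠ 0 ∧ e W ≠ 0 with hF
  have hFk : ∀ W ∈ F, W.card ≤ k := by
    intro W hW
    by_contra! h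
    rw [hF, mem_filter] at hW
    exact hW.2.2.1 ((fDeg_Yv.pow k) W (by omega))
  have hFcard : R ≤ F.card := by
    have h1 : |∑ W ∈ univ.erase ∅, a W * e W| ≤ F.card * (Cm / √n) := by
      have h2 : ∑ W ∈ univ.erase ∅, a W * e W = ∑ W ∈ F, a W * e W := by
        symm; apply sum_subset
        · intro W hW; rw [hF, mem_filter] at hW; exact mem_erase.2 ⟨hW.2.1, mem_univ _⟩
        · intro W hW hWF
          by_contra h
          exact hWF (mem_filter.2 ⟨mem_univ _, (mem_erase.1 hW).1, left_ne_zero_of_mul h,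
            right_ne_zero_of_mul h⟩)
      rw [h2]
      refine (abs_sum_le_sum_abs _ _).trans ((sum_le_card_nsmul _ _ (Cm / √n) ?_).trans_eq
        (by simp))
      intro W hW
      rw [abs_mul]
      have h3 : |e W| ≤ 1 := abs_Ex_le_of fun x => by rw [abs_mul, abs_chi, abs_chi, one_mul]
      have h4 : |a W| ≤ Cm / √n := by
        refine (abs_fc_Yv_pow_le k (nonempty_iff_ne_empty.2 (mem_filter.1 hW).2.1)).trans ?_
        gcongr
        exact hCm k hk
      calc |a W| * |e W| ≤ Cm / √n * 1 := by gcongr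
        _ = _ := mul_one _
    rw [hexp] at hS
    have h5 : γ < F.card * (Cm / √n) := hS.trans_le h1
    have hsn : 0 < √(n : ℝ) := Real.sqrt_pos.2 hn0
    rw [← mul_div_assoc, lt_div_iff₀ hsn] at h5
    rw [div_lt_iff₀ hγ] at hsq
    have h6 : (R : ℝ) * Cm < F.card * Cm := by linarith
    exact_mod_cast (lt_of_mul_lt_mul_right h6 hCm0.le).le
  have hbi : ∀ W ∈ F, (W.biUnion T).card ≤ D := fun W hW => by
    refine card_biUnion_le.trans ((sum_le_card_nsmul _ _ d fun i _ => hT i).trans ?_)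
    rw [smul_eq_mul]; exact Nat.mul_le_mul_right d ((hFk W hW).trans hk)
  obtain ⟨V0, F', hV0, hF', hr', hdis⟩ := hR ι F (fun W => W.biUnion T) hbi hFcard
  set V := V0 ∪ S with hV
  have hVs : V.card ≤ s := (card_union_le _ _).trans (by rw [hs]; rw [mul_assoc]; omega)
  have hex : ∀ W ∈ F', ∃ A ∈ V.powerset, Ex (fun y => chi W (f (ov V (ind A) y))) ≠ 0 := by
    intro W hW
    have h1 : e W ≠ 0 := (mem_filter.1 (hF' hW)).2.2.2
    by_contra! hcon2
    apply h1
    simp only [he]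
    rw [Ex_cond V]
    rw [sum_eq_zero, mul_zero]
    intro A hA
    have h2 : ∀ y, chi S (ov V (ind A) y) = chi S (ind A) := fun y =>
      depOn_chi S _ _ fun i hi => ov_of_mem (mem_union_right _ hi)
    simp_rw [h2, Ex_mul_left, hcon2 A hA, mul_zero]
  choose! Af hAf hAne using hex
  obtain ⟨A, hA, hAr⟩ := exists_le_card_fiber_of_mul_le_card_of_maps_to (n := r) hAf
    (powerset_nonempty V) (by
      rw [card_powerset]
      exact (Nat.mul_le_mul_right r (Nat.pow_le_pow_right two_pos hVs)).trans hr')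
  set F'' := F'.filter fun W => Af W = A with hF''
  have hbs : ∀ W : Finset (Fin n), (W.biUnion fun i => T i \ V) = W.biUnion T \ V := fun W => by
    ext j; simp only [mem_biUnion, mem_sdiff]
    constructor
    · rintro ⟨i, hi, hj, hjV⟩; exact ⟨⟨i, hi, hj⟩, hjV⟩
    · rintro ⟨⟨i, hi, hj⟩, hjV⟩; exact ⟨i, hi, hj, hjV⟩
  obtain ⟨E, hE1, hE2⟩ := exists_test_of_disjoint (D := D) (f := fun y => f (ov V (ind A) y))
    (N := fun i => T i \ V) (fun i => (hfT i).ov _) (F := F'')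
    (fun W hW => by
      rw [hbs]
      exact (card_le_card sdiff_subset).trans (hbi W (hF' (mem_filter.1 hW).1)))
    (fun W hW W' hW' hne => by
      rw [hbs, hbs]
      have := hdis W (mem_filter.1 hW).1 W' (mem_filter.1 hW').1 hne
      refine this.mono (sdiff_subset_sdiff Subset.rfl subset_union_left)
        (sdiff_subset_sdiff Subset.rfl subset_union_left))
    (fun W hW => by
      have := hAne W (mem_filter.1 hW).1
      rwa [(mem_filter.1 hW).2] at this)
    (card_pos.1 (by omega))
  have hfin : (4 : ℝ) ^ (D + 1) / F''.card ≤ θ := by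
    have hrF : (r : ℝ) ≤ F''.card := by exact_mod_cast hAr
    have hr1 : (0 : ℝ) < r := by exact_mod_cast hr0
    rw [div_le_iff₀ (by linarith)]
    rw [div_lt_iff₀ hθ] at hr
    nlinarith
  exact absurd (hE2.trans hfin) (not_le.2 (hcon V A E hVs (mem_powerset.1 hA) (hE1.trans hfin)))

/-! ### Decomposition of the output law according to moments -/

lemma FDeg.sub_const {ι : Type} [Fintype ι] [DecidableEq ι] {K : ℕ} {g : (ι → Bool) → ℝ}
    (hg : FDeg K g) (c : ℝ) : FDeg K (fun x => g x - c) := fun S hS => by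
  simp_rw [sub_eq_add_neg]
  rw [fc_add, hg S hS, (fDeg_const (-c)) S (by omega), add_zero]

lemma moments_of_good (d K0 : ℕ) {γ' : ℝ} (hγ' : 0 < γ') : ∃ γ > 0, ∀ (n : ℕ) (ι : Type) [Fintype ι]
    [DecidableEq ι] (f : (ι → Bool) → (Fin n → Bool)), Loc d f →
    (∀ k ≤ 2 * K0, ∀ S, |fc (fun x => Yv (f x) ^ k - mom n k) S| ≤ γ) →
    ∀ k ≤ K0, |Ex (fun x => Yv (f x) ^ k - mom n k)| ≤ γ' ∧
      |Ex (fun x => chi univ (f x) * (Yv (f x) ^ k - mom n k))| ≤ γ' := by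
  obtain ⟨M, hM0, hM⟩ : ∃ M : ℝ, 0 < M ∧ ∀ k ≤ K0, 4 * momB k + 2 ≤ M := by
    refine ⟨∑ k ∈ range (K0 + 1), (4 * momB k + 2) + 1, ?_, fun k hk => ?_⟩
    · have : 0 ≤ ∑ k ∈ range (K0 + 1), (4 * momB k + 2) :=
        sum_nonneg fun k _ => by have := momB_pos k; positivity
      linarith
    · have := single_le_sum (f := fun k : ℕ => 4 * momB k + 2) (s := range (K0 + 1))
        (fun k _ => by have := momB_pos k; positivity) (mem_range.2 (Nat.lt_succ_of_le hk))
      linarith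
  obtain ⟨γ1, hγ1, H⟩ := gowers_type d (K0 * d) M γ' hM0 hγ'
  refine ⟨min 1 (min γ' (γ1 / M)), by positivity, fun n ι _ _ f hf hgood k hk => ?_⟩
  have g1 : ∀ k ≤ 2 * K0, ∀ S, |fc (fun x => Yv (f x) ^ k - mom n k) S| ≤ 1 :=
    fun k hk S => (hgood k hk S).trans (min_le_left _ _)
  have g2 : ∀ k ≤ 2 * K0, ∀ S, |fc (fun x => Yv (f x) ^ k - mom n k) S| ≤ γ1 / M :=
    fun k hk S => (hgood k hk S).trans ((min_le_right _ _).trans (min_le_right _ _))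
  set q : (ι → Bool) → ℝ := fun x => Yv (f x) ^ k - mom n k with hq
  constructor
  · have := (hgood k (by omega) ∅).trans ((min_le_right _ _).trans (min_le_left _ _))
    rwa [fc_empty] at this
  · have hE : Ex (fun x => q x ^ 2) ≤ M := by
      refine le_trans ?_ (hM k hk)
      have h1 : ∀ x, q x ^ 2 ≤ 2 * (Yv (f x) ^ (2 * k) - mom n (2 * k))
          + (2 * mom n (2 * k) + 2 * mom n k ^ 2) := fun x => by
        simp only [hq]
        rw [mul_comm 2 k, pow_mul]
        nlinarith [sq_nonneg (Yv (f x) ^ k + mom n k)]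
      refine (Ex_mono h1).trans ?_
      rw [Ex_add, Ex_mul_left, Ex_const]
      have h2 := g1 (2 * k) (by omega) ∅
      rw [fc_empty] at h2
      have h3 : mom n k ^ 2 ≤ mom n (2 * k) := by
        refine (sq_Ex_le _).trans_eq ?_
        unfold mom; congr 1; ext y; rw [← pow_mul, mul_comm]
      have h4 := mom_even_le_momB (n := n) k
      have h5 := (le_abs_self _).trans h2
      linarith
    apply H ι _ q
    · obtain ⟨T, hT, hfT⟩ := hf
      unfold chi
      refine SignPoly.prod univ fun i _ => ?_
      refine (signPoly_of_depOn (T i) ((hfT i).comp sg) fun x => ?_).mono (hT i)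
      cases f x i <;> simp [sg]
    · exact ((FDeg.comp_local hf k).mono (Nat.mul_le_mul_right d hk)).sub_const _
    · exact hE
    · have hb : ∀ S, fc q S ^ 4 ≤ γ1 / M * fc q S ^ 2 := fun S => by
        have h1 : fc q S ^ 2 ≤ γ1 / M := by
          have e1 := g1 k (by omega) S
          have e2 := g2 k (by omega) S
          rw [← sq_abs]
          nlinarith [abs_nonneg (fc q S)]
        nlinarith [sq_nonneg (fc q S)]
      calc fourNorm q ≤ ∑ S, γ1 / M * fc q S ^ 2 := sum_le_sum fun S _ => hb S
        _ = γ1 / M * Ex (fun x => q x ^ 2) := by rw [← mul_sum, parseval_sq]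
        _ ≤ γ1 / M * M := by gcongr
        _ = γ1 := by field_simp

section Dec
variable {ι : Type} [Fintype ι] [DecidableEq ι] {n : ℕ}

/-- The law of `f` splits into a part with nearly Gaussian moments (also when twisted by parity),
a part supported on a small set, and a part of small mass. -/
def Dec (K0 : ℕ) (γ θ μ D : ℝ) (f : (ι → Bool) → (Fin n → Bool)) : Prop :=
  ∃ PG PB PL : (Fin n → Bool) → ℝ, (∀ y, 0 ≤ PG y) ∧ (∀ y, 0 ≤ PB y) ∧ (∀ y, 0 ≤ PL y) ∧
    (∀ y, law f y = PG y + PB y + PL y) ∧ ∑ y, PL y ≤ μ ∧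
    (∀ k ≤ K0, |∑ y, PG y * (Yv y ^ k - mom n k)| ≤ γ ∧
      |∑ y, PG y * (chi univ y * (Yv y ^ k - mom n k))| ≤ γ) ∧
    ∃ E : Finset (Fin n → Bool), ∑ y, PB y * (if y ∈ E then 0 else 1) ≤ θ ∧
      (E.card : ℝ) / 2 ^ n ≤ D

lemma dec_of_moments {K0 : ℕ} {γ θ μ D : ℝ} (hθ : 0 ≤ θ) (hμ : 0 ≤ μ) (hD : 0 ≤ D)
    {f : (ι → Bool) → (Fin n → Bool)}
    (h : ∀ k ≤ K0, |Ex (fun x => Yv (f x) ^ k - mom n k)| ≤ γ ∧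
      |Ex (fun x => chi univ (f x) * (Yv (f x) ^ k - mom n k))| ≤ γ) : Dec K0 γ θ μ D f := by
  refine ⟨law f, fun _ => 0, fun _ => 0, law_nonneg f, fun _ => le_rfl, fun _ => le_rfl,
    fun y => by ring, by simpa using hμ, fun k hk => ?_, ∅, by simpa using hθ, by simpa using hD⟩
  rw [sum_law_mul f (fun y => Yv y ^ k - mom n k),
    sum_law_mul f (fun y => chi univ y * (Yv y ^ k - mom n k))]
  exact h k hk

lemma law_cond (V : Finset ι) (f : (ι → Bool) → (Fin n → Bool)) (y : Fin n → Bool) :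
    law f y = ∑ A ∈ V.powerset, (1 / 2) ^ V.card * law (fun x => f (ov V (ind A) x)) y := by
  rw [← mul_sum]; exact Ex_cond V _

lemma dec_of_cond {K0 : ℕ} {γ θ D : ℝ} (V : Finset ι) {μ : Finset ι → ℝ}
    {f : (ι → Bool) → (Fin n → Bool)}
    (h : ∀ A ∈ V.powerset, Dec K0 γ θ (μ A) D (fun x => f (ov V (ind A) x))) :
    Dec K0 γ θ (∑ A ∈ V.powerset, (1 / 2) ^ V.card * μ A) (2 ^ V.card * D) f := by
  unfold Dec at h
  choose! PG PB PL hG hB hL hsum hμ hmom E hE1 hE2 using h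
  have hw0 : (0 : ℝ) ≤ (1 / 2) ^ V.card := by positivity
  have hw1 : ∑ _A ∈ V.powerset, (1 / 2 : ℝ) ^ V.card = 1 := by
    rw [sum_const, card_powerset, nsmul_eq_mul]; push_cast
    rw [← mul_pow]; norm_num
  have havg : ∀ c : ℝ, ∑ _A ∈ V.powerset, (1 / 2 : ℝ) ^ V.card * c = c := fun c => by
    rw [← sum_mul, hw1, one_mul]
  have hswap : ∀ (P : Finset ι → (Fin n → Bool) → ℝ) (τ : (Fin n → Bool) → ℝ),
      ∑ y, (∑ A ∈ V.powerset, (1 / 2) ^ V.card * P A y) * τ y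
        = ∑ A ∈ V.powerset, (1 / 2) ^ V.card * ∑ y, P A y * τ y := fun P τ => by
    simp_rw [sum_mul, mul_sum]
    rw [sum_comm]
    exact sum_congr rfl fun A _ => sum_congr rfl fun y _ => by ring
  have habs : ∀ (P : Finset ι → (Fin n → Bool) → ℝ) (τ : (Fin n → Bool) → ℝ) (c : ℝ),
      (∀ A ∈ V.powerset, |∑ y, P A y * τ y| ≤ c) →
      |∑ y, (∑ A ∈ V.powerset, (1 / 2) ^ V.card * P A y) * τ y| ≤ c := fun P τ c hc => by
    rw [hswap]
    refine (abs_sum_le_sum_abs _ _).trans ?_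
    rw [← havg c]
    refine sum_le_sum fun A hA => ?_
    rw [abs_mul, abs_of_nonneg hw0]
    exact mul_le_mul_of_nonneg_left (hc A hA) hw0
  refine ⟨fun y => ∑ A ∈ V.powerset, (1 / 2) ^ V.card * PG A y,
    fun y => ∑ A ∈ V.powerset, (1 / 2) ^ V.card * PB A y,
    fun y => ∑ A ∈ V.powerset, (1 / 2) ^ V.card * PL A y,
    fun y => sum_nonneg fun A hA => mul_nonneg hw0 (hG A hA y),
    fun y => sum_nonneg fun A hA => mul_nonneg hw0 (hB A hA y),
    fun y => sum_nonneg fun A hA => mul_nonneg hw0 (hL A hA y), fun y => ?_, ?_, fun k hk => ?_,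
    V.powerset.biUnion E, ?_, ?_⟩
  · rw [law_cond V, ← sum_add_distrib, ← sum_add_distrib]
    refine sum_congr rfl fun A hA => ?_
    rw [hsum A hA]; ring
  · rw [sum_comm]
    refine sum_le_sum fun A hA => ?_
    rw [← mul_sum]
    exact mul_le_mul_of_nonneg_left (hμ A hA) hw0
  · exact ⟨habs PG _ γ fun A hA => (hmom A hA k hk).1,
      habs PG _ γ fun A hA => (hmom A hA k hk).2⟩
  · rw [hswap, ← havg θ]
    refine sum_le_sum fun A hA => mul_le_mul_of_nonneg_left (le_trans ?_ (hE1 A hA)) hw0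
    refine sum_le_sum fun y _ => mul_le_mul_of_nonneg_left ?_ (hB A hA y)
    by_cases hy : y ∈ E A
    · rw [if_pos (mem_biUnion.2 ⟨A, hA, hy⟩), if_pos hy]
    · rw [if_neg hy]; split_ifs <;> norm_num
  · calc ((V.powerset.biUnion E).card : ℝ) / 2 ^ n
        ≤ (∑ A ∈ V.powerset, ((E A).card : ℝ)) / 2 ^ n := by
          gcongr; exact_mod_cast card_biUnion_le
      _ = ∑ A ∈ V.powerset, ((E A).card : ℝ) / 2 ^ n := sum_div _ _ _
      _ ≤ ∑ _A ∈ V.powerset, D := sum_le_sum fun A hA => hE2 A hA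
      _ = _ := by rw [sum_const, card_powerset, nsmul_eq_mul]; push_cast; rfl

lemma Dec.mono {K0 : ℕ} {γ θ μ μ' D D' : ℝ} (hμ : μ ≤ μ') (hD : D ≤ D')
    {f : (ι → Bool) → (Fin n → Bool)} (h : Dec K0 γ θ μ D f) : Dec K0 γ θ μ' D' f := by
  obtain ⟨PG, PB, PL, h1, h2, h3, h4, h5, h6, E, h7, h8⟩ := h
  exact ⟨PG, PB, PL, h1, h2, h3, h4, h5.trans hμ, h6, E, h7, h8.trans hD⟩

end Dec

/-- Moment decomposition of laws of local functions. -/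
theorem macro_decomp (d K0 : ℕ) {γ' β : ℝ} (hγ' : 0 < γ') (hβ : 0 < β) : ∃ D : ℝ, 0 < D ∧
    ∀ θ > 0, ∃ N : ℕ, ∀ n, N ≤ n → ∀ (ι : Type) [Fintype ι] [DecidableEq ι]
      (f : (ι → Bool) → (Fin n → Bool)), Loc d f → Dec K0 γ' θ β (D * θ) f := by
  obtain ⟨γ, hγ, Hγ⟩ := moments_of_good d K0 hγ'
  set s := 2 * (2 * K0) * d with hs
  set ρ : ℝ := 1 - (1 / 2) ^ s with hρ
  have hρ0 : 0 ≤ ρ := by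
    have : (1 / 2 : ℝ) ^ s ≤ 1 := pow_le_one₀ (by norm_num) (by norm_num)
    rw [hρ]; linarith
  have hρ1 : ρ < 1 := by
    have : (0 : ℝ) < (1 / 2 : ℝ) ^ s := by positivity
    rw [hρ]; linarith
  obtain ⟨L, hL⟩ := exists_pow_lt_of_lt_one hβ hρ1
  refine ⟨(2 ^ s) ^ L, by positivity, fun θ hθ => ?_⟩
  obtain ⟨N, hN⟩ := good_or_test d (2 * K0) hγ hθ
  refine ⟨N, fun n hn ι _ _ f hf => ?_⟩
  have key : ∀ L : ℕ, ∀ f : (ι → Bool) → (Fin n → Bool), Loc d f →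
      Dec K0 γ' θ (ρ ^ L) ((2 ^ s) ^ L * θ) f := by
    intro L
    induction L with
    | zero =>
      intro f _
      refine ⟨fun _ => 0, fun _ => 0, law f, fun _ => le_rfl, fun _ => le_rfl, law_nonneg f,
        fun y => by ring, ?_, fun k _ => by simpa using hγ'.le, ∅, by simpa using hθ.le,
        by simpa using hθ.le⟩
      have := sum_law_mul f (fun _ => 1)
      simp only [mul_one] at this
      rw [this, Ex_const]; simp
    | succ L ih =>
      intro f hf
      rcases hN n hn ι f hf with hg | ⟨V, A0, E, hV, hA0, hE1, hE2⟩
      · exact dec_of_moments hθ.le (by positivity) (by positivity) (Hγ n ι f hf hg)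
      have h1 : ∀ A ∈ V.powerset, Dec K0 γ' θ (if A = A0 then 0 else ρ ^ L) ((2 ^ s) ^ L * θ)
          (fun x => f (ov V (ind A) x)) := by
        intro A _
        split_ifs with h
        · subst h
          refine ⟨fun _ => 0, law fun x => f (ov V (ind A) x), fun _ => 0, fun _ => le_rfl,
            law_nonneg _, fun _ => le_rfl, fun y => by ring, by simp,
            fun k _ => by simpa using hγ'.le, E, ?_, hE2.trans ?_⟩
          · rw [sum_law_mul _ (fun y => if y ∈ E then (0 : ℝ) else 1)]; exact hE1
          · have : (1 : ℝ) ≤ (2 ^ s) ^ L := one_le_pow₀ (one_le_pow₀ (by norm_num))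
            nlinarith
        · exact ih _ (hf.ov V _)
      refine Dec.mono ?_ ?_ (dec_of_cond V h1)
      · rw [← mul_sum]
        have h2 : ∑ A ∈ V.powerset, (if A = A0 then 0 else ρ ^ L) = (2 ^ V.card - 1) * ρ ^ L := by
          rw [← add_sum_erase _ _ (mem_powerset.2 hA0), if_pos rfl, zero_add,
            sum_congr rfl (g := fun _ => ρ ^ L) (fun A hA => if_neg (ne_of_mem_erase hA)),
            sum_const, card_erase_of_mem (mem_powerset.2 hA0), card_powerset, nsmul_eq_mul,
            Nat.cast_sub Nat.one_le_two_pow]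
          push_cast; rfl
        have h3 : (1 / 2 : ℝ) ^ s ≤ (1 / 2) ^ V.card :=
          pow_le_pow_of_le_one (by norm_num) (by norm_num) hV
        have h4 : (1 / 2 : ℝ) ^ V.card * 2 ^ V.card = 1 := by rw [← mul_pow]; norm_num
        rw [h2, pow_succ, ← mul_assoc, mul_sub, h4, mul_one, mul_comm (ρ ^ L)]
        refine mul_le_mul_of_nonneg_right ?_ (by positivity)
        rw [hρ]; linarith
      · rw [pow_succ, mul_comm ((2 ^ s) ^ L) (2 ^ s), mul_assoc]
        refine mul_le_mul_of_nonneg_right ?_ (by positivity)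
        exact pow_le_pow_right₀ (by norm_num) hV
  exact Dec.mono hL.le le_rfl (key L f hf)

/-! ### Sparse removal of inputs leaving many independent blocks -/

section Graph

lemma exists_indep {α : Type*} [DecidableEq α] (I : Finset α) (r : α → α → Prop) [DecidableRel r]
    (hr : ∀ i, r i i) (hs : ∀ i j, r i j → r j i) (K : ℕ)
    (hK : ∀ j ∈ I, (I.filter fun i => r j i).card ≤ K) :
    ∃ J ⊆ I, (∀ i ∈ J, ∀ j ∈ J, i ≠ j → ¬ r i j) ∧ I.card ≤ K * J.card := by
  obtain ⟨J, hJ, hmax⟩ := exists_max_image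
    (I.powerset.filter fun J => ∀ i ∈ J, ∀ j ∈ J, i ≠ j → ¬ r i j) card ⟨∅, by simp⟩
  rw [mem_filter, mem_powerset] at hJ
  refine ⟨J, hJ.1, hJ.2, ?_⟩
  have hcov : I ⊆ J.biUnion fun j => I.filter fun i => r j i := by
    intro i hi
    by_contra hcon
    have hc : ∀ j ∈ J, ¬ r j i := fun j hj hji =>
      hcon (mem_biUnion.2 ⟨j, hj, mem_filter.2 ⟨hi, hji⟩⟩)
    have hiJ : i ∉ J := fun h => hc i h (hr i)
    have := hmax (insert i J) (by
      rw [mem_filter, mem_powerset]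
      refine ⟨insert_subset hi hJ.1, fun a ha b hb hab => ?_⟩
      rcases mem_insert.1 ha with ha' | ha' <;> rcases mem_insert.1 hb with hb' | hb'
      · exact absurd (ha'.trans hb'.symm) hab
      · rw [ha']; exact fun h => hc b hb' (hs _ _ h)
      · rw [hb']; exact hc a ha'
      · exact hJ.2 a ha' b hb' hab)
    rw [card_insert_of_notMem hiJ] at this
    omega
  calc I.card ≤ _ := card_le_card hcov
    _ ≤ ∑ j ∈ J, (I.filter fun i => r j i).card := card_biUnion_le
    _ ≤ ∑ _j ∈ J, K := sum_le_sum fun j hj => hK j (hJ.1 hj)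
    _ = _ := by rw [sum_const, smul_eq_mul, mul_comm]

variable {ι κ : Type*} [DecidableEq ι] [Fintype κ] [DecidableEq κ]

/-- The outputs sharing with `i` an input outside `S`, and `i` itself. -/
def nb (T : κ → Finset ι) (S : Finset ι) (i : κ) : Finset κ :=
  univ.filter fun i' => i' = i ∨ ¬ Disjoint (T i \ S) (T i')

/-- All inputs outside `S` of the outputs in `nb T S i`. -/
def blk (T : κ → Finset ι) (S : Finset ι) (i : κ) : Finset ι :=
  (nb T S i).biUnion fun i' => T i' \ S

/-- Number of outputs reading an input. -/
def deg (T : κ → Finset ι) (j : ι) : ℕ := (univ.filter fun i => j ∈ T i).card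

lemma mem_nb_self (T : κ → Finset ι) (S : Finset ι) (i : κ) : i ∈ nb T S i := by simp [nb]

lemma sdiff_subset_blk (T : κ → Finset ι) (S : Finset ι) {i i' : κ} (h : i' ∈ nb T S i) :
    T i' \ S ⊆ blk T S i := subset_biUnion_of_mem (fun i' => T i' \ S) h

lemma disjoint_nb {T : κ → Finset ι} {S : Finset ι} {i j : κ} (hij : i ≠ j)
    (h : Disjoint (blk T S i) (blk T S j)) : Disjoint (nb T S i) (nb T S j) := by
  rw [disjoint_left]
  intro a ha hb
  have h1 : Disjoint (T a \ S) (T a \ S) :=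
    h.mono (sdiff_subset_blk T S ha) (sdiff_subset_blk T S hb)
  rw [disjoint_self_iff_empty] at h1
  have key : ∀ i, a ∈ nb T S i → a = i := by
    intro i hi
    rcases (mem_filter.1 hi).2 with h | h
    · exact h
    · refine absurd ?_ h
      rw [disjoint_left]
      intro x hx hxa
      have : x ∈ T a \ S := mem_sdiff.2 ⟨hxa, (mem_sdiff.1 hx).2⟩
      rw [h1] at this; simp at this
  exact hij ((key i ha).symm.trans (key j hb))

lemma card_nb_le {T : κ → Finset ι} {S : Finset ι} {d L : ℕ} {i : κ} (hT : (T i).card ≤ d)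
    (hL : ∀ j ∈ T i \ S, deg T j ≤ L) : (nb T S i).card ≤ 1 + d * L := by
  have hsub : nb T S i ⊆ {i} ∪ (T i \ S).biUnion fun j => univ.filter fun i' => j ∈ T i' := by
    intro a ha
    rcases (mem_filter.1 ha).2 with h | h
    · simp [h]
    · obtain ⟨x, hx, hxa⟩ := not_disjoint_iff.1 h
      exact mem_union_right _ (mem_biUnion.2 ⟨x, hx, by simp [hxa]⟩)
  refine (card_le_card hsub).trans ((card_union_le _ _).trans ?_)
  rw [card_singleton]
  refine Nat.add_le_add_left ?_ 1
  calc _ ≤ ∑ j ∈ T i \ S, deg T j := card_biUnion_le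
    _ ≤ ∑ _j ∈ T i \ S, L := sum_le_sum hL
    _ = (T i \ S).card * L := by rw [sum_const, smul_eq_mul]
    _ ≤ d * L := Nat.mul_le_mul_right _ ((card_le_card sdiff_subset).trans hT)

lemma card_rev_nb_le {T : κ → Finset ι} {S : Finset ι} {d L : ℕ} (hT : ∀ i, (T i).card ≤ d)
    {I : Finset κ} (hL : ∀ i ∈ I, ∀ j ∈ T i \ S, deg T j ≤ L) (a : κ) :
    (I.filter fun i => a ∈ nb T S i).card ≤ 1 + d * L := by
  have hsub : (I.filter fun i => a ∈ nb T S i) ⊆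
      {a} ∪ ((T a).filter fun j => deg T j ≤ L).biUnion fun j => univ.filter fun i' => j ∈ T i' := by
    intro i hi
    obtain ⟨hiI, hi⟩ := mem_filter.1 hi
    rcases (mem_filter.1 hi).2 with h | h
    · simp [h]
    · obtain ⟨x, hx, hxa⟩ := not_disjoint_iff.1 h
      exact mem_union_right _ (mem_biUnion.2 ⟨x, mem_filter.2 ⟨hxa, hL i hiI x hx⟩,
        by simp [(mem_sdiff.1 hx).1]⟩)
  refine (card_le_card hsub).trans ((card_union_le _ _).trans ?_)
  rw [card_singleton]
  refine Nat.add_le_add_left ?_ 1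
  calc _ ≤ ∑ j ∈ (T a).filter fun j => deg T j ≤ L, deg T j := card_biUnion_le
    _ ≤ ∑ _j ∈ (T a).filter fun j => deg T j ≤ L, L :=
        sum_le_sum fun j hj => (mem_filter.1 hj).2
    _ = _ := by rw [sum_const, smul_eq_mul]
    _ ≤ d * L := Nat.mul_le_mul_right _ ((card_filter_le _ _).trans (hT a))

lemma card_blk_le {T : κ → Finset ι} {S : Finset ι} {d K : ℕ} (hT : ∀ i, (T i).card ≤ d) {i : κ}
    (h : (nb T S i).card ≤ K) : (blk T S i).card ≤ d * K :=
  calc (blk T S i).card ≤ ∑ i' ∈ nb T S i, (T i' \ S).card := card_biUnion_le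
    _ ≤ ∑ _i' ∈ nb T S i, d := sum_le_sum fun i' _ => (card_le_card sdiff_subset).trans (hT i')
    _ = (nb T S i).card * d := by rw [sum_const, smul_eq_mul]
    _ ≤ d * K := by rw [mul_comm]; exact Nat.mul_le_mul_left _ h

/-- Clean centres have few conflicts. -/
lemma card_conflict_le {T : κ → Finset ι} {S : Finset ι} {d L Q : ℕ} (hT : ∀ i, (T i).card ≤ d)
    {I : Finset κ} (hL : ∀ i ∈ I, ∀ j ∈ T i \ S, deg T j ≤ L) {a : κ} (ha : a ∈ I)
    (hQ : ∀ j ∈ blk T S a, deg T j ≤ Q) :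
    (I.filter fun i => a = i ∨ ¬ Disjoint (blk T S a) (blk T S i)).card
      ≤ 1 + d * (1 + d * L) * (Q * (1 + d * L)) := by
  have hsub : (I.filter fun i => a = i ∨ ¬ Disjoint (blk T S a) (blk T S i)) ⊆ {a} ∪
      (blk T S a).biUnion fun j => (univ.filter fun i' => j ∈ T i').biUnion fun i' =>
        I.filter fun i => i' ∈ nb T S i := by
    intro i hi
    obtain ⟨hiI, hi⟩ := mem_filter.1 hi
    rcases hi with rfl | h
    · simp
    · obtain ⟨x, hx, hxi⟩ := not_disjoint_iff.1 h
      obtain ⟨i', hi', hxi'⟩ := mem_biUnion.1 hxi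
      exact mem_union_right _ (mem_biUnion.2 ⟨x, hx, mem_biUnion.2 ⟨i',
        by simp [(mem_sdiff.1 hxi').1], mem_filter.2 ⟨hiI, hi'⟩⟩⟩)
  refine (card_le_card hsub).trans ((card_union_le _ _).trans ?_)
  rw [card_singleton]
  refine Nat.add_le_add_left ?_ 1
  have hb := card_blk_le hT (card_nb_le (hT a) (hL a ha))
  calc _ ≤ ∑ j ∈ blk T S a, ((univ.filter fun i' => j ∈ T i').biUnion fun i' =>
        I.filter fun i => i' ∈ nb T S i).card := card_biUnion_le
    _ ≤ ∑ j ∈ blk T S a, Q * (1 + d * L) := sum_le_sum fun j hj => by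
        refine card_biUnion_le.trans ?_
        calc _ ≤ ∑ _i' ∈ univ.filter fun i' => j ∈ T i', (1 + d * L) :=
              sum_le_sum fun i' _ => card_rev_nb_le hT hL i'
          _ = deg T j * (1 + d * L) := by rw [sum_const, smul_eq_mul]; rfl
          _ ≤ _ := Nat.mul_le_mul_right _ (hQ j hj)
    _ = _ := by rw [sum_const, smul_eq_mul]
    _ ≤ _ := Nat.mul_le_mul_right _ hb

/-- Few centres are not clean. -/
lemma card_unclean_le {T : κ → Finset ι} {S : Finset ι} {d L : ℕ} (hT : ∀ i, (T i).card ≤ d)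
    {I : Finset κ} (hL : ∀ i ∈ I, ∀ j ∈ T i \ S, deg T j ≤ L) (Mid : Finset ι) :
    (I.filter fun i => ¬ Disjoint (blk T S i) Mid).card
      ≤ (∑ j ∈ Mid, deg T j) * (1 + d * L) := by
  have hsub : (I.filter fun i => ¬ Disjoint (blk T S i) Mid) ⊆
      Mid.biUnion fun j => (univ.filter fun i' => j ∈ T i').biUnion fun i' =>
        I.filter fun i => i' ∈ nb T S i := by
    intro i hi
    obtain ⟨hiI, h⟩ := mem_filter.1 hi
    obtain ⟨x, hx, hxi⟩ := not_disjoint_iff.1 h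
    obtain ⟨i', hi', hxi'⟩ := mem_biUnion.1 hx
    exact mem_biUnion.2 ⟨x, hxi, mem_biUnion.2 ⟨i',
        by simp [(mem_sdiff.1 hxi').1], mem_filter.2 ⟨hiI, hi'⟩⟩⟩
  refine (card_le_card hsub).trans (card_biUnion_le.trans ?_)
  rw [sum_mul]
  refine sum_le_sum fun j _ => card_biUnion_le.trans ?_
  calc _ ≤ ∑ _i' ∈ univ.filter fun i' => j ∈ T i', (1 + d * L) :=
        sum_le_sum fun i' _ => card_rev_nb_le hT hL i'
    _ = deg T j * (1 + d * L) := by rw [sum_const, smul_eq_mul]; rfl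

omit [DecidableEq κ] in
lemma sum_deg_le [Fintype ι] {T : κ → Finset ι} {d : ℕ} (hT : ∀ i, (T i).card ≤ d) :
    ∑ j, deg T j ≤ d * Fintype.card κ := by
  have : ∑ j, deg T j = ∑ i, (T i).card := by
    unfold deg
    simp_rw [card_eq_sum_ones, sum_filter]
    rw [sum_comm]
    refine sum_congr rfl fun i _ => by rw [← sum_filter]; simp
  rw [this]
  calc _ ≤ ∑ _i : κ, d := sum_le_sum fun i _ => hT i
    _ = _ := by rw [sum_const, smul_eq_mul, mul_comm]; rfl


omit [DecidableEq κ] in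
/-- Every output misses one of `d + 1` disjoint degree ranges. -/
lemma exists_missed_range {T : κ → Finset ι} {d : ℕ} (hT : ∀ i, (T i).card ≤ d) {E : ℕ → ℕ}
    (hE : Monotone E) (i : κ) :
    ∃ k ∈ range (d + 1), ∀ j ∈ T i, ¬ (E k ≤ deg T j ∧ deg T j < E (k + 1)) := by
  by_contra! hcon
  obtain ⟨j0, -⟩ := hcon 0 (by simp)
  have : Nonempty ι := ⟨j0⟩
  choose! g hg1 hg2 hg3 using hcon
  have hinj : Set.InjOn g ((range (d + 1) : Finset ℕ) : Set ℕ) := by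
    intro a ha b hb hab
    by_contra hne
    rcases lt_or_gt_of_ne hne with h | h
    · have h1 := hE (Nat.succ_le_of_lt h)
      have h2 := hg3 a ha
      have h3 := hg2 b hb
      rw [hab] at h2
      exact absurd (h2.trans_le (h1.trans h3)) (lt_irrefl _)
    · have h1 := hE (Nat.succ_le_of_lt h)
      have h2 := hg3 b hb
      have h3 := hg2 a ha
      rw [← hab] at h2
      exact absurd (h2.trans_le (h1.trans h3)) (lt_irrefl _)
  have := card_le_card_of_injOn g (fun k hk => hg1 k hk) hinj
  rw [card_range] at this
  have := hT i
  omega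

theorem exists_blocks (d : ℕ) {c0 : ℕ → ℝ} (hc0 : ∀ L, 0 < c0 L) : ∃ Q : ℕ, ∃ τ : ℝ, 0 < τ ∧
    ∀ n : ℕ, 0 < n → ∀ (ι : Type) [Fintype ι] [DecidableEq ι] (T : Fin n → Finset ι),
      (∀ i, (T i).card ≤ d) → ∃ L ≤ Q, ∃ S : Finset ι, ∃ J : Finset (Fin n),
        (∀ i ∈ J, (nb T S i).card ≤ 1 + d * L) ∧
        (∀ i ∈ J, ∀ j ∈ J, i ≠ j → Disjoint (blk T S i) (blk T S j)) ∧
        (S.card : ℝ) ≤ c0 L * J.card ∧ τ * n ≤ J.card := by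
  set P : ℕ → ℕ := fun L => 1 + d * (1 + d * L) * (1 + d * L) with hP
  set A : ℕ → ℕ := fun L => ⌈2 * d * (d + 1) * P L / c0 L⌉₊ + 1 with hA
  have hA1 : ∀ L, 1 ≤ A L := fun L => Nat.le_add_left _ _
  have hAc : ∀ L, (2 * d * (d + 1) * P L : ℝ) ≤ A L * c0 L := by
    intro L
    rw [← div_le_iff₀ (hc0 L)]
    refine (Nat.le_ceil _).trans ?_
    rw [Nat.cast_le]
    exact Nat.le_succ _
  set M : ℕ → ℕ := fun L => d * (2 * (d + 1) * (1 + d * L)) + 1 with hM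
  set E : ℕ → ℕ := fun k => Nat.rec 1 (fun _ e => A e ^ M e * e) k with hE
  have hEs : ∀ k, E (k + 1) = A (E k) ^ M (E k) * E k := fun k => rfl
  have hE0 : ∀ k, 1 ≤ E k := by
    intro k
    induction k with
    | zero => exact le_rfl
    | succ k ih => rw [hEs]; exact Nat.mul_pos (Nat.pow_pos (hA1 _)) ih
  have hEm : Monotone E := monotone_nat_of_le_succ fun k => by
    rw [hEs]; exact Nat.le_mul_of_pos_left _ (Nat.pow_pos (hA1 _))
  set Q := E (d + 1) with hQ
  have hQ1 : 1 ≤ Q := hE0 (d + 1)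
  refine ⟨Q, 1 / (2 * (d + 1) * P Q * Q : ℕ), ?_, fun n hn ι _ _ T hT => ?_⟩
  · have : 0 < 2 * (d + 1) * P Q * Q := by positivity
    have : (0 : ℝ) < (2 * (d + 1) * P Q * Q : ℕ) := by exact_mod_cast this
    positivity
  -- the missed range
  obtain ⟨k, hk, hkn⟩ : ∃ k ∈ range (d + 1), n ≤ (d + 1) * (univ.filter fun i : Fin n =>
      ∀ j ∈ T i, ¬ (E k ≤ deg T j ∧ deg T j < E (k + 1))).card := by
    by_contra hcon
    have hcon : ∀ k ∈ range (d + 1), (d + 1) * (univ.filter fun i : Fin n =>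
        ∀ j ∈ T i, ¬ (E k ≤ deg T j ∧ deg T j < E (k + 1))).card < n :=
      fun k hk => lt_of_not_ge fun h => hcon ⟨k, hk, h⟩
    have h1 : (univ : Finset (Fin n)) ⊆ (range (d + 1)).biUnion fun k =>
        univ.filter fun i : Fin n => ∀ j ∈ T i, ¬ (E k ≤ deg T j ∧ deg T j < E (k + 1)) := by
      intro i _
      obtain ⟨k, hk, h⟩ := exists_missed_range hT hEm i
      exact mem_biUnion.2 ⟨k, hk, mem_filter.2 ⟨mem_univ _, h⟩⟩
    have h2 := (card_le_card h1).trans card_biUnion_le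
    rw [card_univ, Fintype.card_fin] at h2
    have h3 := sum_lt_sum_of_nonempty (s := range (d + 1)) ⟨0, by simp⟩ hcon
    rw [← mul_sum, sum_const, card_range, smul_eq_mul] at h3
    exact absurd (h3.trans_le (Nat.mul_le_mul_left _ h2)) (lt_irrefl _)
  set I := univ.filter fun i : Fin n =>
    ∀ j ∈ T i, ¬ (E k ≤ deg T j ∧ deg T j < E (k + 1)) with hI
  set L := E k with hL
  have hkd : k + 1 ≤ d + 1 := by rw [mem_range] at hk; omega
  have hLQ : L ≤ Q := hEm (show k ≤ d + 1 by omega)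
  set D : ℕ → ℕ := fun b => A L ^ b * L with hD
  have hDm : Monotone D := fun a b hab => Nat.mul_le_mul_right _ (Nat.pow_le_pow_right (hA1 L) hab)
  have hD1 : ∀ b, 1 ≤ D b := fun b => Nat.mul_pos (Nat.pow_pos (hA1 (E k))) (hE0 k)
  have hDE : D (M L) = E (k + 1) := rfl
  set Mid : ℕ → Finset ι := fun b => univ.filter fun j => D b ≤ deg T j ∧ deg T j < D (b + 1)
    with hMid
  have hdeg := sum_deg_le hT
  rw [Fintype.card_fin] at hdeg
  obtain ⟨b, hb, hbn⟩ : ∃ b ∈ range (M L),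
      (∑ j ∈ Mid b, deg T j) * (2 * (d + 1) * (1 + d * L)) ≤ n := by
    by_contra! hcon
    have h3 := sum_lt_sum_of_nonempty (s := range (M L)) ⟨0, by simp [hM]⟩ hcon
    rw [← sum_mul, sum_const, card_range, smul_eq_mul] at h3
    have hdisj : Set.PairwiseDisjoint ((range (M L) : Finset ℕ) : Set ℕ) Mid := by
      intro a _ b _ hab
      refine disjoint_left.2 fun j hj hj' => ?_
      have h1 := (mem_filter.1 hj).2
      have h2 := (mem_filter.1 hj').2
      rcases lt_or_gt_of_ne hab with h | h
      · have := hDm (Nat.succ_le_of_lt h)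
        simp only [Nat.succ_eq_add_one] at this
        omega
      · have := hDm (Nat.succ_le_of_lt h)
        simp only [Nat.succ_eq_add_one] at this
        omega
    rw [← sum_biUnion hdisj] at h3
    have h4 : ∑ j ∈ (range (M L)).biUnion Mid, deg T j ≤ ∑ j, deg T j :=
      sum_le_sum_of_subset (subset_univ _)
    have h5 := Nat.mul_le_mul_right (2 * (d + 1) * (1 + d * L)) (h4.trans hdeg)
    have h6 : M L * n = d * n * (2 * (d + 1) * (1 + d * L)) + n := by rw [hM]; ring
    omega
  set S : Finset ι := univ.filter fun j => D (b + 1) ≤ deg T j with hS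
  have hlow : ∀ i ∈ I, ∀ j ∈ T i \ S, deg T j ≤ L := by
    intro i hi j hj
    obtain ⟨hj, hjS⟩ := mem_sdiff.1 hj
    have h1 := (mem_filter.1 hi).2 j hj
    have h2 : deg T j < D (b + 1) := by
      by_contra h; exact hjS (mem_filter.2 ⟨mem_univ _, not_lt.1 h⟩)
    have h3 : D (b + 1) ≤ E (k + 1) := by
      rw [← hDE]; exact hDm (by rw [mem_range] at hb; omega)
    by_contra h4
    exact h1 ⟨by omega, by omega⟩
  set I' := I.filter fun i => Disjoint (blk T S i) (Mid b) with hI'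
  have hcl : n ≤ 2 * (d + 1) * I'.card := by
    have h1 := card_unclean_le hT hlow (Mid b)
    have h2 := card_filter_add_card_filter_not (s := I) (fun i => Disjoint (blk T S i) (Mid b))
    have h3 := Nat.mul_le_mul_right (2 * (d + 1)) h1
    rw [mul_assoc, mul_comm (1 + d * L)] at h3
    have h4 : 2 * (d + 1) * I.card = 2 * (d + 1) * I'.card +
      (I.filter fun i => ¬ Disjoint (blk T S i) (Mid b)).card * (2 * (d + 1)) := by
      rw [← h2]; ring
    have h5 : 2 * (d + 1) * I.card = (d + 1) * I.card + (d + 1) * I.card := by ring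
    omega
  obtain ⟨J, hJI, hJ, hJc⟩ := exists_indep I'
    (fun i j => i = j ∨ ¬ Disjoint (blk T S i) (blk T S j)) (fun i => Or.inl rfl)
    (fun i j h => by rwa [eq_comm, disjoint_comm]) (P L * D b) (by
      intro a ha
      obtain ⟨haI, hac⟩ := mem_filter.1 ha
      refine (card_le_card (filter_subset_filter _ (filter_subset _ _))).trans
        ((card_conflict_le hT hlow haI (Q := D b) ?_).trans ?_)
      · intro j hj
        by_contra h
        obtain ⟨i', _, hj'⟩ := mem_biUnion.1 hj
        have hjS := (mem_sdiff.1 hj').2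
        refine disjoint_left.1 hac hj (mem_filter.2 ⟨mem_univ _, by omega, ?_⟩)
        by_contra h; exact hjS (mem_filter.2 ⟨mem_univ _, not_lt.1 h⟩)
      · have : P L * D b = D b + d * (1 + d * L) * (D b * (1 + d * L)) := by rw [hP]; ring
        rw [this]
        exact Nat.add_le_add_right (hD1 b) _)
  have hnJ : n ≤ 2 * (d + 1) * (P L * D b) * J.card := by
    refine hcl.trans ?_
    rw [mul_assoc (2 * (d + 1))]; exact Nat.mul_le_mul_left _ hJc
  refine ⟨L, hLQ, S, J, fun i hi => card_nb_le (hT i) (hlow i (mem_filter.1 (hJI hi)).1),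
    fun i hi j hj hij => ?_, ?_, ?_⟩
  · have := hJ i hi j hj hij
    push Not at this
    exact this.2
  · have h1 : S.card * D (b + 1) ≤ d * n := by
      refine le_trans ?_ hdeg
      calc S.card * D (b + 1) = ∑ _j ∈ S, D (b + 1) := by rw [sum_const, smul_eq_mul]
        _ ≤ ∑ j ∈ S, deg T j := sum_le_sum fun j hj => (mem_filter.1 hj).2
        _ ≤ _ := sum_le_sum_of_subset (subset_univ _)
    have h2 : S.card * A L ≤ 2 * d * (d + 1) * P L * J.card := by
      refine Nat.le_of_mul_le_mul_right (c := D b) ?_ (hD1 b)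
      calc S.card * A L * D b = S.card * D (b + 1) := by
            simp only [hD]; ring
        _ ≤ d * n := h1
        _ ≤ d * (2 * (d + 1) * (P L * D b) * J.card) := Nat.mul_le_mul_left _ hnJ
        _ = _ := by ring
    have h3 : (S.card * A L : ℝ) ≤ 2 * d * (d + 1) * P L * J.card := by exact_mod_cast h2
    have h4 := mul_le_mul_of_nonneg_right (hAc L) (Nat.cast_nonneg (α := ℝ) J.card)
    have h5 : (0 : ℝ) < A L := by exact_mod_cast hA1 L
    refine le_of_mul_le_mul_right ?_ h5
    linarith
  · have hDQ : D b ≤ Q := by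
      refine le_trans (hDm (show b ≤ M L by rw [mem_range] at hb; omega)) ?_
      rw [hDE]; exact hEm hkd
    have hPQ : P L ≤ P Q := by
      simp only [hP]; gcongr
    have h1 : n ≤ 2 * (d + 1) * P Q * Q * J.card := by
      refine hnJ.trans (Nat.mul_le_mul_right _ ?_)
      rw [mul_assoc (2 * (d + 1)) (P Q)]
      exact Nat.mul_le_mul_left _ (Nat.mul_le_mul hPQ hDQ)
    have h2 : 0 < 2 * (d + 1) * P Q * Q := by positivity
    rw [div_mul_eq_mul_div, one_mul, div_le_iff₀ (by exact_mod_cast h2), mul_comm]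
    exact_mod_cast h1

end Graph

/-! ### Uniform and non-uniform output blocks -/

section Blocks
variable {ι : Type} [Fintype ι] [DecidableEq ι] {n : ℕ}

/-- Indicator that the output agrees with the pattern `p` on `N`. -/
def hit (N : Finset (Fin n)) (p : Fin n → Bool) (y : Fin n → Bool) : ℝ :=
  if ∀ i ∈ N, y i = p i then 1 else 0

/-- The output of `g` on `N` is uniform. -/
def UnifBlock (g : (ι → Bool) → (Fin n → Bool)) (N : Finset (Fin n)) : Prop :=
  ∀ p, Ex (fun x => hit N p (g x)) = (1 / 2) ^ N.card

lemma hit_nonneg (N : Finset (Fin n)) (p y : Fin n → Bool) : 0 ≤ hit N p y := by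
  unfold hit; split_ifs <;> norm_num

lemma hit_le_one (N : Finset (Fin n)) (p y : Fin n → Bool) : hit N p y ≤ 1 := by
  unfold hit; split_ifs <;> norm_num

lemma depOn_hit (N : Finset (Fin n)) (p : Fin n → Bool) : DepOn N (hit N p) := fun x y h => by
  unfold hit
  have : (∀ i ∈ N, x i = p i) ↔ ∀ i ∈ N, y i = p i :=
    forall₂_congr fun i hi => by rw [h i hi]
  simp only [this]

lemma Ex_hit (N : Finset (Fin n)) (p : Fin n → Bool) : Ex (hit N p) = (1 / 2) ^ N.card := by
  rw [← Ex_pin (R := ℝ) N p]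
  congr 1; funext x; unfold hit; congr

omit [Fintype ι] [DecidableEq ι] in
lemma DepOn.comp_local {β : Type*} {g : (ι → Bool) → (Fin n → Bool)} {N : Finset (Fin n)}
    {B : Finset ι} (hg : ∀ i ∈ N, DepOn B (fun x => g x i)) {H : (Fin n → Bool) → β}
    (hH : DepOn N H) : DepOn B (fun x => H (g x)) := fun x y h =>
  hH _ _ fun i hi => hg i hi x y h

lemma exists_heavy {g : (ι → Bool) → (Fin n → Bool)} {N : Finset (Fin n)} {B : Finset ι}
    (hg : ∀ i ∈ N, DepOn B (fun x => g x i)) (h : ¬ UnifBlock g N) :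
    ∃ p, (1 / 2 : ℝ) ^ N.card + (1 / 2) ^ (N.card + B.card) ≤ Ex (fun x => hit N p (g x)) := by
  have hex : ∃ p, (1 / 2 : ℝ) ^ N.card < Ex (fun x => hit N p (g x)) := by
    by_contra! hcon
    apply h
    have h1 : Ex (fun p => (1 / 2 : ℝ) ^ N.card - Ex (fun x => hit N p (g x))) = 0 := by
      rw [Ex_sub, Ex_const, Ex_comm]
      have : ∀ x, Ex (fun p => hit N p (g x)) = (1 / 2) ^ N.card := fun x => by
        rw [← Ex_hit N (g x)]
        congr 1; funext p
        unfold hit; simp only [eq_comm]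
      simp_rw [this, Ex_const, sub_self]
    intro p
    have := Ex_eq_zero_of_nonneg (fun p => sub_nonneg.2 (hcon p)) h1 p
    linarith
  obtain ⟨p, hp⟩ := hex
  refine ⟨p, ?_⟩
  have h2 : (2 : ℝ) ^ N.card * (1 / 2) ^ N.card = 1 := by rw [← mul_pow]; norm_num
  have h3 : Ex (fun x => 2 ^ N.card * hit N p (g x) - 1)
      = 2 ^ N.card * Ex (fun x => hit N p (g x)) - 1 := by
    rw [Ex_sub, Ex_mul_left, Ex_const]
  have hpos : (0 : ℝ) < 2 ^ N.card := by positivity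
  have h4 : 0 < Ex (fun x => 2 ^ N.card * hit N p (g x) - 1) := by
    rw [h3]; nlinarith
  have h5 := one_le_abs_Ex_of_depOn (V := B) (H := fun x => 2 ^ N.card * hit N p (g x) - 1)
    ((DepOn.comp_local hg (depOn_hit N p)).comp fun u => 2 ^ N.card * u - 1) (fun x => by
      unfold hit
      split_ifs
      · exact ⟨2 ^ N.card - 1, by push_cast; ring⟩
      · exact ⟨-1, by push_cast; ring⟩) h4.ne'
  rw [abs_of_pos h4, h3] at h5
  have h6 := mul_le_mul_of_nonneg_left h5 (show (0 : ℝ) ≤ (1 / 2) ^ N.card by positivity)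
  rw [pow_add]
  nlinarith

lemma ofReal_Ex (g : (ι → Bool) → ℝ) : ((Ex g : ℝ) : ℂ) = Ex (fun x => (g x : ℂ)) := by
  unfold Ex; push_cast; rfl

lemma UnifBlock.Ex_comp {g : (ι → Bool) → (Fin n → Bool)} {N : Finset (Fin n)}
    (h : UnifBlock g N) {H : (Fin n → Bool) → ℂ} (hH : DepOn N H) :
    Ex (fun x => H (g x)) = Ex H := by
  have h1 : ∀ y, H y = ∑ A ∈ N.powerset, H (ind A) * (hit N (ind A) y : ℂ) := by
    intro y
    rw [sum_eq_single (N.filter fun i => y i = true)]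
    · unfold hit
      rw [if_pos, Complex.ofReal_one, mul_one]
      · exact hH _ _ fun i hi => by simp [ind, hi]
      · intro i hi; simp [ind, hi]
    · intro A hA hne
      unfold hit
      rw [if_neg, Complex.ofReal_zero, mul_zero]
      intro h
      apply hne
      ext i
      simp only [mem_filter]
      constructor
      · intro hi
        refine ⟨mem_powerset.1 hA hi, ?_⟩
        rw [h i (mem_powerset.1 hA hi)]; simp [ind, hi]
      · rintro ⟨hi, hx⟩; rw [h i hi] at hx; simpa [ind] using hx
    · intro h; simp at h
  rw [funext fun x => h1 (g x), funext h1, Ex_sum, Ex_sum]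
  refine sum_congr rfl fun A _ => ?_
  rw [Ex_mul_left, Ex_mul_left, ← ofReal_Ex, ← ofReal_Ex, h (ind A), Ex_hit]
  exact congrArg (· * _) (h1 (ind A)).symm

/-- Number of ones on `N`, as an integer. -/
def wt (N : Finset (Fin n)) (y : Fin n → Bool) : ℤ := ∑ i ∈ N, if y i = true then 1 else 0

lemma depOn_wt (N : Finset (Fin n)) : DepOn N (wt N) := fun x y h =>
  sum_congr rfl fun i hi => by rw [h i hi]

lemma zpow_wt (N : Finset (Fin n)) (y : Fin n → Bool) {ω : ℂ} (hω : ω ≠ 0) :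
    ω ^ wt N y = ∏ j ∈ N, if y j = true then ω else 1 := by
  unfold wt
  induction N using Finset.induction_on with
  | empty => simp
  | insert a s ha ih =>
    rw [sum_insert ha, prod_insert ha, zpow_add₀ hω, ih]
    congr 1; split_ifs <;> simp

lemma Ex_sg_mul_zpow {N : Finset (Fin n)} {i : Fin n} (hi : i ∈ N) {ω : ℂ} (hω : ω ≠ 0) :
    Ex (fun y => (sg (y i) : ℂ) * ω ^ wt N y) = ((1 - ω) / 2) * ((1 + ω) / 2) ^ (N.card - 1) := by
  have h1 : ∀ y : Fin n → Bool, (sg (y i) : ℂ) * ω ^ wt N y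
      = ∏ j ∈ N, (if j = i then (sg (y i) : ℂ) else 1) * (if y j = true then ω else 1) := by
    intro y
    rw [prod_mul_distrib, prod_ite_eq' N i, if_pos hi, zpow_wt _ _ hω]
  rw [funext h1, Ex_prod_of_disjoint N (A := fun j => {j})
    (g := fun j y => (if j = i then (sg (y i) : ℂ) else 1) * (if y j = true then ω else 1))]
  · rw [← mul_prod_erase N _ hi, prod_congr rfl (g := fun _ => (1 + ω) / 2), prod_const,
      card_erase_of_mem hi]
    · congr 1
      rw [Ex_coord i (fun c => (if i = i then (sg c : ℂ) else 1) * (if c = true then ω else 1))]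
      simp [sg]; ring
    · intro j hj
      have hji : j ≠ i := ne_of_mem_erase hj
      simp only [if_neg hji, one_mul]
      rw [Ex_coord j (fun c => if c = true then ω else 1)]
      simp; ring
  · intro j _ x y h
    have := h j (mem_singleton_self j)
    by_cases hji : j = i
    · subst hji; simp [this]
    · simp [hji, this]
  · intro k _ l _ h; simpa using h

/-- The changes of the weight on `N` caused by overwriting the inputs in `T`. -/
def diffs (g : (ι → Bool) → (Fin n → Bool)) (N : Finset (Fin n)) (T : Finset ι) : Finset ℤ :=
  univ.image fun p : (ι → Bool) × (ι → Bool) => wt N (g (ov T p.1 p.2)) - wt N (g p.2)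

lemma abs_wt_sub_le (N : Finset (Fin n)) (x y : Fin n → Bool) : |wt N x - wt N y| ≤ N.card := by
  unfold wt
  rw [← sum_sub_distrib]
  refine (abs_sum_le_sum_abs _ _).trans ?_
  calc _ ≤ ∑ _i ∈ N, (1 : ℤ) := sum_le_sum fun i _ => by split_ifs <;> simp
    _ = _ := by simp

lemma diffs_subset (g : (ι → Bool) → (Fin n → Bool)) (N : Finset (Fin n)) (T : Finset ι) {κ : ℕ}
    (h : N.card ≤ κ) : diffs g N T ⊆ Icc (-(κ : ℤ)) κ := by
  intro z hz
  obtain ⟨p, _, rfl⟩ := mem_image.1 hz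
  have h1 := abs_wt_sub_le N (g (ov T p.1 p.2)) (g p.2)
  have h2 : (N.card : ℤ) ≤ κ := by exact_mod_cast h
  rw [mem_Icc]
  exact abs_le.1 (h1.trans h2)

lemma exists_root {H : AddSubgroup ℤ} (h : (2 : ℤ) ∉ H) :
    ∃ ω : ℂ, ω ≠ 0 ∧ (∀ z ∈ H, ω ^ z = 1) ∧ ω ^ 2 ≠ 1 := by
  obtain ⟨a, rfl⟩ := Int.subgroup_cyclic H
  rw [← AddSubgroup.zmultiples_eq_closure, Int.mem_zmultiples_iff] at h
  by_cases ha : a = 0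
  · refine ⟨2, by norm_num, fun z hz => ?_, by norm_num⟩
    rw [← AddSubgroup.zmultiples_eq_closure, Int.mem_zmultiples_iff, ha, zero_dvd_iff] at hz
    rw [hz]; simp
  have hp := Complex.isPrimitiveRoot_exp a.natAbs (by simpa using ha)
  refine ⟨_, hp.ne_zero (by simpa using ha), fun z hz => ?_, fun h2 => ?_⟩
  · rw [← AddSubgroup.zmultiples_eq_closure, Int.mem_zmultiples_iff] at hz
    rw [hp.zpow_eq_one_iff_dvd]
    exact Int.natAbs_dvd.2 hz
  · have := hp.dvd_of_pow_eq_one 2 h2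
    exact h (Int.natAbs_dvd.1 (by exact_mod_cast this))

/-- If the output on `N` is uniform, resampling the inputs of one of its bits changes the weight
by amounts generating an even shift. -/
lemma UnifBlock.two_mem_closure {g : (ι → Bool) → (Fin n → Bool)} {N : Finset (Fin n)}
    (h : UnifBlock g N) {i : Fin n} (hi : i ∈ N) {T : Finset ι}
    (hT : DepOn T (fun x => g x i)) :
    (2 : ℤ) ∈ AddSubgroup.closure ((diffs g N T : Finset ℤ) : Set ℤ) := by
  by_contra hcon
  obtain ⟨ω, hω0, hω1, hω2⟩ := exists_root hcon
  have hF : DepOn (univ \ T) (fun x => ω ^ wt N (g x)) := by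
    intro x y hxy
    have h1 : x = ov T x y := by
      funext j
      by_cases hj : j ∈ T
      · rw [ov_of_mem hj]
      · rw [ov_of_notMem hj]; exact hxy j (by simp [hj])
    have h2 : wt N (g x) - wt N (g y) ∈ AddSubgroup.closure ((diffs g N T : Finset ℤ) : Set ℤ) := by
      apply AddSubgroup.subset_closure
      rw [mem_coe]
      refine mem_image.2 ⟨(x, y), mem_univ _, ?_⟩
      simp only [← h1]
    have h3 := hω1 _ h2
    rw [zpow_sub₀ hω0, div_eq_one_iff_eq (zpow_ne_zero _ hω0)] at h3
    exact h3
  have h1 : Ex (fun x => (sg (g x i) : ℂ)) = 0 := by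
    rw [h.Ex_comp (H := fun y => (sg (y i) : ℂ)) (fun x y hxy => by simp only [hxy i hi]),
      Ex_coord i (fun c => (sg c : ℂ))]
    simp [sg]
  have h2 := Ex_mul_of_disjoint (hT.comp fun c => (sg c : ℂ)) hF disjoint_sdiff
  rw [h1, zero_mul] at h2
  have h3 := h.Ex_comp (H := fun y => (sg (y i) : ℂ) * ω ^ wt N y) (fun x y hxy => by
    simp only [hxy i hi, depOn_wt N x y hxy])
  rw [h2, Ex_sg_mul_zpow hi hω0] at h3
  have h4 : (1 - ω) * (1 + ω) ≠ 0 := by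
    intro h; apply hω2
    linear_combination -h
  have h5 := left_ne_zero_of_mul h4
  have h6 := right_ne_zero_of_mul h4
  exact mul_ne_zero (div_ne_zero h5 two_ne_zero) (pow_ne_zero _ (div_ne_zero h6 two_ne_zero)) h3.symm

end Blocks

/-! ### Tests against non-uniform blocks; smoothness from uniform blocks -/

section Tests
variable {ι : Type} [Fintype ι] [DecidableEq ι] {n : ℕ}

lemma Ex_exp_le {Ω : Type*} [Fintype Ω] [Nonempty Ω] {z : Ω → ℝ} (hz : ∀ x, |z x| ≤ 1)
    (h0 : Ex z = 0) {l : ℝ} (hl0 : 0 ≤ l) (hl1 : l ≤ 1) :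
    Ex (fun x => Real.exp (l * z x)) ≤ Real.exp (l ^ 2) := by
  have h1 : ∀ x, Real.exp (l * z x) ≤ (1 + l ^ 2) + l * z x := by
    intro x
    have hle : |l * z x| ≤ 1 := by
      rw [abs_mul, abs_of_nonneg hl0]
      exact mul_le_one₀ hl1 (abs_nonneg _) (hz x)
    have h2 := (abs_le.1 (Real.abs_exp_sub_one_sub_id_le hle)).2
    have h3 : z x ^ 2 ≤ 1 := by
      rw [← sq_abs]; exact pow_le_one₀ (abs_nonneg _) (hz x)
    nlinarith [mul_le_mul_of_nonneg_left h3 (sq_nonneg l)]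
  refine (Ex_mono h1).trans ?_
  rw [Ex_add, Ex_mul_left, h0, Ex_const, mul_zero, add_zero, add_comm]
  exact Real.add_one_le_exp _

lemma exists_block_test {g : (ι → Bool) → (Fin n → Bool)} {J : Finset (Fin n)}
    {N : Fin n → Finset (Fin n)} {B : Fin n → Finset ι} (hJ : J.Nonempty)
    (hB : ∀ i ∈ J, ∀ j ∈ J, i ≠ j → Disjoint (B i) (B j))
    (hN : ∀ i ∈ J, ∀ j ∈ J, i ≠ j → Disjoint (N i) (N j))
    (hg : ∀ i ∈ J, ∀ i' ∈ N i, DepOn (B i) (fun x => g x i')) {γ : ℝ} (hγ0 : 0 < γ) (hγ1 : γ ≤ 1)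
    (hp : ∀ i ∈ J, ∃ p, (1 / 2 : ℝ) ^ (N i).card + γ ≤ Ex (fun x => hit (N i) p (g x))) :
    ∃ E : Finset (Fin n → Bool), Ex (fun x => if g x ∈ E then (0 : ℝ) else 1) ≤ 4 / (J.card * γ ^ 2) ∧
      (E.card : ℝ) / 2 ^ n ≤ Real.exp (-(γ ^ 2 / 16) * J.card) := by
  choose! p hp using hp
  have hr : (0 : ℝ) < J.card := by exact_mod_cast hJ.card_pos
  set r : ℝ := (J.card : ℝ) with hrdef
  set z : Fin n → (Fin n → Bool) → ℝ := fun i y => hit (N i) (p i) y - (1 / 2) ^ (N i).card with hz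
  set E := univ.filter fun y : Fin n → Bool => γ * r / 2 ≤ ∑ i ∈ J, z i y with hE
  refine ⟨E, ?_, ?_⟩
  · have h1 : (fun x => if g x ∈ E then (0 : ℝ) else 1) =
        fun x => if g x ∉ E then (1 : ℝ) else 0 := by
      funext x; split_ifs <;> simp_all
    have hv := Ex_sq_sum_centred J (B := B) (g := fun i x => hit (N i) (p i) (g x))
      (fun i hi => DepOn.comp_local (hg i hi) (depOn_hit _ _)) hB
    rw [h1]
    refine (Ex_ite_le_div (t := (γ * r / 2) ^ 2) (by positivity) (fun x => sq_nonneg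
      (∑ i ∈ J, (hit (N i) (p i) (g x) - Ex (fun x => hit (N i) (p i) (g x))))) ?_).trans ?_
    · intro x hx
      have h2 : ∑ i ∈ J, z i (g x) < γ * r / 2 := by
        by_contra h; exact hx (mem_filter.2 ⟨mem_univ _, not_lt.1 h⟩)
      have h3 : ∑ i ∈ J, (hit (N i) (p i) (g x) - Ex (fun x => hit (N i) (p i) (g x)))
          ≤ ∑ i ∈ J, (z i (g x) - γ) := sum_le_sum fun i hi => by
        have := hp i hi
        simp only [hz]; linarith
      rw [sum_sub_distrib (fun i => z i (g x)) (fun _ => γ), sum_const, nsmul_eq_mul, ← hrdef] at h3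
      have h4 : 0 < γ * r := by positivity
      nlinarith
    · rw [div_le_div_iff₀ (by positivity) (by positivity)]
      have h5 : ∑ i ∈ J, Ex (fun x => hit (N i) (p i) (g x) ^ 2) ≤ r := by
        rw [hrdef, card_eq_sum_ones, Nat.cast_sum]
        refine sum_le_sum fun i _ => ?_
        refine Ex_le_const fun x => ?_
        rw [Nat.cast_one]
        exact pow_le_one₀ (hit_nonneg _ _ _) (hit_le_one _ _ _)
      have h6 := hv.trans h5
      have h7 : 0 ≤ r * γ ^ 2 := by positivity
      calc _ ≤ r * (r * γ ^ 2) := mul_le_mul_of_nonneg_right h6 h7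
        _ = _ := by ring
  · rw [card_div_eq_Ex]
    set l := γ / 4 with hl
    have h1 : Ex (fun y => Real.exp (∑ i ∈ J, l * z i y)) ≤ Real.exp (l ^ 2) ^ J.card := by
      simp_rw [Real.exp_sum]
      rw [Ex_prod_of_disjoint J (A := N) (g := fun i y => Real.exp (l * z i y))
        (fun i _ => (depOn_hit (N i) (p i)).comp fun u => Real.exp (l * (u - (1 / 2) ^ (N i).card))) hN]
      rw [← prod_const]
      refine prod_le_prod (fun i _ => Ex_nonneg fun y => (Real.exp_pos _).le) fun i _ => ?_
      refine Ex_exp_le (fun y => ?_) ?_ (by positivity) (by rw [hl]; linarith)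
      · have h2 : (1 / 2 : ℝ) ^ (N i).card ≤ 1 := pow_le_one₀ (by norm_num) (by norm_num)
        have h3 : (0 : ℝ) ≤ (1 / 2 : ℝ) ^ (N i).card := by positivity
        have h4 := hit_nonneg (N i) (p i) y
        have h5 := hit_le_one (N i) (p i) y
        rw [abs_le]; constructor <;> simp only [hz] <;> linarith
      · simp only [hz]
        rw [Ex_sub, Ex_const]
        have := Ex_hit (N i) (p i)
        rw [sub_eq_zero]; exact this
    refine (Ex_ite_le_div (t := Real.exp (l * (γ * r / 2))) (Real.exp_pos _)
      (g := fun y => Real.exp (∑ i ∈ J, l * z i y)) (fun y => (Real.exp_pos _).le) ?_).trans ?_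
    · intro y hy
      rw [← mul_sum]
      exact Real.exp_le_exp.2 (mul_le_mul_of_nonneg_left (mem_filter.1 hy).2 (by positivity))
    · rw [div_le_iff₀ (Real.exp_pos _), ← Real.exp_add]
      refine h1.trans ?_
      rw [← Real.exp_nat_mul, ← hrdef]
      apply Real.exp_le_exp.2
      apply le_of_eq
      rw [hl]; ring

lemma Ex_mul_pin (V : Finset ι) (b : ι → Bool) (F : (ι → Bool) → ℝ) :
    Ex (fun x => F x * if ∀ i ∈ V, x i = b i then 1 else 0)
      = (1 / 2) ^ V.card * Ex (fun y => F (ov V b y)) := by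
  have h1 : ∀ x, F x * (if ∀ i ∈ V, x i = b i then (1 : ℝ) else 0)
      = F (ov V b x) * if ∀ i ∈ V, x i = b i then 1 else 0 := by
    intro x
    split_ifs with h
    · congr 2
      funext i
      by_cases hi : i ∈ V
      · rw [ov_of_mem hi, h i hi]
      · rw [ov_of_notMem hi]
    · simp
  have h2 : DepOn (univ \ V) (fun x => F (ov V b x)) := by
    intro x y h
    have : ov V b x = ov V b y := by
      funext i
      by_cases hi : i ∈ V
      · rw [ov_of_mem hi, ov_of_mem hi]
      · rw [ov_of_notMem hi, ov_of_notMem hi]; exact h i (by simp [hi])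
    simp only [this]
  have h3 : DepOn V (fun x : ι → Bool => if ∀ i ∈ V, x i = b i then (1 : ℝ) else 0) := by
    intro x y h
    have : (∀ i ∈ V, x i = b i) ↔ ∀ i ∈ V, y i = b i := forall₂_congr fun i hi => by rw [h i hi]
    simp only [this]
  simp_rw [h1]
  rw [Ex_mul_of_disjoint h2 h3 sdiff_disjoint, Ex_pin, mul_comm]

/-- Many disjoint places where the integer statistic `W` can be increased by `Δ` make its law
nearly invariant under the shift by `Δ`. -/
lemma abs_shift_le {κ : Type*} [DecidableEq κ] (W : (ι → Bool) → ℤ) {J : Finset κ}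
    {B : κ → Finset ι} (hJ : J.Nonempty) (hB : ∀ i ∈ J, ∀ j ∈ J, i ≠ j → Disjoint (B i) (B j))
    {b : ℕ} (hb : ∀ i ∈ J, (B i).card ≤ b) {Δ : ℤ}
    (h : ∀ i ∈ J, ∃ a a' : ι → Bool, ∀ y, W (ov (B i) a' y) = W (ov (B i) a y) + Δ)
    {φ : ℤ → ℝ} (hφ : ∀ k, |φ k| ≤ 1) :
    |Ex (fun x => φ (W x)) - Ex (fun x => φ (W x + Δ))| ≤ 2 / √(J.card * (1 / 2) ^ b) := by
  choose! a a' ha using h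
  set X : (κ → ι → Bool) → (ι → Bool) → ℝ := fun a x =>
    ∑ i ∈ J, if ∀ j ∈ B i, x j = a i j then 1 else 0 with hX
  set μ : ℝ := ∑ i ∈ J, (1 / 2) ^ (B i).card with hμ
  have hμ0 : J.card * (1 / 2 : ℝ) ^ b ≤ μ := by
    rw [hμ, ← nsmul_eq_mul, ← sum_const]
    exact sum_le_sum fun i hi => pow_le_pow_of_le_one (by norm_num) (by norm_num) (hb i hi)
  have hpos : (0 : ℝ) < J.card * (1 / 2 : ℝ) ^ b := by
    have : (0 : ℝ) < J.card := by exact_mod_cast hJ.card_pos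
    positivity
  have hμp : 0 < μ := hpos.trans_le hμ0
  have hvar : ∀ a, Ex (fun x => (X a x - μ) ^ 2) ≤ μ := by
    intro a
    have h1 := Ex_sq_sum_centred J (B := B)
      (g := fun i x => if ∀ j ∈ B i, x j = a i j then (1 : ℝ) else 0) (fun i _ => by
        intro x y h
        have : (∀ j ∈ B i, x j = a i j) ↔ ∀ j ∈ B i, y j = a i j :=
          forall₂_congr fun i hi => by rw [h i hi]
        simp only [this]) hB
    simp_rw [Ex_pin, sum_sub_distrib] at h1
    refine h1.trans (le_of_eq ?_)
    rw [hμ]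
    refine sum_congr rfl fun i _ => ?_
    rw [← Ex_pin (R := ℝ) (B i) (a i)]
    congr 1; funext x; split_ifs <;> simp
  have hcs : ∀ (a) (ψ : (ι → Bool) → ℝ), (∀ x, |ψ x| ≤ 1) →
      |Ex (fun x => ψ x * X a x) - μ * Ex ψ| ≤ √μ := by
    intro a ψ hψ
    have h1 : Ex (fun x => ψ x * X a x) - μ * Ex ψ = Ex (fun x => ψ x * (X a x - μ)) := by
      rw [← Ex_mul_left, ← Ex_sub]; congr 1; funext x; ring
    rw [h1]
    apply Real.abs_le_sqrt
    refine (Ex_mul_sq_le _ _).trans ?_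
    have h2 : Ex (fun x => ψ x ^ 2) ≤ 1 := Ex_le_const fun x => by
      rw [← sq_abs]; exact pow_le_one₀ (abs_nonneg _) (hψ x)
    have h3 : 0 ≤ Ex (fun x => (X a x - μ) ^ 2) := Ex_nonneg fun x => sq_nonneg _
    nlinarith [hvar a]
  have heq : Ex (fun x => φ (W x) * X a' x) = Ex (fun x => φ (W x + Δ) * X a x) := by
    simp only [hX, mul_sum]
    rw [Ex_sum, Ex_sum]
    refine sum_congr rfl fun i hi => ?_
    rw [Ex_mul_pin (B i) (a' i) (fun x => φ (W x)), Ex_mul_pin (B i) (a i) (fun x => φ (W x + Δ))]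
    simp_rw [ha i hi]
  have h1 := hcs a' (fun x => φ (W x)) fun x => hφ _
  have h2 := hcs a (fun x => φ (W x + Δ)) fun x => hφ _
  rw [heq] at h1
  have h3 : μ * |Ex (fun x => φ (W x)) - Ex (fun x => φ (W x + Δ))| ≤ 2 * √μ := by
    rw [← abs_of_pos hμp, ← abs_mul, abs_of_pos hμp]
    rw [abs_le] at h1 h2 ⊢
    constructor <;> linarith [h1.1, h1.2, h2.1, h2.2]
  have h4 : |Ex (fun x => φ (W x)) - Ex (fun x => φ (W x + Δ))| ≤ 2 / √μ := by
    rw [le_div_iff₀ (Real.sqrt_pos.2 hμp)]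
    refine le_of_mul_le_mul_right ?_ (Real.sqrt_pos.2 hμp)
    rw [mul_assoc, Real.mul_self_sqrt hμp.le, mul_comm]
    exact h3
  refine h4.trans ?_
  gcongr

end Tests

section Closure

lemma closure_bound {s : Set ℤ} {t : ℤ} (ht : t ∈ AddSubgroup.closure s) :
    ∃ K : ℕ, ∀ P : ℤ → ℝ → Prop, P 0 0 → (∀ u e, P u e → P (-u) e) →
      (∀ u v e e', P u e → P v e' → P (u + v) (e + e')) → ∀ η, (∀ u ∈ s, P u η) → P t (K * η) := by
  induction ht using AddSubgroup.closure_induction with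
  | mem x hx => exact ⟨1, fun P _ _ _ η h => by simpa using h x hx⟩
  | zero => exact ⟨0, fun P h0 _ _ η _ => by simpa using h0⟩
  | add x y _ _ hx hy =>
    obtain ⟨K, hK⟩ := hx
    obtain ⟨K', hK'⟩ := hy
    refine ⟨K + K', fun P h0 h1 h2 η h => ?_⟩
    have := h2 _ _ _ _ (hK P h0 h1 h2 η h) (hK' P h0 h1 h2 η h)
    rwa [← add_mul, ← Nat.cast_add] at this
  | neg x _ hx =>
    obtain ⟨K, hK⟩ := hx
    exact ⟨K, fun P h0 h1 h2 η h => h1 _ _ (hK P h0 h1 h2 η h)⟩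

lemma closure_bound_uniform (F : Finset (Finset ℤ)) (t : ℤ) : ∃ K : ℕ, ∀ s ∈ F,
    t ∈ AddSubgroup.closure (s : Set ℤ) → ∀ P : ℤ → ℝ → Prop, P 0 0 → (∀ u e, P u e → P (-u) e) →
      (∀ u v e e', P u e → P v e' → P (u + v) (e + e')) → (∀ u e e', e ≤ e' → P u e → P u e') →
      ∀ η, 0 ≤ η → (∀ u ∈ s, P u η) → P t (K * η) := by
  have h : ∀ s : Finset ℤ, ∃ K : ℕ, t ∈ AddSubgroup.closure (s : Set ℤ) →
      ∀ P : ℤ → ℝ → Prop, P 0 0 → (∀ u e, P u e → P (-u) e) →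
      (∀ u v e e', P u e → P v e' → P (u + v) (e + e')) → ∀ η, (∀ u ∈ s, P u η) → P t (K * η) := by
    intro s
    by_cases ht : t ∈ AddSubgroup.closure (s : Set ℤ)
    · obtain ⟨K, hK⟩ := closure_bound ht
      exact ⟨K, fun _ P h0 h1 h2 η h => hK P h0 h1 h2 η (by simpa using h)⟩
    · exact ⟨0, fun h => absurd h ht⟩
  choose K hK using h
  refine ⟨∑ s ∈ F, K s, fun s hs ht P h0 h1 h2 h3 η hη h => ?_⟩
  refine h3 _ _ _ ?_ (hK s ht P h0 h1 h2 η h)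
  refine mul_le_mul_of_nonneg_right ?_ hη
  exact_mod_cast single_le_sum (f := K) (fun _ _ => Nat.zero_le _) hs

end Closure

/-! ### Smoothness of the weight in steps of two -/

lemma wt_add_compl {n : ℕ} (N : Finset (Fin n)) (y : Fin n → Bool) :
    wt univ y = wt N y + wt (univ \ N) y := by
  unfold wt
  rw [add_comm, sum_sdiff (subset_univ N)]

lemma wt_resample {ι : Type} [Fintype ι] [DecidableEq ι] {n : ℕ} {T : Fin n → Finset ι}
    {S : Finset ι} {g : (ι → Bool) → (Fin n → Bool)}
    (hg : ∀ i, DepOn (T i \ S) (fun x => g x i)) (i : Fin n) (a b y : ι → Bool) :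
    wt univ (g (ov (blk T S i) (ov (T i \ S) a b) y))
      = wt univ (g (ov (blk T S i) b y))
        + (wt (nb T S i) (g (ov (T i \ S) a b)) - wt (nb T S i) (g b)) := by
  have h1 : ∀ c, wt (nb T S i) (g (ov (blk T S i) c y)) = wt (nb T S i) (g c) := fun c => by
    refine depOn_wt _ _ _ fun i' hi' => hg i' _ _ fun j hj => ov_of_mem ?_
    exact sdiff_subset_blk T S hi' hj
  have h2 : wt (univ \ nb T S i) (g (ov (blk T S i) (ov (T i \ S) a b) y))
      = wt (univ \ nb T S i) (g (ov (blk T S i) b y)) := by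
    refine depOn_wt _ _ _ fun i' hi' => hg i' _ _ fun j hj => ?_
    have hn : i' ∉ nb T S i := (mem_sdiff.1 hi').2
    have hj' : j ∉ T i \ S := by
      intro h
      apply hn
      refine mem_filter.2 ⟨mem_univ _, Or.inr (not_disjoint_iff.2 ⟨j, h, (mem_sdiff.1 hj).1⟩)⟩
    by_cases hjb : j ∈ blk T S i
    · rw [ov_of_mem hjb, ov_of_mem hjb, ov_of_notMem hj']
    · rw [ov_of_notMem hjb, ov_of_notMem hjb]
  rw [wt_add_compl (nb T S i), h1, h2, wt_add_compl (nb T S i) (g (ov (blk T S i) b y)), h1]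
  ring

lemma smooth_of_unif (b κ : ℕ) : ∃ B : ℝ, 0 ≤ B ∧ ∀ (n : ℕ) (ι : Type) [Fintype ι] [DecidableEq ι]
    (T : Fin n → Finset ι) (S : Finset ι) (g : (ι → Bool) → (Fin n → Bool)) (J : Finset (Fin n)),
    J.Nonempty → (∀ i, DepOn (T i \ S) (fun x => g x i)) → (∀ i ∈ J, (nb T S i).card ≤ κ) →
    (∀ i ∈ J, (blk T S i).card ≤ b) →
    (∀ i ∈ J, ∀ j ∈ J, i ≠ j → Disjoint (blk T S i) (blk T S j)) →
    (∀ i ∈ J, UnifBlock g (nb T S i)) → ∀ (j : ℕ) (φ : ℤ → ℝ), (∀ k, |φ k| ≤ 1) →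
      |Ex (fun x => φ (wt univ (g x))) - Ex (fun x => φ (wt univ (g x) + 2 * j))|
        ≤ j * (B / √(J.card)) := by
  set F := (Icc (-(κ : ℤ)) κ).powerset with hF
  obtain ⟨K, hK⟩ := closure_bound_uniform F 2
  have hFp : 0 < F.card := card_pos.2 ⟨∅, by simp [hF]⟩
  have hFp' : (0 : ℝ) < F.card := by exact_mod_cast hFp
  refine ⟨K * (2 / √((1 / 2) ^ b / F.card)), by positivity,
    fun n ι _ _ T S g J hJ hg hnb hblk hdis hun => ?_⟩
  have hJp : (0 : ℝ) < J.card := by exact_mod_cast hJ.card_pos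
  obtain ⟨s, hsF, hs⟩ := exists_le_card_fiber_of_nsmul_le_card_of_maps_to (s := J) (t := F)
    (f := fun i => diffs g (nb T S i) (T i \ S)) (b := (J.card : ℝ) / F.card)
    (fun i hi => mem_powerset.2 (diffs_subset g _ _ (hnb i hi))) ⟨∅, by simp [hF]⟩
    (by rw [nsmul_eq_mul, mul_div_cancel₀ _ hFp'.ne'])
  set Js := J.filter fun i => diffs g (nb T S i) (T i \ S) = s with hJs
  have hJsp : (0 : ℝ) < Js.card := lt_of_lt_of_le (by positivity) hs
  have hJsn : Js.Nonempty := card_pos.1 (by exact_mod_cast hJsp)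
  set P : ℤ → ℝ → Prop := fun t e => ∀ φ : ℤ → ℝ, (∀ k, |φ k| ≤ 1) →
    |Ex (fun x => φ (wt univ (g x))) - Ex (fun x => φ (wt univ (g x) + t))| ≤ e with hP
  have hP0 : P 0 0 := fun φ _ => by simp
  have hPadd : ∀ u v e e', P u e → P v e' → P (u + v) (e + e') := by
    intro u v e e' hu hv φ hφ
    have h1 := hu φ hφ
    have h2 := hv (fun k => φ (k + u)) fun k => hφ _
    have h3 : ∀ x, wt univ (g x) + (u + v) = wt univ (g x) + v + u := fun x => by ring
    simp_rw [h3]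
    exact (abs_sub_le _ _ _).trans (add_le_add h1 h2)
  have hPneg : ∀ u e, P u e → P (-u) e := by
    intro u e hu φ hφ
    have h1 := hu (fun k => φ (k - u)) fun k => hφ _
    rw [abs_sub_comm] at h1
    simpa [sub_eq_add_neg] using h1
  have hPmono : ∀ u e e', e ≤ e' → P u e → P u e' := fun u e e' hee hu φ hφ => (hu φ hφ).trans hee
  obtain ⟨i0, hi0⟩ := hJsn
  have h2mem : (2 : ℤ) ∈ AddSubgroup.closure (s : Set ℤ) := by
    rw [← (mem_filter.1 hi0).2]
    exact (hun i0 (mem_filter.1 hi0).1).two_mem_closure (mem_nb_self T S i0) (hg i0)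
  have hbase : ∀ u ∈ s, P u (2 / √((1 / 2) ^ b / F.card) / √(J.card)) := by
    intro u hu φ hφ
    refine (abs_shift_le (fun x => wt univ (g x)) (J := Js) (B := fun i => blk T S i) ⟨i0, hi0⟩
      (fun i hi j hj => hdis i (mem_filter.1 hi).1 j (mem_filter.1 hj).1)
      (fun i hi => hblk i (mem_filter.1 hi).1) (Δ := u) ?_ hφ).trans ?_
    · intro i hi
      rw [← (mem_filter.1 hi).2] at hu
      obtain ⟨p, _, hp⟩ := mem_image.1 hu
      exact ⟨p.2, ov (T i \ S) p.1 p.2, fun y => by rw [wt_resample hg, hp]⟩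
    · rw [div_div, ← Real.sqrt_mul (by positivity)]
      have : (1 / 2 : ℝ) ^ b / F.card * J.card ≤ Js.card * (1 / 2) ^ b := by
        rw [div_mul_eq_mul_div, mul_div_assoc, mul_comm]
        exact mul_le_mul_of_nonneg_right hs (by positivity)
      gcongr
  have hP2 := hK s hsF h2mem P hP0 hPneg hPadd hPmono _ (by positivity) hbase
  intro j
  have : P (2 * j) (j * (K * (2 / √((1 / 2) ^ b / F.card)) / √(J.card))) := by
    induction j with
    | zero => simpa using hP0
    | succ j ih =>
      have := hPadd _ _ _ _ ih hP2
      push_cast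
      have e1 : (2 : ℤ) * (j + 1) = 2 * j + 2 := by ring
      have e2 : ((j : ℝ) + 1) * (K * (2 / √((1 / 2) ^ b / F.card)) / √(J.card))
        = j * (K * (2 / √((1 / 2) ^ b / F.card)) / √(J.card))
          + K * (2 / √((1 / 2) ^ b / F.card) / √(J.card)) := by ring
      rw [e1, e2]
      exact this
  exact this

lemma abs_sum_sub_mul_le {α : Type} [Fintype α] (A D : α → ℝ) {τ : α → ℝ} (h : ∀ x, |τ x| ≤ 1) :
    |∑ x, A x * τ x - ∑ x, D x * τ x| ≤ 2 * tvd A D := by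
  unfold tvd
  rw [mul_div_cancel₀ _ (two_ne_zero), ← sum_sub_distrib]
  refine (abs_sum_le_sum_abs _ _).trans (sum_le_sum fun x _ => ?_)
  rw [← sub_mul, abs_mul]
  exact mul_le_of_le_one_right (abs_nonneg _) (h x)

lemma tvd_nonneg {α : Type} [Fintype α] (A D : α → ℝ) : 0 ≤ tvd A D :=
  div_nonneg (sum_nonneg fun _ _ => abs_nonneg _) zero_le_two

/-- The weight of a local function close to a uniform distribution on a not too small set is nearly
invariant under even shifts. -/
theorem micro_smooth (d : ℕ) : ∃ c : ℝ, 0 < c ∧ ∃ B : ℝ, 0 ≤ B ∧ ∀ δ > 0, ∃ N : ℕ, ∀ n, N ≤ n →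
    ∀ (ι : Type) [Fintype ι] [DecidableEq ι] (f : (ι → Bool) → (Fin n → Bool)), Loc d f →
    ∀ C : Finset (Fin n → Bool), Real.exp (-c * n) * 2 ^ n ≤ C.card →
    ∀ (j : ℕ) (φ : ℤ → ℝ), (∀ k, |φ k| ≤ 1) →
      |Ex (fun x => φ (wt univ (f x))) - Ex (fun x => φ (wt univ (f x) + 2 * j))|
        ≤ j * (B / √n) + 4 * tvd (law f) (unifOn C) + δ := by
  set κ : ℕ → ℕ := fun L => 1 + d * L with hκ
  set γ : ℕ → ℝ := fun L => (1 / 2) ^ (κ L + d * κ L) with hγ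
  have hγ0 : ∀ L, 0 < γ L := fun L => by simp only [hγ]; positivity
  have hγ1 : ∀ L, γ L ≤ 1 := fun L => pow_le_one₀ (by norm_num) (by norm_num)
  obtain ⟨Q, τ, hτ, HQ⟩ := exists_blocks d (c0 := fun L => γ L ^ 2 / 64) fun L => by
    have := hγ0 L; positivity
  have hκm : ∀ L ≤ Q, κ L ≤ κ Q := fun L hL => by simp only [hκ]; gcongr
  have hγm : ∀ L ≤ Q, γ Q ≤ γ L := fun L hL => by
    simp only [hγ]
    refine pow_le_pow_of_le_one (by norm_num) (by norm_num) ?_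
    have := hκm L hL
    gcongr
  obtain ⟨B, hB, HB⟩ := smooth_of_unif (d * κ Q) (κ Q)
  have hγQ := hγ0 Q
  set c := γ Q ^ 2 * τ / 128 with hc
  have hc0 : 0 < c := by positivity
  refine ⟨c, hc0, B / √(τ / 2), by positivity, fun δ hδ => ?_⟩
  set M : ℝ := 2 * (8 / (τ * γ Q ^ 2)) + 2 / c with hM
  have hM0 : 0 < M := by positivity
  refine ⟨⌈M / δ⌉₊ + 1, fun n hn ι _ _ f hf C hC j φ hφ => ?_⟩
  have hn0 : 0 < n := by omega
  have hn' : (0 : ℝ) < n := by exact_mod_cast hn0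
  have hMn : M / n ≤ δ := by
    rw [div_le_iff₀ hn', mul_comm, ← div_le_iff₀ hδ]
    refine (Nat.le_ceil _).trans ?_
    exact_mod_cast (by omega : ⌈M / δ⌉₊ ≤ n)
  obtain ⟨T, hT, hfT⟩ := hf
  obtain ⟨L, hLQ, S, J, hnb, hdis, hS, hJ⟩ := HQ n hn0 ι T hT
  have hJp : (0 : ℝ) < J.card := lt_of_lt_of_le (by positivity) hJ
  have hblk : ∀ i ∈ J, (blk T S i).card ≤ d * κ L := fun i hi => card_blk_le hT (hnb i hi)
  set fA : Finset ι → (ι → Bool) → (Fin n → Bool) := fun A x => f (ov S (ind A) x) with hfA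
  have hdep : ∀ A i, DepOn (T i \ S) (fun x => fA A x i) := fun A i => (hfT i).ov _
  classical
  set Jn : Finset ι → Finset (Fin n) := fun A => J.filter fun i => ¬ UnifBlock (fA A) (nb T S i)
    with hJn
  set bad : Finset (Finset ι) := S.powerset.filter fun A => J.card ≤ 2 * (Jn A).card with hbad
  set e1 : ℝ := 8 / (τ * γ Q ^ 2) / n with he1
  have he10 : 0 ≤ e1 := by positivity
  have htest : ∀ A, ∃ E : Finset (Fin n → Bool), A ∈ bad →
      Ex (fun x => if fA A x ∈ E then (0 : ℝ) else 1) ≤ e1 ∧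
      (E.card : ℝ) / 2 ^ n ≤ Real.exp (-(γ L ^ 2 / 32) * J.card) := by
    intro A
    by_cases hA : A ∈ bad
    swap
    · exact ⟨∅, fun h => absurd h hA⟩
    have h1 := (mem_filter.1 hA).2
    have h1' : (J.card : ℝ) ≤ 2 * (Jn A).card := by exact_mod_cast h1
    have h2 : (Jn A).Nonempty := by
      rw [← card_pos]
      have : 0 < J.card := by exact_mod_cast hJp
      omega
    have hJnp : (0 : ℝ) < (Jn A).card := by exact_mod_cast h2.card_pos
    have hL0 := hγ0 L
    obtain ⟨E, hE1, hE2⟩ := exists_block_test (g := fA A) (J := Jn A) (N := nb T S)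
      (B := blk T S) h2
      (fun i hi j hj => hdis i (mem_filter.1 hi).1 j (mem_filter.1 hj).1)
      (fun i hi j hj hij => disjoint_nb hij
        (hdis i (mem_filter.1 hi).1 j (mem_filter.1 hj).1 hij))
      (fun i hi i' hi' => (hdep A i').mono (sdiff_subset_blk T S hi')) (hγ0 L) (hγ1 L)
      (fun i hi => by
        obtain ⟨hiJ, hnu⟩ := mem_filter.1 hi
        obtain ⟨p, hp⟩ := exists_heavy (B := blk T S i)
          (fun i' hi' => (hdep A i').mono (sdiff_subset_blk T S hi')) hnu
        refine ⟨p, le_trans ?_ hp⟩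
        refine add_le_add le_rfl ?_
        exact pow_le_pow_of_le_one (by norm_num) (by norm_num)
          (add_le_add (hnb i hiJ) (hblk i hiJ)))
    refine ⟨E, fun _ => ⟨hE1.trans ?_, hE2.trans ?_⟩⟩
    · rw [he1, div_div]
      rw [div_le_div_iff₀ (by positivity) (by positivity)]
      have h3 : γ Q ^ 2 ≤ γ L ^ 2 := pow_le_pow_left₀ hγQ.le (hγm L hLQ) 2
      have h4 : τ * n ≤ 2 * (Jn A).card := hJ.trans h1'
      have h5 := mul_le_mul h4 h3 (by positivity) (by positivity)
      nlinarith
    · apply Real.exp_le_exp.2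
      have := mul_le_mul_of_nonneg_left h1' (show 0 ≤ γ L ^ 2 / 32 by positivity)
      nlinarith
  choose E hE using htest
  set EE := bad.biUnion E with hEE
  set β : ℝ := (1 / 2) ^ S.card * bad.card with hβ
  have hw0 : (0 : ℝ) ≤ (1 / 2) ^ S.card := by positivity
  have hw1 : (1 / 2 : ℝ) ^ S.card * 2 ^ S.card = 1 := by rw [← mul_pow]; norm_num
  have hβ1 : β ≤ 1 := by
    rw [← hw1, hβ]
    refine mul_le_mul_of_nonneg_left ?_ hw0
    have : bad.card ≤ 2 ^ S.card := by
      rw [← card_powerset]; exact card_filter_le _ _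
    exact_mod_cast this
  -- the test has small uniform mass
  have hEEc : (EE.card : ℝ) / 2 ^ n ≤ Real.exp (-(2 * c) * n) := by
    have h1 : (EE.card : ℝ) / 2 ^ n ≤ 2 ^ S.card * Real.exp (-(γ L ^ 2 / 32) * J.card) := by
      calc (EE.card : ℝ) / 2 ^ n ≤ (∑ A ∈ bad, ((E A).card : ℝ)) / 2 ^ n := by
            gcongr; exact_mod_cast card_biUnion_le
        _ = ∑ A ∈ bad, ((E A).card : ℝ) / 2 ^ n := sum_div _ _ _
        _ ≤ ∑ _A ∈ bad, Real.exp (-(γ L ^ 2 / 32) * J.card) :=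
            sum_le_sum fun A hA => (hE A hA).2
        _ = bad.card * Real.exp (-(γ L ^ 2 / 32) * J.card) := by rw [sum_const, nsmul_eq_mul]
        _ ≤ _ := by
            refine mul_le_mul_of_nonneg_right ?_ (Real.exp_pos _).le
            have : bad.card ≤ 2 ^ S.card := by
              rw [← card_powerset]; exact card_filter_le _ _
            exact_mod_cast this
    have h2 : (2 : ℝ) ^ S.card ≤ Real.exp S.card := by
      rw [← mul_one (S.card : ℝ), Real.exp_nat_mul]
      refine pow_le_pow_left₀ (by norm_num) ?_ _
      have := Real.add_one_le_exp 1
      linarith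
    refine h1.trans ((mul_le_mul_of_nonneg_right h2 (Real.exp_pos _).le).trans ?_)
    rw [← Real.exp_add]
    apply Real.exp_le_exp.2
    have h3 : γ Q ^ 2 ≤ γ L ^ 2 := pow_le_pow_left₀ hγQ.le (hγm L hLQ) 2
    have h4 := mul_le_mul h3 hJ (by positivity) (by positivity)
    rw [hc]
    nlinarith
  -- mass of bad restrictions
  have hβb : β ≤ 2 * tvd (law f) (unifOn C) + e1 + Real.exp (-c * n) := by
    have h1 := (abs_le.1 (abs_sum_sub_mul_le (law f) (unifOn C)
      (τ := fun y => if y ∈ EE then 1 else 0) fun y => by split_ifs <;> simp)).2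
    rw [sum_law_mul f (fun y => if y ∈ EE then (1 : ℝ) else 0),
      Ex_cond S (fun x => if f x ∈ EE then (1 : ℝ) else 0)] at h1
    have h2 : β - e1 ≤ (1 / 2) ^ S.card *
        ∑ A ∈ S.powerset, Ex (fun y => if f (ov S (ind A) y) ∈ EE then (1 : ℝ) else 0) := by
      have h3 : ∑ A ∈ bad, (1 - e1) ≤
          ∑ A ∈ S.powerset, Ex (fun y => if f (ov S (ind A) y) ∈ EE then (1 : ℝ) else 0) := by
        refine (sum_le_sum fun A hA => ?_).trans
          (sum_le_sum_of_subset_of_nonneg (filter_subset _ _)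
            fun A _ _ => Ex_nonneg fun x => by split_ifs <;> norm_num)
        have h4 := (hE A hA).1
        have h5 : 1 - Ex (fun x => if fA A x ∈ E A then (0 : ℝ) else 1)
            ≤ Ex (fun y => if f (ov S (ind A) y) ∈ EE then (1 : ℝ) else 0) := by
          have h6 : Ex (fun x => (1 : ℝ) - (if fA A x ∈ E A then (0 : ℝ) else 1))
              = 1 - Ex (fun x => if fA A x ∈ E A then (0 : ℝ) else 1) := by
            rw [Ex_sub, Ex_const]
          rw [← h6]
          apply Ex_mono
          intro x
          by_cases hx : fA A x ∈ E A
          · have : f (ov S (ind A) x) ∈ EE := mem_biUnion.2 ⟨A, hA, hx⟩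
            rw [if_pos hx, if_pos this]; norm_num
          · rw [if_neg hx]; split_ifs <;> norm_num
        linarith
      rw [sum_const, nsmul_eq_mul] at h3
      have h6 := mul_le_mul_of_nonneg_left h3 hw0
      rw [← mul_assoc, ← hβ] at h6
      nlinarith
    have h7 : ∑ y, unifOn C y * (if y ∈ EE then (1 : ℝ) else 0) ≤ Real.exp (-c * n) := by
      have hCp : (0 : ℝ) < C.card := lt_of_lt_of_le (by positivity) hC
      calc ∑ y, unifOn C y * (if y ∈ EE then (1 : ℝ) else 0)
          ≤ ∑ y, (if y ∈ EE then (C.card : ℝ)⁻¹ else 0) := by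
            refine sum_le_sum fun y _ => ?_
            unfold unifOn
            split_ifs <;> simp
        _ = EE.card / C.card := by
            rw [← sum_filter, sum_const, nsmul_eq_mul, filter_mem_eq_inter, univ_inter,
              div_eq_mul_inv]
        _ ≤ Real.exp (-c * n) := by
            rw [div_le_iff₀ hCp]
            rw [div_le_iff₀ (by positivity)] at hEEc
            refine hEEc.trans ?_
            have h8 : Real.exp (-(2 * c) * n) = Real.exp (-c * n) * Real.exp (-c * n) := by
              rw [← Real.exp_add]; congr 1; ring
            rw [h8, mul_assoc]
            exact mul_le_mul_of_nonneg_left hC (Real.exp_pos _).le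
    linarith
  have hexp : Real.exp (-c * n) ≤ 1 / (c * n) := by
    rw [neg_mul, Real.exp_neg, ← one_div]
    refine one_div_le_one_div_of_le (by positivity) ?_
    have := Real.add_one_le_exp (c * n)
    linarith
  -- good restrictions are smooth
  have hgood : ∀ A ∈ S.powerset, A ∉ bad →
      |Ex (fun x => φ (wt univ (fA A x))) - Ex (fun x => φ (wt univ (fA A x) + 2 * j))|
        ≤ j * (B / √(τ / 2) / √n) := by
    intro A hA hAb
    set Ju := J.filter fun i => UnifBlock (fA A) (nb T S i) with hJu
    have h1 : J.card ≤ 2 * Ju.card := by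
      have h2 : Ju.card + (Jn A).card = J.card := by
        convert card_filter_add_card_filter_not (s := J)
          (fun i => UnifBlock (fA A) (nb T S i))
      have h3 : ¬ J.card ≤ 2 * (Jn A).card := fun h => hAb (mem_filter.2 ⟨hA, h⟩)
      omega
    have h1' : (J.card : ℝ) ≤ 2 * Ju.card := by exact_mod_cast h1
    have hJuN : Ju.Nonempty := by
      rw [← card_pos]
      have : 0 < J.card := by exact_mod_cast hJp
      omega
    refine (HB n ι T S (fA A) Ju hJuN (hdep A)
      (fun i hi => (hnb i (mem_filter.1 hi).1).trans (hκm L hLQ))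
      (fun i hi => (hblk i (mem_filter.1 hi).1).trans (Nat.mul_le_mul_left _ (hκm L hLQ)))
      (fun i hi j hj => hdis i (mem_filter.1 hi).1 j (mem_filter.1 hj).1)
      (fun i hi => (mem_filter.1 hi).2) j φ hφ).trans ?_
    rw [div_div, ← Real.sqrt_mul (by positivity)]
    have : τ / 2 * n ≤ Ju.card := by linarith
    gcongr
  rw [Ex_cond S (fun x => φ (wt univ (f x))), Ex_cond S (fun x => φ (wt univ (f x) + 2 * j)),
    ← mul_sub, ← sum_sub_distrib, abs_mul, abs_of_nonneg hw0]
  have hsum : |∑ A ∈ S.powerset, (Ex (fun x => φ (wt univ (f (ov S (ind A) x))))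
      - Ex (fun x => φ (wt univ (f (ov S (ind A) x)) + 2 * j)))|
      ≤ ∑ A ∈ S.powerset, (j * (B / √(τ / 2) / √n) + if A ∈ bad then 2 else 0) := by
    refine (abs_sum_le_sum_abs _ _).trans (sum_le_sum fun A hA => ?_)
    by_cases hAb : A ∈ bad
    · rw [if_pos hAb]
      have h1 : |Ex (fun x => φ (wt univ (f (ov S (ind A) x))))| ≤ 1 :=
        abs_Ex_le_of fun x => hφ _
      have h2 : |Ex (fun x => φ (wt univ (f (ov S (ind A) x)) + 2 * j))| ≤ 1 :=
        abs_Ex_le_of fun x => hφ _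
      have h3 : 0 ≤ (j : ℝ) * (B / √(τ / 2) / √n) := by positivity
      have h4 := abs_sub (Ex (fun x => φ (wt univ (f (ov S (ind A) x)))))
        (Ex (fun x => φ (wt univ (f (ov S (ind A) x)) + 2 * j)))
      linarith
    · rw [if_neg hAb, add_zero]
      exact hgood A hA hAb
  refine (mul_le_mul_of_nonneg_left hsum hw0).trans ?_
  rw [sum_add_distrib, sum_const, card_powerset, nsmul_eq_mul, ← sum_filter, sum_const,
    nsmul_eq_mul, mul_add]
  push_cast
  have h1 : (S.powerset.filter fun A => A ∈ bad) = bad := by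
    ext A; simp only [mem_filter, hbad]; tauto
  have h3 : (1 / 2 : ℝ) ^ S.card * (bad.card * 2) = β * 2 := by rw [hβ]; ring
  rw [h1, ← mul_assoc, hw1, one_mul, h3]
  have h2 : M / n = 2 * e1 + 2 * (1 / (c * n)) := by
    rw [hM, he1, add_div]; field_simp
  linarith

/-! ### Binomial weights -/

lemma wt_univ_eq {n : ℕ} (y : Fin n → Bool) : wt univ y = (hw y : ℤ) := by
  simp [wt, hw]

lemma hw_le {n : ℕ} (y : Fin n → Bool) : hw y ≤ n := by
  simpa [hw] using card_filter_le (univ : Finset (Fin n)) (fun i => y i = true)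

lemma card_hw_eq (n l : ℕ) :
    (univ.filter fun y : Fin n → Bool => hw y = l).card = n.choose l := by
  rw [← card_fin n, ← card_powersetCard, card_fin]
  refine card_nbij' (fun y => univ.filter fun i => y i = true) (fun s i => decide (i ∈ s))
    ?_ ?_ ?_ ?_
  · intro y hy
    have := (mem_filter.1 (mem_coe.1 hy)).2
    simpa [mem_powersetCard, hw] using this
  · intro s hs
    have := (mem_powersetCard.1 (mem_coe.1 hs)).2
    refine mem_coe.2 (mem_filter.2 ⟨mem_univ _, ?_⟩)
    simpa [hw] using this
  · intro y _
    funext i; simp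
  · intro s _
    ext i; simp

/-- The probability that a uniform string has weight `l`. -/
def hp (n l : ℕ) : ℝ := Ex (fun y : Fin n → Bool => if wt univ y = (l : ℤ) then (1 : ℝ) else 0)

lemma hp_eq (n l : ℕ) : hp n l = n.choose l / 2 ^ n := by
  rw [← card_hw_eq, card_div_eq_Ex]
  simp [hp, wt_univ_eq]

lemma hp_nonneg (n l : ℕ) : 0 ≤ hp n l := by rw [hp_eq]; positivity

lemma hp_succ (n l : ℕ) : hp n (l + 1) * (l + 1) = hp n l * ((n : ℝ) - l) := by
  rw [hp_eq, hp_eq, div_mul_eq_mul_div, div_mul_eq_mul_div]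
  congr 1
  have h := Nat.choose_succ_right_eq n l
  rcases le_or_gt l n with hl | hl
  · have : ((n.choose (l + 1) * (l + 1) : ℕ) : ℝ) = (n.choose l * (n - l) : ℕ) := by rw [h]
    push_cast [Nat.cast_sub hl] at this
    exact this
  · rw [Nat.choose_eq_zero_of_lt hl, Nat.choose_eq_zero_of_lt (by omega)]; simp

lemma hp_symm {n l : ℕ} (hl : l ≤ n) : hp n (n - l) = hp n l := by
  rw [hp_eq, hp_eq, Nat.choose_symm hl]

lemma hp_decay {n l : ℕ} (hn : 0 < n) (hl : n ≤ 2 * l) (hln : l ≤ n) (i : ℕ) :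
    hp n (l + i) ≤ (1 - (2 * l - n) / n) ^ i * hp n l := by
  have hn' : (0 : ℝ) < n := by exact_mod_cast hn
  have hl' : (n : ℝ) ≤ 2 * l := by exact_mod_cast hl
  have hln' : (l : ℝ) ≤ n := by exact_mod_cast hln
  set r : ℝ := 1 - (2 * l - n) / n with hr
  have hr' : r * n = 2 * (n - l) := by rw [hr]; field_simp; ring
  have hr0 : 0 ≤ r := by
    by_contra! h
    nlinarith
  induction i with
  | zero => simp
  | succ i ih =>
    have h1 := hp_succ n (l + i)
    push_cast at h1
    have h0 := hp_nonneg n (l + i)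
    have h3 := hp_nonneg n (l + i + 1)
    have h4 : (0 : ℝ) ≤ i := Nat.cast_nonneg i
    have h2 : hp n (l + i + 1) ≤ r * hp n (l + i) := by
      have h5 : hp n (l + i + 1) * n ≤ hp n (l + i + 1) * (2 * (l + i + 1)) :=
        mul_le_mul_of_nonneg_left (by linarith) h3
      have h6 : hp n (l + i) * (n - (l + i)) ≤ hp n (l + i) * (n - l) :=
        mul_le_mul_of_nonneg_left (by linarith) h0
      have h7 : hp n (l + i + 1) * n ≤ r * hp n (l + i) * n := by
        calc hp n (l + i + 1) * n ≤ 2 * (hp n (l + i + 1) * (l + i + 1)) := by linarith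
          _ ≤ 2 * (hp n (l + i) * (n - l)) := by rw [h1]; linarith
          _ = r * n * hp n (l + i) := by rw [hr']; ring
          _ = _ := by ring
      exact le_of_mul_le_mul_right h7 hn'
    calc hp n (l + (i + 1)) ≤ r * hp n (l + i) := h2
      _ ≤ r * (r ^ i * hp n l) := mul_le_mul_of_nonneg_left ih hr0
      _ = _ := by ring

lemma sum_geom_le {r : ℝ} (h0 : 0 ≤ r) (h1 : r < 1) (J : ℕ) :
    ∑ j ∈ Icc 1 J, r ^ (2 * j) ≤ 1 / (1 - r) := by
  rw [le_div_iff₀ (by linarith)]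
  have h2 : ∑ j ∈ Icc 1 J, r ^ (2 * j) ≤ ∑ j ∈ range (J + 1), r ^ j := by
    refine (sum_le_sum fun j _ => pow_le_pow_of_le_one h0 h1.le (by omega : j ≤ 2 * j)).trans ?_
    refine sum_le_sum_of_subset_of_nonneg (fun j hj => ?_) fun j _ _ => by positivity
    rw [mem_Icc] at hj
    exact mem_range.2 (by omega)
  have h3 := geom_sum_mul_neg r (J + 1)
  have h4 : 0 ≤ r ^ (J + 1) := by positivity
  nlinarith

lemma Yv_eq_wt {n : ℕ} (y : Fin n → Bool) : Yv y = ((n : ℝ) - 2 * (wt univ y : ℝ)) / √n := by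
  unfold Yv
  congr 1
  have : ∀ i, sg (y i) = 1 - 2 * (if y i = true then (1 : ℝ) else 0) := fun i => by
    cases y i <;> norm_num [sg]
  simp_rw [this]
  rw [sum_sub_distrib, ← mul_sum]
  simp [wt]

lemma hp_mid {n : ℕ} (hn : 0 < n) : 1 / (18 * √n) ≤ hp n (n / 2) := by
  have hn' : (1 : ℝ) ≤ n := by exact_mod_cast hn
  have hs : 1 ≤ √(n : ℝ) := Real.one_le_sqrt.2 hn'
  have hsq : √(n : ℝ) * √n = n := Real.mul_self_sqrt (by linarith)
  set k := 2 * Nat.sqrt n + 2 with hk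
  have hk1 : 2 * √(n : ℝ) ≤ k := by
    have h1 : (n : ℝ) ≤ ((Nat.sqrt n + 1 : ℕ) : ℝ) ^ 2 := by
      have := Nat.lt_succ_sqrt n
      rw [sq]; exact_mod_cast this.le
    have h2 : √(n : ℝ) ≤ ((Nat.sqrt n + 1 : ℕ) : ℝ) := Real.sqrt_le_iff.2 ⟨by positivity, h1⟩
    rw [hk]; push_cast at h2 ⊢; linarith
  have hk2 : (k : ℝ) ≤ 2 * √(n : ℝ) + 2 := by
    have h1 : ((Nat.sqrt n : ℕ) : ℝ) ≤ √(n : ℝ) := Real.nat_sqrt_le_real_sqrt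
    rw [hk]; push_cast; linarith
  have hfar : Ex (fun y : Fin n → Bool => if 4 ≤ |Yv y| then (1 : ℝ) else 0) ≤ 1 / 2 := by
    refine (Ex_ite_le_div (g := fun y : Fin n → Bool => Yv y ^ (2 * 1)) (t := 16) (by norm_num)
      (fun y => by rw [pow_mul]; positivity) fun y hy => ?_).trans ?_
    · rw [mul_one, ← sq_abs]; nlinarith
    · have h1 : Ex (fun y : Fin n → Bool => Yv y ^ (2 * 1)) ≤ momB 1 := mom_even_le_momB 1
      have h2 : Real.exp (1 / 2) ≤ 2 := by
        have h3 : Real.exp (1 / 2) ^ 2 ≤ 2 ^ 2 := by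
          rw [← Real.exp_nat_mul]; norm_num
          linarith [Real.exp_one_lt_d9]
        exact le_of_sq_le_sq h3 (by norm_num)
      have h3 : momB 1 ≤ 8 := by
        simp only [momB]; norm_num at h2 ⊢; linarith
      linarith
  have hnear : (1 : ℝ) ≤ Ex (fun y : Fin n → Bool => if 4 ≤ |Yv y| then (1 : ℝ) else 0)
      + ∑ l ∈ Icc (n / 2 - k) (n / 2 + k), hp n l := by
    unfold hp
    rw [← Ex_sum, ← Ex_add]
    apply const_le_Ex
    intro y
    have hnn : ∀ l ∈ Icc (n / 2 - k) (n / 2 + k),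
        (0 : ℝ) ≤ if wt univ y = (l : ℤ) then (1 : ℝ) else 0 := fun l _ => by
      split_ifs <;> norm_num
    by_cases hy : 4 ≤ |Yv y|
    · rw [if_pos hy]
      linarith [sum_nonneg hnn]
    · rw [if_neg hy, zero_add]
      push Not at hy
      rw [Yv_eq_wt, abs_div, abs_of_nonneg (Real.sqrt_nonneg _), div_lt_iff₀ (by linarith),
        wt_univ_eq, abs_lt] at hy
      have h1 : (n : ℝ) < 2 * hw y + 2 * k := by push_cast at hy; linarith [hy.2]
      have h2 : (2 : ℝ) * hw y < n + 2 * k := by push_cast at hy; linarith [hy.1]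
      have h1' : n < 2 * hw y + 2 * k := by exact_mod_cast h1
      have h2' : 2 * hw y < n + 2 * k := by exact_mod_cast h2
      have hm : hw y ∈ Icc (n / 2 - k) (n / 2 + k) := mem_Icc.2 ⟨by omega, by omega⟩
      refine le_trans ?_ (single_le_sum hnn hm)
      rw [if_pos (wt_univ_eq y)]
  have hle : ∑ l ∈ Icc (n / 2 - k) (n / 2 + k), hp n l ≤ (2 * k + 1) * hp n (n / 2) := by
    have h1 : ∀ l ∈ Icc (n / 2 - k) (n / 2 + k), hp n l ≤ hp n (n / 2) := fun l _ => by
      rw [hp_eq, hp_eq]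
      gcongr
      exact Nat.choose_le_middle l n
    refine (sum_le_card_nsmul _ _ _ h1).trans ?_
    rw [nsmul_eq_mul, Nat.card_Icc]
    refine mul_le_mul_of_nonneg_right ?_ (hp_nonneg _ _)
    have : n / 2 + k + 1 - (n / 2 - k) ≤ 2 * k + 1 := by omega
    exact_mod_cast this
  rw [div_le_iff₀ (by linarith)]
  have h0 := hp_nonneg n (n / 2)
  have : (2 * k + 1 : ℝ) * hp n (n / 2) ≤ 9 * √n * hp n (n / 2) :=
    mul_le_mul_of_nonneg_right (by linarith) h0
  nlinarith

/-- Local lower bound for binomial weights. -/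
lemma hp_ge {n l : ℕ} (hn : 0 < n) (hl : n ≤ 2 * l) (hx : (2 * l - n + 1 : ℝ) ≤ n / 4) :
    1 / (18 * √n) * Real.exp (-(2 * (2 * l - n + 1 : ℝ) ^ 2 / n)) ≤ hp n l := by
  have hn' : (0 : ℝ) < n := by exact_mod_cast hn
  have hl' : (n : ℝ) ≤ 2 * l := by exact_mod_cast hl
  set x : ℝ := 2 * l - n + 1 with hxd
  set u : ℝ := 2 * x / n with hu
  have hx0 : 0 ≤ x := by linarith
  have hu0 : 0 ≤ u := by positivity
  have hu1 : u ≤ 1 / 2 := by rw [hu, div_le_iff₀ hn']; linarith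
  have hexp : Real.exp (-(2 * u)) ≤ 1 - u := by
    have h1 := Real.add_one_le_exp (2 * u)
    rw [Real.exp_neg, inv_le_iff_one_le_mul₀ (Real.exp_pos _)]
    nlinarith [Real.exp_pos (2 * u)]
  have hun : u * n = 2 * x := by rw [hu]; field_simp
  have key : ∀ i, n / 2 + i ≤ l → Real.exp (-(2 * u)) ^ i * hp n (n / 2) ≤ hp n (n / 2 + i) := by
    intro i
    induction i with
    | zero => intro _; simp
    | succ i ih =>
      intro hi
      have ih := ih (by omega)
      have h1 := hp_succ n (n / 2 + i)
      set p := n / 2 + i with hp'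
      have hpl : (p : ℝ) + 1 ≤ l := by exact_mod_cast hi
      have hpn : (n : ℝ) ≤ 2 * (p + 1) := by
        have : n ≤ 2 * (p + 1) := by omega
        exact_mod_cast this
      have h0 := hp_nonneg n p
      have h2 : Real.exp (-(2 * u)) * hp n p ≤ hp n (p + 1) := by
        refine (mul_le_mul_of_nonneg_right hexp h0).trans ?_
        have h3 : (1 - u) * (p + 1) ≤ n - p := by
          have h4 : u * (n / 2) ≤ u * (p + 1) := mul_le_mul_of_nonneg_left (by linarith) hu0
          nlinarith
        have h5 : (1 - u) * hp n p * (p + 1) ≤ hp n (p + 1) * (p + 1) := by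
          rw [h1]
          have := mul_le_mul_of_nonneg_left h3 h0
          linarith
        exact le_of_mul_le_mul_right h5 (by positivity)
      calc Real.exp (-(2 * u)) ^ (i + 1) * hp n (n / 2)
          = Real.exp (-(2 * u)) * (Real.exp (-(2 * u)) ^ i * hp n (n / 2)) := by ring
        _ ≤ Real.exp (-(2 * u)) * hp n p := mul_le_mul_of_nonneg_left ih (Real.exp_pos _).le
        _ ≤ _ := h2
  have h1 := key (l - n / 2) (by omega)
  rw [show n / 2 + (l - n / 2) = l by omega] at h1
  refine le_trans ?_ h1
  rw [mul_comm]
  refine mul_le_mul ?_ (hp_mid hn) (by positivity) (by positivity)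
  rw [← Real.exp_nat_mul]
  apply Real.exp_le_exp.2
  have h2 : ((l - n / 2 : ℕ) : ℝ) ≤ x / 2 := by
    rw [Nat.cast_sub (by omega), hxd]
    have : n ≤ 2 * (n / 2) + 1 := by omega
    have : (n : ℝ) ≤ 2 * ((n / 2 : ℕ) : ℝ) + 1 := by exact_mod_cast this
    linarith
  have h3 := mul_le_mul_of_nonneg_right h2 (show 0 ≤ 2 * u by positivity)
  have h4 : x / 2 * (2 * u) = 2 * x ^ 2 / n := by rw [hu]; field_simp
  linarith

/-- Near-central binomial weights are not exponentially small. -/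
lemma exists_central_bound {c : ℝ} (hc : 0 < c) : ∃ c' > 0, ∃ N : ℕ, ∀ n, N ≤ n → ∀ s ≤ n,
    |(s : ℝ) - n / 2| ≤ c' * n → Real.exp (-c * n) ≤ hp n s := by
  refine ⟨min (1 / 16) (c / 3), by positivity, ⌈(36 / c) ^ 2 + 3 / c + 64⌉₊, fun n hn s hs hsn => ?_⟩
  set c' := min (1 / 16) (c / 3) with hc'
  have hc0 : 0 < c' := by positivity
  have hc1 : c' ≤ 1 / 16 := min_le_left _ _
  have hc2 : c' ≤ c / 3 := min_le_right _ _
  have hN : (36 / c) ^ 2 + 3 / c + 64 ≤ n := (Nat.le_ceil _).trans (by exact_mod_cast hn)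
  have ha : 0 ≤ (36 / c) ^ 2 := by positivity
  have hb : 0 < 3 / c := by positivity
  have hn64 : (64 : ℝ) ≤ n := by linarith
  have hn' : (0 : ℝ) < n := by linarith
  have hn0 : 0 < n := by exact_mod_cast hn'
  have hcn : 1 ≤ c' * n := by
    rcases min_choice (1 / 16) (c / 3) with h | h
    · rw [hc', h]; linarith
    · rw [hc', h]
      have : 3 / c ≤ n := by linarith
      rw [div_le_iff₀ hc] at this
      linarith
  wlog hs2 : n ≤ 2 * s generalizing s
  · rw [← hp_symm hs]
    refine this (n - s) (Nat.sub_le _ _) ?_ (by omega)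
    rw [Nat.cast_sub hs, abs_sub_comm, show (n / 2 - (n - s) : ℝ) = s - n / 2 by ring]
    exact hsn
  have hs2' : (n : ℝ) ≤ 2 * s := by exact_mod_cast hs2
  have h1 := (abs_le.1 hsn).2
  have hx : (2 * s - n + 1 : ℝ) ≤ 3 * (c' * n) := by linarith
  have hcn' : c' * n ≤ 1 / 16 * n := mul_le_mul_of_nonneg_right hc1 hn'.le
  refine le_trans ?_ (hp_ge hn0 hs2 (by linarith))
  have hs0 : 0 < √(n : ℝ) := Real.sqrt_pos.2 hn'
  have hsq : √(n : ℝ) * √n = n := Real.mul_self_sqrt hn'.le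
  have hs36 : 36 / c ≤ √(n : ℝ) := Real.le_sqrt_of_sq_le (by linarith)
  have h18 : 18 * √(n : ℝ) ≤ Real.exp (c * n / 2) := by
    rw [div_le_iff₀ hc] at hs36
    have h2 := mul_le_mul_of_nonneg_right hs36 hs0.le
    have h3 := Real.add_one_le_exp (c * n / 2)
    have h4 : √(n : ℝ) * c * √n = c * n := by rw [mul_right_comm, hsq, mul_comm]
    linarith
  have hq : 2 * (2 * s - n + 1 : ℝ) ^ 2 / n ≤ c * n / 2 := by
    rw [div_le_iff₀ hn']
    have h2 : (2 * s - n + 1 : ℝ) ^ 2 ≤ (3 * (c' * n)) ^ 2 :=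
      pow_le_pow_left₀ (by linarith) hx 2
    have h3 : c' * c' ≤ 1 / 16 * (c / 3) := mul_le_mul hc1 hc2 hc0.le (by norm_num)
    have h4 := mul_le_mul_of_nonneg_right h3 (show (0 : ℝ) ≤ n ^ 2 by positivity)
    nlinarith
  calc Real.exp (-c * n) = Real.exp (-(c * n / 2)) * Real.exp (-(c * n / 2)) := by
        rw [← Real.exp_add]; congr 1; ring
    _ ≤ 1 / (18 * √n) * Real.exp (-(2 * (2 * s - n + 1 : ℝ) ^ 2 / n)) := by
        refine mul_le_mul ?_ (Real.exp_le_exp.2 (by linarith)) (Real.exp_pos _).le (by positivity)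
        rw [Real.exp_neg, ← one_div]
        exact one_div_le_one_div_of_le (by positivity) h18

/-- On average, inward shifts of the upper half of a small union of slices leave it. -/
lemma exists_shift_small {t : ℝ} (ht : 0 < t) : ∃ α > 0, ∃ N : ℕ, ∀ n, N ≤ n →
    ∃ J : ℕ, 0 < J ∧ J ≤ t * √n ∧ ∀ A : Finset ℤ,
      Ex (fun y : Fin n → Bool => if wt univ y ∈ A then (1 : ℝ) else 0) ≤ α →
      ∑ j ∈ Icc 1 J, Ex (fun y : Fin n → Bool => (if wt univ y ∈ A then (1 : ℝ) else 0) *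
        (if (n : ℤ) ≤ 2 * (wt univ y - 2 * j) ∧ wt univ y - 2 * j ∈ A then 1 else 0))
        ≤ J * (Ex (fun y : Fin n → Bool => if wt univ y ∈ A then (1 : ℝ) else 0) / 10) := by
  set K : ℝ := 20 / t with hK
  have hK0 : 0 < K := by positivity
  refine ⟨t / 20 * (1 / 18 * Real.exp (-(2 * (K + 1) ^ 2))), by positivity,
    ⌈(2 / t) ^ 2 + 16 * (K + 1) ^ 2⌉₊, fun n hn => ⟨⌊t * √n⌋₊, ?_⟩⟩
  have hN : (2 / t) ^ 2 + 16 * (K + 1) ^ 2 ≤ n := (Nat.le_ceil _).trans (by exact_mod_cast hn)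
  have ha : 0 ≤ (2 / t) ^ 2 := by positivity
  have hK1 : (1 : ℝ) ≤ (K + 1) ^ 2 := by nlinarith
  have hn1 : (1 : ℝ) ≤ n := by nlinarith
  have hn' : (0 : ℝ) < n := by linarith
  have hn0 : 0 < n := by exact_mod_cast hn'
  have hs1 : 1 ≤ √(n : ℝ) := Real.one_le_sqrt.2 hn1
  have hsq : √(n : ℝ) * √n = n := Real.mul_self_sqrt hn'.le
  have hst : 2 / t ≤ √(n : ℝ) := Real.le_sqrt_of_sq_le (by nlinarith)
  have hsK : 4 * (K + 1) ≤ √(n : ℝ) := Real.le_sqrt_of_sq_le (by nlinarith)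
  have hts : 2 ≤ t * √n := by rw [div_le_iff₀ ht] at hst; linarith
  set J := ⌊t * √n⌋₊ with hJ
  have hJ1 : (J : ℝ) ≤ t * √n := Nat.floor_le (by positivity)
  have hJ2 : t * √n / 2 ≤ J := by
    have := Nat.lt_floor_add_one (t * √n)
    rw [← hJ] at this
    linarith
  have hJ0' : (0 : ℝ) < J := by linarith
  refine ⟨by exact_mod_cast hJ0', hJ1, fun A hA => ?_⟩
  set a : ℝ := Ex (fun y : Fin n → Bool => if wt univ y ∈ A then (1 : ℝ) else 0) with ha'
  have ha0 : 0 ≤ a := Ex_nonneg fun y => by split_ifs <;> norm_num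
  -- contribution of a single slice
  have slice : ∀ l : ℕ, l ≤ n → n ≤ 2 * l →
      ∑ j ∈ Icc 1 J, Ex (fun y : Fin n → Bool => (if wt univ y ∈ A then (1 : ℝ) else 0) *
        (if wt univ y = (l : ℤ) + 2 * j then 1 else 0)) ≤ J * hp n l / 10 := by
    intro l hl hl2
    have hl2' : (n : ℝ) ≤ 2 * l := by exact_mod_cast hl2
    have hln' : (l : ℝ) ≤ n := by exact_mod_cast hl
    have hp0 := hp_nonneg n l
    by_cases hbig : a ≤ J * hp n l / 10
    · refine le_trans ?_ hbig
      rw [← Ex_sum]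
      apply Ex_mono
      intro y
      rw [← mul_sum]
      refine mul_le_of_le_one_right (by split_ifs <;> norm_num) ?_
      rw [sum_ite, sum_const_zero, add_zero, sum_const, nsmul_eq_mul, mul_one]
      have : ((Icc 1 J).filter fun j : ℕ => wt univ y = (l : ℤ) + 2 * j).card ≤ 1 := by
        refine card_le_one.2 fun p hp q hq => ?_
        have h1 := (mem_filter.1 hp).2
        have h2 := (mem_filter.1 hq).2
        omega
      exact_mod_cast this
    push Not at hbig
    have hx : K * √n < 2 * l - n := by
      by_contra! hx
      have h1 : (2 * l - n + 1 : ℝ) ≤ (K + 1) * √n := by nlinarith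
      have h2 : (K + 1) * √n ≤ n / 4 := by nlinarith
      have h3 := hp_ge hn0 hl2 (h1.trans h2)
      have h4 : 2 * (2 * l - n + 1 : ℝ) ^ 2 / n ≤ 2 * (K + 1) ^ 2 := by
        rw [div_le_iff₀ hn']
        have := pow_le_pow_left₀ (by linarith) h1 2
        rw [mul_pow, sq (√(n : ℝ)), hsq] at this
        linarith
      have h5 : 1 / (18 * √n) * Real.exp (-(2 * (K + 1) ^ 2)) ≤ hp n l :=
        le_trans (mul_le_mul_of_nonneg_left (Real.exp_le_exp.2 (by linarith)) (by positivity)) h3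
      have h6 : t * √n / 2 * (1 / (18 * √n) * Real.exp (-(2 * (K + 1) ^ 2))) ≤ J * hp n l :=
        mul_le_mul hJ2 h5 (by positivity) hJ0'.le
      have h7 : t * √n / 2 * (1 / (18 * √n) * Real.exp (-(2 * (K + 1) ^ 2)))
          = 10 * (t / 20 * (1 / 18 * Real.exp (-(2 * (K + 1) ^ 2)))) := by
        have : √(n : ℝ) ≠ 0 := by positivity
        field_simp; ring
      linarith
    set r : ℝ := 1 - (2 * l - n) / n with hr
    have hr0 : 0 ≤ r := by
      rw [hr, sub_nonneg, div_le_one hn']; linarith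
    have hxp : (0 : ℝ) < 2 * l - n := lt_of_le_of_lt (by positivity) hx
    have hr1 : r < 1 := by rw [hr]; linarith [div_pos hxp hn']
    calc ∑ j ∈ Icc 1 J, Ex (fun y : Fin n → Bool => (if wt univ y ∈ A then (1 : ℝ) else 0) *
          (if wt univ y = (l : ℤ) + 2 * j then 1 else 0))
        ≤ ∑ j ∈ Icc 1 J, r ^ (2 * j) * hp n l := by
          refine sum_le_sum fun j _ => le_trans ?_ (hp_decay hn0 hl2 hl (2 * j))
          apply Ex_mono
          intro y
          push_cast
          split_ifs <;> norm_num
      _ = (∑ j ∈ Icc 1 J, r ^ (2 * j)) * hp n l := by rw [sum_mul]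
      _ ≤ 1 / (1 - r) * hp n l := mul_le_mul_of_nonneg_right (sum_geom_le hr0 hr1 J) hp0
      _ ≤ J / 10 * hp n l := by
          refine mul_le_mul_of_nonneg_right ?_ hp0
          rw [hr, sub_sub_cancel, one_div_div, div_le_iff₀ hxp]
          have h1 : n ≤ t * √n / 20 * (K * √n) := by
            rw [hK, show t * √(n : ℝ) / 20 * (20 / t * √n) = √n * √n by field_simp, hsq]
          have h2 : t * √n / 20 * (K * √n) ≤ J / 10 * (2 * l - n) :=
            mul_le_mul (by linarith) hx.le (by positivity) (by positivity)
          linarith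
      _ = _ := by ring
  set L := (range (n + 1)).filter fun l : ℕ => n ≤ 2 * l ∧ (l : ℤ) ∈ A with hL
  have hsumL : ∑ l ∈ L, hp n l ≤ a := by
    unfold hp
    rw [← Ex_sum]
    apply Ex_mono
    intro y
    by_cases hy : wt univ y ∈ A
    · rw [if_pos hy, sum_ite, sum_const_zero, add_zero, sum_const, nsmul_eq_mul, mul_one]
      have : (L.filter fun l : ℕ => wt univ y = (l : ℤ)).card ≤ 1 := by
        refine card_le_one.2 fun p hp q hq => ?_
        have h1 := (mem_filter.1 hp).2
        have h2 := (mem_filter.1 hq).2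
        omega
      exact_mod_cast this
    · rw [if_neg hy]
      refine (sum_eq_zero fun l hl => if_neg ?_).le
      rintro h
      rw [h] at hy
      exact hy (mem_filter.1 hl).2.2
  calc ∑ j ∈ Icc 1 J, Ex (fun y : Fin n → Bool => (if wt univ y ∈ A then (1 : ℝ) else 0) *
        (if (n : ℤ) ≤ 2 * (wt univ y - 2 * j) ∧ wt univ y - 2 * j ∈ A then 1 else 0))
      ≤ ∑ j ∈ Icc 1 J, ∑ l ∈ L, Ex (fun y : Fin n → Bool =>
          (if wt univ y ∈ A then (1 : ℝ) else 0) *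
          (if wt univ y = (l : ℤ) + 2 * j then 1 else 0)) := by
        refine sum_le_sum fun j _ => ?_
        rw [← Ex_sum]
        apply Ex_mono
        intro y
        rw [← mul_sum]
        refine mul_le_mul_of_nonneg_left ?_ (by split_ifs <;> norm_num)
        have hnn : ∀ l ∈ L, (0 : ℝ) ≤ if wt univ y = (l : ℤ) + 2 * j then (1 : ℝ) else 0 :=
          fun l _ => by split_ifs <;> norm_num
        split_ifs with h
        · have h2 := hw_le y
          rw [wt_univ_eq] at h ⊢
          have hm : hw y - 2 * j ∈ L := by
            refine mem_filter.2 ⟨mem_range.2 (by omega), by omega, ?_⟩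
            convert h.2 using 1
            omega
          rw [wt_univ_eq] at hnn
          refine le_trans ?_ (single_le_sum hnn hm)
          rw [if_pos (by omega)]
        · exact sum_nonneg hnn
    _ = ∑ l ∈ L, ∑ j ∈ Icc 1 J, Ex (fun y : Fin n → Bool =>
          (if wt univ y ∈ A then (1 : ℝ) else 0) *
          (if wt univ y = (l : ℤ) + 2 * j then 1 else 0)) := sum_comm
    _ ≤ ∑ l ∈ L, J * hp n l / 10 := by
        refine sum_le_sum fun l hl => slice l ?_ (mem_filter.1 hl).2.1
        have := mem_range.1 (mem_filter.1 hl).1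
        omega
    _ = J * ((∑ l ∈ L, hp n l) / 10) := by
        rw [← sum_div, ← mul_sum]; ring
    _ ≤ J * (a / 10) := by gcongr

/-- Negation of all bits. -/
def negAll (n : ℕ) : (Fin n → Bool) ≃ (Fin n → Bool) := Equiv.piCongrRight fun _ => Equiv.boolNot

lemma wt_negAll {n : ℕ} (y : Fin n → Bool) : wt univ (negAll n y) = n - wt univ y := by
  have h : wt univ (negAll n y) + wt univ y = n := by
    unfold wt
    rw [← sum_add_distrib]
    have : ∀ i, ((if negAll n y i = true then (1 : ℤ) else 0) + if y i = true then 1 else 0) = 1 :=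
      fun i => by
        have : negAll n y i = !(y i) := rfl
        rw [this]; cases y i <;> simp
    simp [this]
  omega

lemma sum_unifOn_mul {n : ℕ} (C : Finset (Fin n → Bool)) (τ : (Fin n → Bool) → ℝ) :
    ∑ y, unifOn C y * τ y
      = Ex (fun y => (if y ∈ C then (1 : ℝ) else 0) * τ y)
        / Ex (fun y => if y ∈ C then (1 : ℝ) else 0) := by
  have h2 : (2 : ℝ) ^ n ≠ 0 := by positivity
  rw [← card_div_eq_Ex]
  unfold Ex unifOn
  rw [Fintype.card_fun, Fintype.card_bool, Fintype.card_fin]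
  push_cast
  rw [div_div_div_cancel_right₀ h2, sum_div]
  refine sum_congr rfl fun y _ => ?_
  split_ifs
  · rw [one_mul, inv_mul_eq_div]
  · simp

/-- The strings whose weight lies in `Ψ`. -/
def slices (n : ℕ) (Ψ : Finset ℕ) : Finset (Fin n → Bool) := univ.filter fun y => hw y ∈ Ψ

lemma card_slices_ge {c : ℝ} (hc : 0 < c) : ∃ c' > 0, ∃ N : ℕ, ∀ n, N ≤ n → ∀ Ψ ⊆ range (n + 1),
    (∃ s ∈ Ψ, |(s : ℝ) - n / 2| ≤ c' * n) → Real.exp (-c * n) * 2 ^ n ≤ (slices n Ψ).card := by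
  obtain ⟨c', hc', N, H⟩ := exists_central_bound hc
  refine ⟨c', hc', N, fun n hn Ψ hΨ ⟨s, hs, hsn⟩ => ?_⟩
  have h1 := H n hn s (by have := mem_range.1 (hΨ hs); omega) hsn
  rw [hp_eq, le_div_iff₀ (by positivity)] at h1
  refine h1.trans ?_
  rw [← card_hw_eq]
  have : (univ.filter fun y : Fin n → Bool => hw y = s) ⊆ slices n Ψ := fun y hy => by
    rw [mem_filter] at hy
    exact mem_filter.2 ⟨mem_univ _, hy.2 ▸ hs⟩
  exact_mod_cast card_le_card this

lemma far_of_shift {n j : ℕ} {C : Finset (Fin n → Bool)} {ι : Type}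
    [Fintype ι] [DecidableEq ι] {f : (ι → Bool) → (Fin n → Bool)} {η ε : ℝ} {φ : ℤ → ℝ}
    (hφ : ∀ k, |φ k| ≤ 1)
    (h : |Ex (fun x => φ (wt univ (f x))) - Ex (fun x => φ (wt univ (f x) + 2 * j))| ≤ η)
    (hfar : ε ≤ |∑ y, unifOn C y * φ (wt univ y) - ∑ y, unifOn C y * φ (wt univ y + 2 * j)|) :
    ε ≤ η + 4 * tvd (law f) (unifOn C) := by
  have h1 := abs_sum_sub_mul_le (law f) (unifOn C) (τ := fun y => φ (wt univ y)) fun y => hφ _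
  have h2 := abs_sum_sub_mul_le (law f) (unifOn C) (τ := fun y => φ (wt univ y + 2 * j))
    fun y => hφ _
  rw [sum_law_mul f (fun y => φ (wt univ y))] at h1
  rw [sum_law_mul f (fun y => φ (wt univ y + 2 * j))] at h2
  rw [abs_le] at h h1 h2
  rcases abs_cases (∑ y, unifOn C y * φ (wt univ y) - ∑ y, unifOn C y * φ (wt univ y + 2 * j))
    with ⟨h3, _⟩ | ⟨h3, _⟩ <;> rw [h3] at hfar <;> linarith

/-- A local function is far from uniform on a small union of slices. -/
theorem small_slices (d : ℕ) : ∃ α > 0, ∃ c > 0, ∃ N : ℕ, ∀ n, N ≤ n → ∀ (ι : Type) [Fintype ι]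
    [DecidableEq ι] (f : (ι → Bool) → (Fin n → Bool)), Loc d f → ∀ Ψ ⊆ range (n + 1),
    (∃ s ∈ Ψ, |(s : ℝ) - n / 2| ≤ c * n) → ((slices n Ψ).card : ℝ) / 2 ^ n ≤ α →
    1 / 40 ≤ tvd (law f) (unifOn (slices n Ψ)) := by
  obtain ⟨c, hc, B, hB, HB⟩ := micro_smooth d
  obtain ⟨c', hc', N1, H1⟩ := card_slices_ge hc
  obtain ⟨N2, H2⟩ := HB (1 / 10) (by norm_num)
  obtain ⟨α, hα, N3, H3⟩ := exists_shift_small (t := 1 / (10 * (B + 1))) (by positivity)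
  refine ⟨α, hα, c', hc', N1 + N2 + N3 + 1, fun n hn ι _ _ f hf Ψ hΨ hs hcard => ?_⟩
  have hn0 : 0 < n := by omega
  have hn' : (0 : ℝ) < n := by exact_mod_cast hn0
  have hsn : 0 < √(n : ℝ) := Real.sqrt_pos.2 hn'
  have hC := H1 n (by omega) Ψ hΨ hs
  obtain ⟨J, hJ0, hJ, HJ⟩ := H3 n (by omega)
  have hmic := H2 n (by omega) ι f hf _ hC
  set C := slices n Ψ with hCdef
  have hCp' : (0 : ℝ) < C.card := lt_of_lt_of_le (by positivity) hC
  have hCp : 0 < C.card := by exact_mod_cast hCp'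
  have hjB : ∀ j ∈ Icc 1 J, (j : ℝ) * (B / √n) ≤ 1 / 10 := by
    intro j hj
    have h1 : (j : ℝ) ≤ J := by exact_mod_cast (mem_Icc.1 hj).2
    have h2 : (j : ℝ) ≤ 1 / (10 * (B + 1)) * √n := h1.trans hJ
    rw [← mul_div_assoc, div_le_iff₀ hsn]
    refine (mul_le_mul_of_nonneg_right h2 hB).trans ?_
    rw [div_mul_eq_mul_div, div_mul_eq_mul_div, div_le_iff₀ (by positivity)]
    nlinarith
  set A : Finset ℤ := Ψ.image (fun k : ℕ => (k : ℤ)) with hA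
  have hmem : ∀ y : Fin n → Bool, wt univ y ∈ A ↔ y ∈ C := fun y => by
    rw [wt_univ_eq, hA, mem_image, hCdef, slices, mem_filter]
    constructor
    · rintro ⟨k, hk, h⟩
      have : k = hw y := by exact_mod_cast h
      exact ⟨mem_univ _, this ▸ hk⟩
    · rintro ⟨_, h⟩
      exact ⟨_, h, rfl⟩
  set a : ℝ := Ex (fun y : Fin n → Bool => if wt univ y ∈ A then (1 : ℝ) else 0) with ha
  have hav : a = C.card / 2 ^ n := by
    rw [card_div_eq_Ex, ha]; simp_rw [hmem]
  have ha0 : 0 < a := by rw [hav]; positivity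
  have hED : ∀ τ : (Fin n → Bool) → ℝ, ∑ y, unifOn C y * τ y
      = Ex (fun y => (if wt univ y ∈ A then (1 : ℝ) else 0) * τ y) / a := fun τ => by
    rw [sum_unifOn_mul, ha]; simp_rw [hmem]
  -- choice of a half
  have hhalf : a / 2 ≤ Ex (fun y : Fin n → Bool => (if wt univ y ∈ A then (1 : ℝ) else 0) *
        (if (n : ℤ) ≤ 2 * wt univ y then 1 else 0)) ∨
      a / 2 ≤ Ex (fun y : Fin n → Bool => (if wt univ y ∈ A then (1 : ℝ) else 0) *
        (if 2 * wt univ y ≤ (n : ℤ) then 1 else 0)) := by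
    by_contra! h
    have h1 : a ≤ Ex (fun y : Fin n → Bool => (if wt univ y ∈ A then (1 : ℝ) else 0) *
        (if (n : ℤ) ≤ 2 * wt univ y then 1 else 0)) +
        Ex (fun y : Fin n → Bool => (if wt univ y ∈ A then (1 : ℝ) else 0) *
        (if 2 * wt univ y ≤ (n : ℤ) then 1 else 0)) := by
      rw [← Ex_add]
      apply Ex_mono
      intro y
      rcases le_total (n : ℤ) (2 * wt univ y) with h | h <;> rw [if_pos h] <;>
        split_ifs <;> norm_num
    linarith [h.1, h.2]
  have concl : ∀ (j : ℕ) (φ : ℤ → ℝ), j ∈ Icc 1 J → (∀ k, |φ k| ≤ 1) →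
      2 / 5 ≤ |∑ y, unifOn C y * φ (wt univ y) - ∑ y, unifOn C y * φ (wt univ y + 2 * j)| →
      1 / 40 ≤ tvd (law f) (unifOn C) := by
    intro j φ hj hφ h
    have h1 := far_of_shift hφ (hmic j φ hφ) h
    linarith [hjB j hj]
  have hJne : (Icc 1 J).Nonempty := ⟨1, mem_Icc.2 ⟨le_rfl, hJ0⟩⟩
  rcases hhalf with hh | hh
  · have h1 := HJ A (by rw [← ha, hav]; exact hcard)
    obtain ⟨j, hj, hj'⟩ := exists_le_of_sum_le hJne (h1.trans_eq
      (show _ = ∑ _j ∈ Icc 1 J, a / 10 by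
        rw [sum_const, nsmul_eq_mul, Nat.card_Icc]; simp [ha]))
    refine concl j (fun k => if (n : ℤ) ≤ 2 * (k - 2 * j) ∧ k - 2 * j ∈ A then 1 else 0) hj
      (fun k => by split_ifs <;> simp) ?_
    rw [hED (fun y => if (n : ℤ) ≤ 2 * (wt univ y - 2 * j) ∧ wt univ y - 2 * j ∈ A then 1 else 0),
      hED (fun y => if (n : ℤ) ≤ 2 * (wt univ y + 2 * j - 2 * j) ∧ wt univ y + 2 * j - 2 * j ∈ A
        then 1 else 0), abs_sub_comm]
    refine le_trans ?_ (le_abs_self _)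
    rw [← sub_div, le_div_iff₀ ha0]
    have h2 : Ex (fun y : Fin n → Bool => (if wt univ y ∈ A then (1 : ℝ) else 0) *
        (if (n : ℤ) ≤ 2 * (wt univ y + 2 * j - 2 * j) ∧ wt univ y + 2 * j - 2 * j ∈ A
        then 1 else 0)) = Ex (fun y : Fin n → Bool => (if wt univ y ∈ A then (1 : ℝ) else 0) *
        (if (n : ℤ) ≤ 2 * wt univ y then 1 else 0)) := by
      congr 1; funext y
      rw [add_sub_cancel_right]
      by_cases hy : wt univ y ∈ A <;> simp [hy]
    rw [h2]
    linarith
  · set A' : Finset ℤ := A.image (fun k => (n : ℤ) - k) with hA'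
    have hmem' : ∀ k : ℤ, (n : ℤ) - k ∈ A' ↔ k ∈ A := fun k => by
      rw [hA', mem_image]
      constructor
      · rintro ⟨k', hk', h⟩
        rwa [show k = k' by omega]
      · exact fun h => ⟨k, h, rfl⟩
    have haA' : Ex (fun y : Fin n → Bool => if wt univ y ∈ A' then (1 : ℝ) else 0) = a := by
      rw [← Ex_equiv (negAll n)]
      simp_rw [wt_negAll, hmem']
      rfl
    have h1 := HJ A' (by rw [haA', hav]; exact hcard)
    rw [haA'] at h1
    obtain ⟨j, hj, hj'⟩ := exists_le_of_sum_le hJne (h1.trans_eq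
      (show _ = ∑ _j ∈ Icc 1 J, a / 10 by
        rw [sum_const, nsmul_eq_mul, Nat.card_Icc]; simp))
    rw [← Ex_equiv (negAll n)] at hj'
    have h2 : Ex (fun y : Fin n → Bool => (if wt univ y ∈ A then (1 : ℝ) else 0) *
        (if 2 * (wt univ y + 2 * j) ≤ (n : ℤ) ∧ wt univ y + 2 * j ∈ A then 1 else 0)) ≤ a / 10 := by
      refine le_trans (le_of_eq ?_) hj'
      congr 1; funext y
      rw [wt_negAll]
      have h3 : (n : ℤ) - wt univ y - 2 * j = n - (wt univ y + 2 * j) := by ring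
      rw [h3]
      simp_rw [hmem']
      have h4 : (n : ℤ) ≤ 2 * (n - (wt univ y + 2 * j)) ↔ 2 * (wt univ y + 2 * j) ≤ (n : ℤ) := by
        omega
      simp_rw [h4]
    refine concl j (fun k => if 2 * k ≤ (n : ℤ) ∧ k ∈ A then 1 else 0) hj
      (fun k => by split_ifs <;> simp) ?_
    rw [hED (fun y => if 2 * wt univ y ≤ (n : ℤ) ∧ wt univ y ∈ A then 1 else 0),
      hED (fun y => if 2 * (wt univ y + 2 * j) ≤ (n : ℤ) ∧ wt univ y + 2 * j ∈ A then 1 else 0)]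
    refine le_trans ?_ (le_abs_self _)
    rw [← sub_div, le_div_iff₀ ha0]
    have h5 : Ex (fun y : Fin n → Bool => (if wt univ y ∈ A then (1 : ℝ) else 0) *
        (if 2 * wt univ y ≤ (n : ℤ) ∧ wt univ y ∈ A then 1 else 0))
        = Ex (fun y : Fin n → Bool => (if wt univ y ∈ A then (1 : ℝ) else 0) *
        (if 2 * wt univ y ≤ (n : ℤ) then 1 else 0)) := by
      congr 1; funext y
      by_cases hy : wt univ y ∈ A <;> simp [hy]
    rw [h5]
    linarith

/-! ### From moments to Lipschitz test functions -/

section WeakApproximation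

/-- Taylor expansion of a shifted cosine. -/
lemma abs_cos_sub_taylor_le (K : ℕ) : ∀ φ x : ℝ,
    |Real.cos (x + φ) - ∑ k ∈ range K, Real.cos (φ + k * (Real.pi / 2)) * (x ^ k / k.factorial)|
      ≤ |x| ^ K / K.factorial := by
  induction K with
  | zero => intro φ x; simpa using Real.abs_cos_le_one _
  | succ K ih =>
    intro φ x
    have hkey : ∀ s : ℝ, |s| = 1 → ∀ t : ℝ, 0 ≤ t →
        |Real.cos (s * t + φ) - ∑ k ∈ range (K + 1),
          Real.cos (φ + k * (Real.pi / 2)) * ((s * t) ^ k / k.factorial)|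
          ≤ t ^ (K + 1) / (K + 1).factorial := by
      intro s hs t ht
      set g : ℝ → ℝ := fun x => Real.cos (x + φ) - ∑ k ∈ range (K + 1),
          Real.cos (φ + k * (Real.pi / 2)) * (x ^ k / k.factorial) with hg
      set g' : ℝ → ℝ := fun x => Real.cos (x + (φ + Real.pi / 2)) - ∑ k ∈ range K,
          Real.cos ((φ + Real.pi / 2) + k * (Real.pi / 2)) * (x ^ k / k.factorial) with hg'
      have hd : ∀ x, HasDerivAt g (g' x) x := by
        intro x
        have h1 : HasDerivAt (fun x => Real.cos (x + φ)) (Real.cos (x + (φ + Real.pi / 2))) x := by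
          refine ((hasDerivAt_id' x).add_const φ).cos.congr_deriv ?_
          rw [← add_assoc, Real.cos_add_pi_div_two]; simp
        have h2 : ∀ k : ℕ, HasDerivAt (fun x : ℝ => Real.cos (φ + (k + 1 : ℕ) * (Real.pi / 2)) *
            (x ^ (k + 1) / (k + 1).factorial))
            (Real.cos ((φ + Real.pi / 2) + k * (Real.pi / 2)) * (x ^ k / k.factorial)) x := by
          intro k
          refine (((hasDerivAt_pow (k + 1) x).div_const ((k + 1).factorial : ℝ)).const_mul
            (Real.cos (φ + (k + 1 : ℕ) * (Real.pi / 2)))).congr_deriv ?_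
          rw [Nat.factorial_succ]
          have h3 : ((k : ℝ) + 1) ≠ 0 := by positivity
          have h4 : (k.factorial : ℝ) ≠ 0 := by positivity
          congr 1
          · congr 1; push_cast; ring
          · push_cast; field_simp
        have h3 : g = fun x => Real.cos (x + φ) - (∑ k ∈ range K,
            Real.cos (φ + (k + 1 : ℕ) * (Real.pi / 2)) * (x ^ (k + 1) / (k + 1).factorial)
              + Real.cos φ) := by
          funext x; rw [hg]; simp only [sum_range_succ']; simp
        rw [h3]
        refine h1.sub (HasDerivAt.add_const _ ?_)
        exact HasDerivAt.fun_sum fun k _ => h2 k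
      have hd2 : ∀ u, HasDerivAt (fun t => g (s * t)) (g' (s * u) * s) u := fun u => by
        have h1 : HasDerivAt (fun t => s * t) s u := by
          simpa using (hasDerivAt_id u).const_mul s
        exact (hd (s * u)).comp u h1
      have hB : ∀ u : ℝ, HasDerivAt (fun t : ℝ => t ^ (K + 1) / (K + 1).factorial)
          (u ^ K / K.factorial) u := fun u => by
        refine ((hasDerivAt_pow (K + 1) u).div_const ((K + 1).factorial : ℝ)).congr_deriv ?_
        rw [Nat.factorial_succ]
        have h3 : ((K : ℝ) + 1) ≠ 0 := by positivity
        have h4 : (K.factorial : ℝ) ≠ 0 := by positivity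
        push_cast; field_simp
      have := image_norm_le_of_norm_deriv_right_le_deriv_boundary (a := 0) (b := t)
        (f := fun t => g (s * t)) (f' := fun u => g' (s * u) * s)
        (B := fun t : ℝ => t ^ (K + 1) / (K + 1).factorial) (B' := fun u => u ^ K / K.factorial)
        (fun u _ => (hd2 u).continuousAt.continuousWithinAt)
        (fun u _ => (hd2 u).hasDerivWithinAt) (by simp [hg, sum_range_succ'])
        hB (fun u hu => by
          rw [Real.norm_eq_abs, abs_mul, hs, mul_one]
          have := ih (φ + Real.pi / 2) (s * u)
          rwa [abs_mul, hs, one_mul, abs_of_nonneg hu.1] at this)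
        (Set.right_mem_Icc.2 ht)
      simpa using this
    rcases le_total 0 x with hx | hx
    · have := hkey 1 (by simp) x hx
      rw [abs_of_nonneg hx]; simpa using this
    · have := hkey (-1) (by simp) (-x) (by linarith)
      rw [abs_of_nonpos hx]; simpa using this

/-- The signed measure `ν` has small moments, and its absolute moments are controlled. -/
def MomSmall {n : ℕ} (K : ℕ) (γ : ℝ) (ν : (Fin n → Bool) → ℝ) : Prop :=
  (∀ k ≤ K, |∑ y, ν y * Yv y ^ k| ≤ γ) ∧
    ∀ k, 2 * k ≤ K → ∑ y, |ν y| * Yv y ^ (2 * k) ≤ 3 * mom n (2 * k) + γ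

lemma MomSmall.mono {n K L : ℕ} {γ γ' : ℝ} {ν : (Fin n → Bool) → ℝ} (h : MomSmall L γ ν)
    (hK : K ≤ L) (hγ : γ ≤ γ') : MomSmall K γ' ν :=
  ⟨fun k hk => (h.1 k (hk.trans hK)).trans hγ,
    fun k hk => (h.2 k (hk.trans hK)).trans (by linarith)⟩

lemma MomSmall.sum_abs_le {n K : ℕ} {γ : ℝ} {ν : (Fin n → Bool) → ℝ} (h : MomSmall K γ ν) :
    ∑ y, |ν y| ≤ 3 + γ := by
  have := h.2 0 (by simp)
  simpa [mom, Ex_const] using this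

/-- Integrals of `F` against signed measures with small moments are small. -/
def MomNull (F : ℝ → ℝ) : Prop := ∀ η > 0, ∃ K : ℕ, ∃ γ > 0, ∀ (n : ℕ) (ν : (Fin n → Bool) → ℝ),
  MomSmall K γ ν → |∑ y, ν y * F (Yv y)| ≤ η

lemma MomNull.const_mul {F : ℝ → ℝ} (h : MomNull F) (c : ℝ) : MomNull (fun x => c * F x) := by
  intro η hη
  obtain ⟨K, γ, hγ, H⟩ := h (η / (|c| + 1)) (by positivity)
  refine ⟨K, γ, hγ, fun n ν hν => ?_⟩
  have h1 : ∑ y, ν y * (c * F (Yv y)) = c * ∑ y, ν y * F (Yv y) := by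
    rw [mul_sum]; exact sum_congr rfl fun y _ => by ring
  rw [h1, abs_mul]
  calc |c| * |∑ y, ν y * F (Yv y)| ≤ (|c| + 1) * (η / (|c| + 1)) := by
        gcongr
        · linarith
        · exact H n ν hν
    _ = η := by field_simp

lemma MomNull.add {F G : ℝ → ℝ} (hF : MomNull F) (hG : MomNull G) :
    MomNull (fun x => F x + G x) := by
  intro η hη
  obtain ⟨K, γ, hγ, H⟩ := hF (η / 2) (by positivity)
  obtain ⟨L, γ', hγ', H'⟩ := hG (η / 2) (by positivity)
  refine ⟨max K L, min γ γ', lt_min hγ hγ', fun n ν hν => ?_⟩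
  have h1 := H n ν (hν.mono (le_max_left _ _) (min_le_left _ _))
  have h2 := H' n ν (hν.mono (le_max_right _ _) (min_le_right _ _))
  have h3 : ∑ y, ν y * (F (Yv y) + G (Yv y))
      = ∑ y, ν y * F (Yv y) + ∑ y, ν y * G (Yv y) := by
    rw [← sum_add_distrib]; exact sum_congr rfl fun y _ => by ring
  rw [h3]
  exact (abs_add_le _ _).trans (by linarith)

lemma momNull_zero : MomNull (fun _ => 0) := fun η hη => ⟨0, 1, one_pos, fun n ν _ => by
  simpa using hη.le⟩

lemma MomNull.sum {κ : Type*} (s : Finset κ) {F : κ → ℝ → ℝ} (h : ∀ k ∈ s, MomNull (F k)) :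
    MomNull (fun x => ∑ k ∈ s, F k x) := by
  classical
  induction s using Finset.induction_on with
  | empty => simpa using momNull_zero
  | insert a s ha ih =>
    simp only [sum_insert ha]
    exact (h a (mem_insert_self _ _)).add (ih fun k hk => h k (mem_insert_of_mem hk))

lemma momNull_cos (l φ : ℝ) : MomNull (fun x => Real.cos (l * x + φ)) := by
  intro η hη
  set L : ℝ := 2 * (|l| + 1) with hL
  have hL0 : 0 < L := by positivity
  obtain ⟨k, hk⟩ : ∃ k : ℕ, (1 / 2 : ℝ) ^ (2 * k) * (6 * Real.exp (L ^ 2 / 2)) ≤ η / 2 := by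
    obtain ⟨k, hk⟩ := exists_pow_lt_of_lt_one
      (show 0 < η / 2 / (6 * Real.exp (L ^ 2 / 2)) by positivity) (show (1 / 2 : ℝ) < 1 by norm_num)
    refine ⟨k, ?_⟩
    rw [← le_div_iff₀ (by positivity)]
    exact (pow_le_pow_of_le_one (by norm_num) (by norm_num) (by omega)).trans hk.le
  set S : ℝ := ∑ j ∈ range (2 * k), |l| ^ j / j.factorial + |l| ^ (2 * k) / (2 * k).factorial
  have hS : 0 ≤ S := by positivity
  refine ⟨2 * k, η / 2 / (S + 1), by positivity, fun n ν hν => ?_⟩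
  set γ := η / 2 / (S + 1) with hγ
  have hγ0 : 0 < γ := by positivity
  set Tl : ℝ → ℝ := fun x => ∑ j ∈ range (2 * k),
    Real.cos (φ + j * (Real.pi / 2)) * ((l * x) ^ j / j.factorial)
  have h1 : |∑ y, ν y * Tl (Yv y)| ≤ (∑ j ∈ range (2 * k), |l| ^ j / j.factorial) * γ := by
    have : ∑ y, ν y * Tl (Yv y) = ∑ j ∈ range (2 * k),
        Real.cos (φ + j * (Real.pi / 2)) * (l ^ j / j.factorial) * ∑ y, ν y * Yv y ^ j := by
      simp only [Tl, mul_sum]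
      rw [sum_comm]
      refine sum_congr rfl fun j _ => sum_congr rfl fun y _ => ?_
      rw [mul_pow]; ring
    rw [this, sum_mul]
    refine (abs_sum_le_sum_abs _ _).trans (sum_le_sum fun j hj => ?_)
    rw [abs_mul, abs_mul, abs_div, abs_pow, Nat.abs_cast]
    have := hν.1 j (by have := mem_range.1 hj; omega)
    have hc := Real.abs_cos_le_one (φ + j * (Real.pi / 2))
    calc |Real.cos (φ + j * (Real.pi / 2))| * (|l| ^ j / j.factorial) * |∑ y, ν y * Yv y ^ j|
        ≤ 1 * (|l| ^ j / j.factorial) * γ := by gcongr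
      _ = _ := by ring
  have h2 : |∑ y, ν y * (Real.cos (l * Yv y + φ) - Tl (Yv y))|
      ≤ |l| ^ (2 * k) / (2 * k).factorial * (3 * mom n (2 * k) + γ) := by
    calc |∑ y, ν y * (Real.cos (l * Yv y + φ) - Tl (Yv y))|
        ≤ ∑ y, |ν y| * (|l| ^ (2 * k) / (2 * k).factorial * Yv y ^ (2 * k)) := by
          refine (abs_sum_le_sum_abs _ _).trans (sum_le_sum fun y _ => ?_)
          rw [abs_mul]
          gcongr
          have := abs_cos_sub_taylor_le (2 * k) φ (l * Yv y)
          refine this.trans_eq ?_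
          rw [abs_mul, mul_pow, (even_two_mul k).pow_abs (Yv y)]; ring
      _ = |l| ^ (2 * k) / (2 * k).factorial * ∑ y, |ν y| * Yv y ^ (2 * k) := by
          rw [mul_sum]; exact sum_congr rfl fun y _ => by ring
      _ ≤ _ := by gcongr; exact hν.2 k le_rfl
  have h3 : |l| ^ (2 * k) / (2 * k).factorial * (3 * mom n (2 * k)) ≤ η / 2 := by
    refine le_trans ?_ hk
    have hm := mom_even_le (n := n) k hL0
    calc |l| ^ (2 * k) / (2 * k).factorial * (3 * mom n (2 * k))
        ≤ |l| ^ (2 * k) / (2 * k).factorial *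
          (3 * (2 * (2 * k).factorial / L ^ (2 * k) * Real.exp (L ^ 2 / 2))) := by gcongr
      _ = (|l| / L) ^ (2 * k) * (6 * Real.exp (L ^ 2 / 2)) := by
          rw [div_pow]; field_simp; ring
      _ ≤ _ := by
          have : |l| / L ≤ 1 / 2 := by rw [div_le_iff₀ hL0]; linarith
          gcongr
  have h4 : ∑ y, ν y * Real.cos (l * Yv y + φ)
      = ∑ y, ν y * Tl (Yv y) + ∑ y, ν y * (Real.cos (l * Yv y + φ) - Tl (Yv y)) := by
    rw [← sum_add_distrib]; exact sum_congr rfl fun y _ => by ring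
  have h5 : S * γ ≤ η / 2 := by
    rw [hγ, mul_div_assoc', div_le_iff₀ (by positivity)]; nlinarith
  rw [h4]
  refine (abs_add_le _ _).trans ?_
  have h6 : S * γ = (∑ j ∈ range (2 * k), |l| ^ j / j.factorial) * γ
    + |l| ^ (2 * k) / (2 * k).factorial * γ := by simp only [S]; ring
  rw [mul_add] at h2
  linarith

lemma momNull_cos_mul_sin_pow (θ : ℝ) (k : ℕ) :
    ∀ l φ : ℝ, MomNull (fun x => Real.cos (l * x + φ) * Real.sin (θ * x) ^ k) := by
  induction k with
  | zero => intro l φ; simpa using momNull_cos l φ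
  | succ k ih =>
    intro l φ
    have h := ((ih (l + θ) (φ - Real.pi / 2)).const_mul (1 / 2)).add
      ((ih (l - θ) (φ - Real.pi / 2)).const_mul (-1 / 2))
    convert h using 1
    funext x
    have h1 : Real.cos ((l + θ) * x + (φ - Real.pi / 2)) = Real.sin ((l * x + φ) + θ * x) := by
      rw [← Real.cos_sub_pi_div_two]; congr 1; ring
    have h2 : Real.cos ((l - θ) * x + (φ - Real.pi / 2)) = Real.sin ((l * x + φ) - θ * x) := by
      rw [← Real.cos_sub_pi_div_two]; congr 1; ring
    rw [h1, h2, Real.sin_add, Real.sin_sub]; ring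

lemma momNull_sin_pow (θ : ℝ) (k : ℕ) : MomNull (fun x => Real.sin (θ * x) ^ k) := by
  simpa using momNull_cos_mul_sin_pow θ k 0 0

lemma momNull_eval_sin (θ : ℝ) (p : Polynomial ℝ) :
    MomNull (fun x => p.eval (Real.sin (θ * x))) := by
  simp only [Polynomial.eval_eq_sum_range]
  exact MomNull.sum _ fun k _ => (momNull_sin_pow θ k).const_mul _

lemma bernstein_lipschitz {N : ℕ} (hN : 0 < N) {Λ κ : ℝ} (hΛ : 0 ≤ Λ) (hκ : 0 < κ) {g : ℝ → ℝ}
    (hg : ∀ x y, |g x - g y| ≤ Λ * |x - y|) {x : ℝ} (h0 : 0 ≤ x) (h1 : x ≤ 1) :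
    |g x - ∑ k ∈ range (N + 1), g (k / N) * (bernsteinPolynomial ℝ N k).eval x|
      ≤ Λ * (κ + 1 / (N * κ)) := by
  have hN' : (0 : ℝ) < N := by exact_mod_cast hN
  have hb : ∀ k, 0 ≤ (bernsteinPolynomial ℝ N k).eval x := fun k => by
    simp only [bernsteinPolynomial, Polynomial.eval_mul, Polynomial.eval_pow, Polynomial.eval_sub,
      Polynomial.eval_X, Polynomial.eval_one, Polynomial.eval_natCast]
    have : 0 ≤ 1 - x := by linarith
    positivity
  have hs : ∑ k ∈ range (N + 1), (bernsteinPolynomial ℝ N k).eval x = 1 := by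
    have := congrArg (Polynomial.eval x) (bernsteinPolynomial.sum ℝ N)
    simpa [Polynomial.eval_finsetSum] using this
  have hv : ∑ k ∈ range (N + 1), (N * x - k) ^ 2 * (bernsteinPolynomial ℝ N k).eval x
      = N * x * (1 - x) := by
    have := congrArg (Polynomial.eval x) (bernsteinPolynomial.variance ℝ N)
    simpa [Polynomial.eval_finsetSum] using this
  have hu : ∀ k : ℕ, |x - k / N| ≤ κ + (N * x - k) ^ 2 / (N ^ 2 * κ) := fun k => by
    have e : (N * x - k) ^ 2 / (N ^ 2 * κ) = |x - k / N| ^ 2 / κ := by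
      rw [sq_abs]; field_simp
    rw [e]
    set u := |x - k / N|
    have : κ * u ≤ κ * κ + u ^ 2 := by nlinarith [sq_nonneg (κ - u), sq_nonneg u, sq_nonneg κ]
    rw [← sub_le_iff_le_add', le_div_iff₀ hκ]; nlinarith
  have h2 : g x - ∑ k ∈ range (N + 1), g (k / N) * (bernsteinPolynomial ℝ N k).eval x
      = ∑ k ∈ range (N + 1), (g x - g (k / N)) * (bernsteinPolynomial ℝ N k).eval x := by
    simp_rw [sub_mul]; rw [sum_sub_distrib, ← mul_sum, hs, mul_one]
  rw [h2]
  calc |∑ k ∈ range (N + 1), (g x - g (k / N)) * (bernsteinPolynomial ℝ N k).eval x|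
      ≤ ∑ k ∈ range (N + 1), Λ * (κ + (N * x - k) ^ 2 / (N ^ 2 * κ)) *
          (bernsteinPolynomial ℝ N k).eval x := by
        refine (abs_sum_le_sum_abs _ _).trans (sum_le_sum fun k _ => ?_)
        rw [abs_mul, abs_of_nonneg (hb k)]
        refine mul_le_mul_of_nonneg_right ((hg _ _).trans ?_) (hb k)
        exact mul_le_mul_of_nonneg_left (hu k) hΛ
    _ = Λ * (κ * ∑ k ∈ range (N + 1), (bernsteinPolynomial ℝ N k).eval x
          + 1 / (N ^ 2 * κ) * ∑ k ∈ range (N + 1),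
            (N * x - k) ^ 2 * (bernsteinPolynomial ℝ N k).eval x) := by
        rw [mul_sum, mul_sum, ← sum_add_distrib, mul_sum]
        exact sum_congr rfl fun k _ => by ring
    _ ≤ _ := by
        rw [hs, hv, mul_one]
        gcongr
        have : N * x * (1 - x) ≤ N := by nlinarith [mul_nonneg hN'.le h0]
        calc 1 / (N ^ 2 * κ) * (N * x * (1 - x)) ≤ 1 / (N ^ 2 * κ) * N := by gcongr
          _ = _ := by field_simp

/-- Small moments control all Lipschitz functions of `sin (θ Y)`, uniformly. -/
lemma lipschitz_sin_small (θ : ℝ) {Λ η : ℝ} (hΛ : 0 ≤ Λ) (hη : 0 < η) :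
    ∃ K : ℕ, ∃ γ > 0, ∀ (n : ℕ) (ν : (Fin n → Bool) → ℝ), MomSmall K γ ν → ∀ g : ℝ → ℝ,
      (∀ x y, |g x - g y| ≤ Λ * |x - y|) → (∀ x, |g x| ≤ 1) →
      |∑ y, ν y * g (Real.sin (θ * Yv y))| ≤ η := by
  set κ : ℝ := η / (32 * (Λ + 1)) with hκ
  have hκ0 : 0 < κ := by positivity
  obtain ⟨N, hN⟩ := exists_nat_gt (1 / (κ * κ))
  have hN0 : (0 : ℝ) < N := lt_trans (by positivity) hN
  have hN1 : 0 < N := by exact_mod_cast hN0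
  have hNκ : 1 / (N * κ) ≤ κ := by
    rw [div_lt_iff₀ (by positivity)] at hN
    rw [div_le_iff₀ (by positivity)]; nlinarith
  set b : ℕ → ℝ → ℝ := fun k x => (bernsteinPolynomial ℝ N k).eval ((1 + x) / 2) with hb
  have hbn : ∀ k, MomNull (fun x => b k (Real.sin (θ * x))) := fun k => by
    have := momNull_eval_sin θ ((bernsteinPolynomial ℝ N k).comp
      (Polynomial.C (1 / 2) * (1 + Polynomial.X)))
    convert this using 2 with x
    simp [hb]; congr 1; ring
  have hchoose : ∀ k, ∃ K : ℕ, ∃ γ > 0, ∀ (n : ℕ) (ν : (Fin n → Bool) → ℝ), MomSmall K γ ν →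
      |∑ y, ν y * b k (Real.sin (θ * Yv y))| ≤ η / 2 / (N + 1) := fun k =>
    hbn k _ (by positivity)
  choose Kf γf hγf H using hchoose
  have hne : (range (N + 1)).Nonempty := ⟨0, by simp⟩
  refine ⟨(range (N + 1)).sup Kf, min 1 ((range (N + 1)).inf' hne γf),
    lt_min one_pos ((lt_inf'_iff _).2 fun k _ => hγf k), fun n ν hν g hg hg1 => ?_⟩
  have hm : ∑ y, |ν y| ≤ 4 := hν.sum_abs_le.trans (by
    have := min_le_left 1 ((range (N + 1)).inf' hne γf); linarith)
  set g2 : ℝ → ℝ := fun x => g (2 * x - 1)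
  have hg2 : ∀ x y, |g2 x - g2 y| ≤ (2 * Λ) * |x - y| := fun x y => by
    refine (hg _ _).trans_eq ?_
    rw [show 2 * x - 1 - (2 * y - 1) = 2 * (x - y) by ring, abs_mul, abs_two]; ring
  set A : ℝ → ℝ := fun x => ∑ k ∈ range (N + 1), g2 (k / N) * b k x
  have h1 : ∀ y : Fin n → Bool, |g (Real.sin (θ * Yv y)) - A (Real.sin (θ * Yv y))| ≤ η / 8 := by
    intro y
    set s := Real.sin (θ * Yv y)
    have h0 := Real.neg_one_le_sin (θ * Yv y)
    have h1 := Real.sin_le_one (θ * Yv y)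
    have := bernstein_lipschitz hN1 (by positivity : 0 ≤ 2 * Λ) hκ0 hg2
      (x := (1 + s) / 2) (by linarith) (by linarith)
    have e : g2 ((1 + s) / 2) = g s := by simp only [g2]; congr 1; ring
    rw [e] at this
    refine this.trans ?_
    calc 2 * Λ * (κ + 1 / (N * κ)) ≤ 2 * (Λ + 1) * (κ + κ) := by gcongr; linarith
      _ = η / 8 := by rw [hκ]; field_simp; norm_num
  have h2 : |∑ y, ν y * A (Real.sin (θ * Yv y))| ≤ η / 2 := by
    have e : ∑ y, ν y * A (Real.sin (θ * Yv y)) = ∑ k ∈ range (N + 1),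
        g2 (k / N) * ∑ y, ν y * b k (Real.sin (θ * Yv y)) := by
      simp only [A, mul_sum]; rw [sum_comm]
      exact sum_congr rfl fun k _ => sum_congr rfl fun y _ => by ring
    rw [e]
    calc _ ≤ ∑ k ∈ range (N + 1), η / 2 / (N + 1) := by
          refine (abs_sum_le_sum_abs _ _).trans (sum_le_sum fun k hk => ?_)
          rw [abs_mul, ← one_mul (η / 2 / (N + 1))]
          refine mul_le_mul (hg1 _) (H k n ν (hν.mono (le_sup hk)
            ((min_le_right _ _).trans (inf'_le _ hk)))) (abs_nonneg _) zero_le_one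
      _ = η / 2 := by simp; field_simp
  have h3 : ∑ y, ν y * g (Real.sin (θ * Yv y)) = ∑ y, ν y * A (Real.sin (θ * Yv y))
      + ∑ y, ν y * (g (Real.sin (θ * Yv y)) - A (Real.sin (θ * Yv y))) := by
    rw [← sum_add_distrib]; exact sum_congr rfl fun y _ => by ring
  have h4 : |∑ y, ν y * (g (Real.sin (θ * Yv y)) - A (Real.sin (θ * Yv y)))| ≤ 4 * (η / 8) := by
    calc _ ≤ ∑ y, |ν y| * (η / 8) := by
          refine (abs_sum_le_sum_abs _ _).trans (sum_le_sum fun y _ => ?_)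
          rw [abs_mul]; gcongr; exact h1 y
      _ ≤ _ := by rw [← sum_mul]; gcongr
  rw [h3]
  exact (abs_add_le _ _).trans (by linarith)

end WeakApproximation

/-! ### Smooth signed measures on a parity class -/

section ParityClass

/-- The sign `(-1) ^ w`. -/
def par (w : ℤ) : ℝ := if Even w then 1 else -1

lemma par_add_two_mul (w j : ℤ) : par (w + 2 * j) = par w := by
  simp [par, Int.even_add]

lemma par_eq_or (w : ℤ) : par w = 1 ∨ par w = -1 := by
  unfold par; split_ifs <;> simp

lemma chi_univ_eq_par {n : ℕ} (y : Fin n → Bool) : chi univ y = par (wt univ y) := by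
  rw [wt_univ_eq]
  have h1 : chi univ y = (-1) ^ hw y := by
    simp [chi, sg, hw, prod_ite]
  rw [h1, par]
  rcases Nat.even_or_odd (hw y) with h | h
  · rw [h.neg_one_pow, if_pos (by exact_mod_cast h)]
  · rw [h.neg_one_pow, if_neg (by rw [Int.not_even_iff_odd]; exact_mod_cast h)]

lemma exists_eq_add_two_mul {w w' : ℤ} (h : par w = par w') : ∃ k, w' = w + 2 * k := by
  have : Even w ↔ Even w' := by
    unfold par at h; split_ifs at h with h1 h2 h2 <;> first | tauto | norm_num at h
  obtain ⟨k, hk⟩ := (Int.even_sub.2 this.symm : Even (w' - w))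
  exact ⟨k, by omega⟩

/-- Extension of a Lipschitz function from finitely many points. -/
lemma exists_lipschitz_extension {κ : Type*} (S : Finset κ) (a v : κ → ℝ) {Λ : ℝ} (hΛ : 0 ≤ Λ)
    (hv : ∀ i ∈ S, |v i| ≤ 1) (h : ∀ i ∈ S, ∀ j ∈ S, v i - v j ≤ Λ * |a i - a j|) :
    ∃ g : ℝ → ℝ, (∀ x y, |g x - g y| ≤ Λ * |x - y|) ∧ (∀ x, |g x| ≤ 1) ∧ ∀ i ∈ S, g (a i) = v i := by
  rcases S.eq_empty_or_nonempty with rfl | hS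
  · exact ⟨fun _ => 0, fun x y => by simpa using by positivity, fun x => by simp, by simp⟩
  set g0 : ℝ → ℝ := fun x => S.inf' hS fun i => v i + Λ * |x - a i| with hg0
  have h0 : ∀ x y, g0 x ≤ g0 y + Λ * |x - y| := by
    intro x y
    obtain ⟨i, hi, hie⟩ := exists_mem_eq_inf' hS (fun i => v i + Λ * |y - a i|)
    have h1 : g0 x ≤ v i + Λ * |x - a i| := inf'_le _ hi
    have h2 : g0 y = v i + Λ * |y - a i| := hie
    have h3 : Λ * |x - a i| ≤ Λ * (|x - y| + |y - a i|) := by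
      gcongr; exact abs_sub_le _ _ _
    rw [h2]; linarith
  have h1 : ∀ x y, |g0 x - g0 y| ≤ Λ * |x - y| := fun x y => by
    rw [abs_le]
    have := h0 x y
    have := h0 y x
    rw [abs_sub_comm] at this
    constructor <;> linarith
  have h2 : ∀ i ∈ S, g0 (a i) = v i := fun i hi => by
    refine le_antisymm ((inf'_le _ hi).trans (by simp)) ?_
    rw [hg0, le_inf'_iff]
    intro j hj
    have := h i hi j hj
    linarith
  refine ⟨fun x => max (-1) (min 1 (g0 x)), fun x y => ?_, fun x => ?_, fun i hi => ?_⟩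
  · refine le_trans ?_ (h1 x y)
    refine (abs_max_sub_max_le_max _ _ _ _).trans ?_
    rw [sub_self, abs_zero, max_eq_right (abs_nonneg _)]
    refine (abs_min_sub_min_le_max _ _ _ _).trans ?_
    rw [sub_self, abs_zero, max_eq_right (abs_nonneg _)]
  · exact abs_le.2 ⟨le_max_left _ _, max_le (by norm_num) (min_le_left _ _)⟩
  · have := abs_le.1 (hv i hi)
    simp only [h2 i hi]
    rw [min_eq_right this.2, max_eq_right this.1]

lemma abs_sub_le_four_mul_sin {a b : ℝ} (ha : |a| ≤ 1) (hb : |b| ≤ 1) :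
    |a - b| ≤ 4 * |Real.sin a - Real.sin b| := by
  have ha' := abs_le.1 ha
  have hb' := abs_le.1 hb
  rw [Real.sin_sub_sin, abs_mul, abs_mul, abs_two]
  have h1 : 1 / 2 ≤ |Real.cos ((a + b) / 2)| := by
    have := Real.one_sub_sq_div_two_le_cos (x := (a + b) / 2)
    refine le_trans ?_ (le_abs_self _)
    have : ((a + b) / 2) ^ 2 ≤ 1 := by
      rw [sq_le_one_iff_abs_le_one, abs_le]; constructor <;> linarith
    linarith
  have h2 : |a - b| / 4 ≤ |Real.sin ((a - b) / 2)| := by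
    have key : ∀ u : ℝ, 0 ≤ u → u ≤ 1 → u / 2 ≤ Real.sin u := fun u hu hu1 => by
      have := Real.mul_le_sin hu (by linarith [Real.pi_gt_three])
      refine le_trans ?_ this
      have : 1 / 2 ≤ 2 / Real.pi := by
        rw [div_le_div_iff₀ two_pos Real.pi_pos]; linarith [Real.pi_le_four]
      nlinarith
    rcases le_total 0 (a - b) with h | h
    · have := key ((a - b) / 2) (by linarith) (by linarith)
      rw [abs_of_nonneg h]
      exact le_trans (by linarith) (le_abs_self _)
    · have := key (-((a - b) / 2)) (by linarith) (by linarith)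
      rw [Real.sin_neg] at this
      rw [abs_of_nonpos h]
      exact le_trans (by linarith) (neg_le_abs _)
  nlinarith [mul_le_mul h2 h1 (by norm_num) (abs_nonneg _)]

/-- Average of `φ` over `J` steps of size two. -/
def avg2 (J : ℕ) (φ : ℤ → ℝ) (w : ℤ) : ℝ := (∑ j ∈ range J, φ (w + 2 * j)) / J

lemma abs_avg2_le {J : ℕ} (hJ : 0 < J) {φ : ℤ → ℝ} (hφ : ∀ k, |φ k| ≤ 1) (w : ℤ) :
    |avg2 J φ w| ≤ 1 := by
  unfold avg2
  have hJ' : (0 : ℝ) < J := by exact_mod_cast hJ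
  rw [abs_div, Nat.abs_cast, div_le_one hJ']
  exact (abs_sum_le_sum_abs _ _).trans ((sum_le_sum fun j _ => hφ _).trans (by simp))

lemma avg2_sub_le_nat {J : ℕ} {φ : ℤ → ℝ} (hφ : ∀ k, |φ k| ≤ 1) (w : ℤ)
    (k : ℕ) : |avg2 J φ (w + 2 * k) - avg2 J φ w| ≤ 2 * k / J := by
  induction k with
  | zero => simp
  | succ k ih =>
    have h1 : |avg2 J φ (w + 2 * (k + 1 : ℕ)) - avg2 J φ (w + 2 * k)| ≤ 2 / J := by
      unfold avg2
      rw [← sub_div, abs_div, Nat.abs_cast]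
      gcongr
      have := sum_range_sub (fun j : ℕ => φ (w + 2 * k + 2 * j)) J
      rw [← sum_sub_distrib]
      have e : ∀ j : ℕ, φ (w + 2 * (k + 1 : ℕ) + 2 * j) = φ (w + 2 * k + 2 * (j + 1 : ℕ)) :=
        fun j => by congr 1; push_cast; ring
      simp_rw [e]
      rw [this]
      have h1 := abs_le.1 (hφ (w + 2 * k + 2 * (J : ℕ)))
      have h2 := abs_le.1 (hφ (w + 2 * k + 2 * (0 : ℕ)))
      rw [abs_le]; constructor <;> linarith
    calc _ ≤ |avg2 J φ (w + 2 * (k + 1 : ℕ)) - avg2 J φ (w + 2 * k)|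
          + |avg2 J φ (w + 2 * k) - avg2 J φ w| := abs_sub_le _ _ _
      _ ≤ 2 / J + 2 * k / J := add_le_add h1 ih
      _ = _ := by push_cast; ring

lemma avg2_sub_le {J : ℕ} {φ : ℤ → ℝ} (hφ : ∀ k, |φ k| ≤ 1) {w w' : ℤ}
    (h : par w = par w') : |avg2 J φ w - avg2 J φ w'| ≤ |(w : ℝ) - w'| / J := by
  obtain ⟨k, rfl⟩ := exists_eq_add_two_mul h
  obtain ⟨l, rfl | rfl⟩ := Int.eq_nat_or_neg k
  · have := avg2_sub_le_nat (J := J) hφ w l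
    rw [abs_sub_comm]
    refine this.trans_eq ?_
    push_cast
    rw [sub_add_cancel_left, abs_neg, abs_of_nonneg (by positivity)]
  · have := avg2_sub_le_nat (J := J) hφ (w + 2 * -(l : ℤ)) l
    rw [show w + 2 * -(l : ℤ) + 2 * l = w by ring] at this
    refine this.trans_eq ?_
    push_cast
    rw [show (w : ℝ) - (w + 2 * -(l : ℝ)) = 2 * l by ring, abs_of_nonneg (by positivity)]

/-- A signed measure on a parity class which has small moments and whose weight is nearly invariant
under even shifts has a small effect on all functions of the weight. -/
lemma parity_class_small {δ τ : ℝ} (hδ : 0 < δ) (hτ : 0 < τ) :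
    ∃ K : ℕ, ∃ γ > 0, γ ≤ 1 ∧ ∀ (n : ℕ) (ν : (Fin n → Bool) → ℝ), MomSmall K γ ν → 2 ≤ τ * √n →
      ∀ s : ℝ, (∀ y, ν y ≠ 0 → par (wt univ y) = s) → ∀ φ : ℤ → ℝ, (∀ k, |φ k| ≤ 1) → ∀ σ : ℝ,
      (∀ j : ℕ, j ≤ τ * √n →
        |∑ y, ν y * φ (wt univ y) - ∑ y, ν y * φ (wt univ y + 2 * j)| ≤ σ) →
      |∑ y, ν y * φ (wt univ y)| ≤ σ + δ := by
  set R : ℝ := 2 * (3 * momB 1 + 1) * 2 / δ + 1 with hR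
  have hmB := momB_pos 1
  have hR1 : 1 ≤ R := by rw [hR]; have : 0 ≤ 2 * (3 * momB 1 + 1) * 2 / δ := by positivity
                         linarith
  have hR0 : 0 < R := by linarith
  obtain ⟨K, γ, hγ, H⟩ := lipschitz_sin_small (1 / R) (show 0 ≤ 4 * R / τ by positivity)
    (show 0 < δ / 2 by positivity)
  refine ⟨max K 2, min γ 1, lt_min hγ one_pos, min_le_right _ _,
    fun n ν hν hn s hs φ hφ σ hσ => ?_⟩
  have hnpos : 0 < √n := by
    by_contra! h
    have : √(n : ℝ) = 0 := le_antisymm h (Real.sqrt_nonneg _)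
    rw [this] at hn; linarith
  set J := ⌊τ * √n⌋₊ with hJ
  have hJ1 : (J : ℝ) ≤ τ * √n := Nat.floor_le (by positivity)
  have hJ2 : τ * √n / 2 ≤ J := by
    have := (Nat.lt_floor_add_one (τ * √n)).le
    rw [← hJ] at this; linarith
  have hJ0 : (0 : ℝ) < J := by linarith
  have hJpos : 0 < J := by exact_mod_cast hJ0
  set S : Finset (Fin n → Bool) := univ.filter fun y => ν y ≠ 0 ∧ |Yv y| ≤ R with hS
  have hmem : ∀ y, y ∈ S ↔ ν y ≠ 0 ∧ |Yv y| ≤ R := fun y => by simp [hS]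
  obtain ⟨g, hg1, hg2, hg3⟩ := exists_lipschitz_extension S (fun y => Real.sin (1 / R * Yv y))
    (fun y => avg2 J φ (wt univ y)) (show 0 ≤ 4 * R / τ by positivity)
    (fun y _ => abs_avg2_le hJpos hφ _) (fun y hy z hz => by
      rw [hmem] at hy hz
      have h1 := avg2_sub_le (J := J) hφ ((hs y hy.1).trans (hs z hz.1).symm)
      refine (le_abs_self _).trans (h1.trans ?_)
      have h2 : |((wt univ y : ℤ) : ℝ) - wt univ z| = √n * |Yv y - Yv z| / 2 := by
        rw [Yv_eq_wt, Yv_eq_wt, ← sub_div, abs_div, abs_of_pos hnpos, mul_div_cancel₀ _ hnpos.ne',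
          show ((n : ℝ) - 2 * (wt univ y : ℤ) - (n - 2 * (wt univ z : ℤ)))
            = -2 * ((wt univ y : ℤ) - (wt univ z : ℤ)) by ring, abs_mul]
        norm_num
      have hbd : ∀ u : ℝ, |u| ≤ R → |1 / R * u| ≤ 1 := fun u hu => by
        rw [abs_mul, abs_of_pos (by positivity : 0 < 1 / R), one_div, inv_mul_le_iff₀ hR0, mul_one]
        exact hu
      have h3 := abs_sub_le_four_mul_sin (hbd _ hy.2) (hbd _ hz.2)
      rw [← mul_sub, abs_mul, abs_of_pos (by positivity : 0 < 1 / R), one_div,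
        inv_mul_le_iff₀ hR0] at h3
      rw [h2, div_le_iff₀ hJ0]
      calc √n * |Yv y - Yv z| / 2
          ≤ √n * (R * (4 * |Real.sin (1 / R * Yv y) - Real.sin (1 / R * Yv z)|)) / 2 := by
            gcongr; simpa using h3
        _ = 4 * R / τ * |Real.sin (1 / R * Yv y) - Real.sin (1 / R * Yv z)| * (τ * √n / 2) := by
            field_simp
        _ ≤ _ := by gcongr)
  have hA := H n ν (hν.mono (le_max_left _ _) (min_le_left _ _)) g hg1 hg2
  have hB : |∑ y, ν y * φ (wt univ y) - ∑ y, ν y * avg2 J φ (wt univ y)| ≤ σ := by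
    have e : ∑ y, ν y * φ (wt univ y) - ∑ y, ν y * avg2 J φ (wt univ y)
        = (∑ j ∈ range J,
          (∑ y, ν y * φ (wt univ y) - ∑ y, ν y * φ (wt univ y + 2 * j))) / J := by
      rw [sum_sub_distrib, sum_const, card_range, nsmul_eq_mul, sub_div,
        mul_div_cancel_left₀ _ hJ0.ne']
      congr 1
      rw [sum_comm, sum_div]
      refine sum_congr rfl fun y _ => ?_
      rw [avg2, ← mul_sum, mul_div_assoc]
    rw [e, abs_div, Nat.abs_cast, div_le_iff₀ hJ0]
    refine (abs_sum_le_sum_abs _ _).trans ?_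
    calc _ ≤ ∑ j ∈ range J, σ := sum_le_sum fun j hj => hσ j (by
            have : (j : ℝ) ≤ J := by exact_mod_cast (mem_range.1 hj).le
            linarith)
      _ = σ * J := by simp [mul_comm]
  have hC : |∑ y, ν y * avg2 J φ (wt univ y) - ∑ y, ν y * g (Real.sin (1 / R * Yv y))|
      ≤ δ / 2 := by
    rw [← sum_sub_distrib]
    have h2 := hν.2 1 (le_max_right _ _)
    have h3 : mom n (2 * 1) ≤ momB 1 := mom_even_le_momB 1
    have h4 := min_le_right γ 1
    calc |∑ y, (ν y * avg2 J φ (wt univ y) - ν y * g (Real.sin (1 / R * Yv y)))|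
        ≤ ∑ y, 2 / R ^ 2 * (|ν y| * Yv y ^ (2 * 1)) := by
          refine (abs_sum_le_sum_abs _ _).trans (sum_le_sum fun y _ => ?_)
          rw [← mul_sub, abs_mul]
          by_cases hy : y ∈ S
          · have h0 : 0 ≤ Yv y ^ (2 * 1) := by rw [mul_one]; positivity
            rw [hg3 y hy, sub_self, abs_zero, mul_zero]
            positivity
          · rw [hmem, not_and_or, not_not, not_le] at hy
            rcases hy with hy | hy
            · simp [hy]
            · have h5 : |avg2 J φ (wt univ y) - g (Real.sin (1 / R * Yv y))| ≤ 2 := by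
                have h6 := abs_le.1 (abs_avg2_le hJpos hφ (wt univ y))
                have h7 := abs_le.1 (hg2 (Real.sin (1 / R * Yv y)))
                rw [abs_le]; constructor <;> linarith
              have h8 : 1 ≤ Yv y ^ (2 * 1) / R ^ 2 := by
                rw [one_le_div (by positivity), mul_one, ← sq_abs (Yv y)]
                gcongr
              calc |ν y| * |avg2 J φ (wt univ y) - g (Real.sin (1 / R * Yv y))|
                  ≤ |ν y| * (2 * (Yv y ^ (2 * 1) / R ^ 2)) := by gcongr; linarith
                _ = _ := by ring
      _ ≤ 2 / R ^ 2 * (3 * momB 1 + 1) := by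
          rw [← mul_sum]; gcongr; linarith
      _ ≤ δ / 2 := by
          rw [div_mul_eq_mul_div, div_le_iff₀ (by positivity)]
          have h5 : 2 * (3 * momB 1 + 1) * 2 / δ ≤ R ^ 2 := by nlinarith
          rw [div_le_iff₀ hδ] at h5
          linarith
  have hab := abs_add_three (∑ y, ν y * φ (wt univ y) - ∑ y, ν y * avg2 J φ (wt univ y))
    (∑ y, ν y * avg2 J φ (wt univ y) - ∑ y, ν y * g (Real.sin (1 / R * Yv y)))
    (∑ y, ν y * g (Real.sin (1 / R * Yv y)))
  rw [sub_add_sub_cancel, sub_add_cancel] at hab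
  linarith

end ParityClass

/-! ### Comparison with the mixture of even and odd strings -/

section Mixture

variable {n : ℕ}

/-- For `s = ± 1`, the indicator function of the strings of parity `s`. -/
def ev (s : ℝ) (y : Fin n → Bool) : ℝ := (1 + s * chi univ y) / 2

lemma ev_eq {s : ℝ} (hs : s = 1 ∨ s = -1) (y : Fin n → Bool) :
    ev s y = if par (wt univ y) = s then 1 else 0 := by
  unfold ev
  rw [chi_univ_eq_par]
  rcases hs with rfl | rfl <;> rcases par_eq_or (wt univ y) with h | h <;> rw [h] <;> norm_num

lemma ev_nonneg {s : ℝ} (hs : s = 1 ∨ s = -1) (y : Fin n → Bool) : 0 ≤ ev s y := by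
  rw [ev_eq hs]; split_ifs <;> norm_num

lemma ev_le_one {s : ℝ} (hs : s = 1 ∨ s = -1) (y : Fin n → Bool) : ev s y ≤ 1 := by
  rw [ev_eq hs]; split_ifs <;> norm_num

lemma ev_add_ev (y : Fin n → Bool) : ev 1 y + ev (-1) y = 1 := by unfold ev; ring

lemma Ex_ev_mul_pow (s : ℝ) {k : ℕ} (hk : k < n) :
    Ex (fun y : Fin n → Bool => ev s y * Yv y ^ k) = mom n k / 2 := by
  have h1 : ∀ y : Fin n → Bool, ev s y * Yv y ^ k
      = 1 / 2 * Yv y ^ k + s / 2 * (chi univ y * Yv y ^ k) := fun y => by unfold ev; ring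
  simp_rw [h1]
  rw [Ex_add, Ex_mul_left, Ex_mul_left, Ex_chi_univ_Yv_pow hk, mom]; ring

lemma Ex_ev (s : ℝ) (hn : 0 < n) : Ex (fun y : Fin n → Bool => ev s y) = 1 / 2 := by
  have := Ex_ev_mul_pow s hn
  simpa [mom, Ex_const] using this

lemma sum_div_two_pow (g : (Fin n → Bool) → ℝ) : ∑ y, g y / 2 ^ n = Ex g := by
  rw [← sum_div, Ex]; simp

/-- The part of `PG - uniform` of parity `s`, normalised to have total mass zero. -/
def cen (PG : (Fin n → Bool) → ℝ) (s : ℝ) (y : Fin n → Bool) : ℝ :=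
  ev s y * (PG y - 2 * (∑ z, PG z * ev s z) / 2 ^ n)

lemma sum_cen_mul (PG : (Fin n → Bool) → ℝ) (s : ℝ) (g : (Fin n → Bool) → ℝ) :
    ∑ y, cen PG s y * g y
      = ∑ y, PG y * (ev s y * g y) - 2 * (∑ z, PG z * ev s z) * Ex (fun y => ev s y * g y) := by
  rw [← sum_div_two_pow, mul_sum, ← sum_sub_distrib]
  refine sum_congr rfl fun y _ => ?_
  unfold cen; ring

lemma momSmall_cen {K : ℕ} {γ : ℝ} (hK : K < n) {PG : (Fin n → Bool) → ℝ} (h0 : ∀ y, 0 ≤ PG y)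
    (h1 : ∑ y, PG y ≤ 1)
    (h : ∀ k ≤ K, |∑ y, PG y * (Yv y ^ k - mom n k)| ≤ γ ∧
      |∑ y, PG y * (chi univ y * (Yv y ^ k - mom n k))| ≤ γ)
    {s : ℝ} (hs : s = 1 ∨ s = -1) : MomSmall K γ (cen PG s) := by
  set η := ∑ z, PG z * ev s z with hη
  have hη0 : 0 ≤ η := sum_nonneg fun z _ => mul_nonneg (h0 z) (ev_nonneg hs z)
  have hη1 : η ≤ 1 := (sum_le_sum fun z _ =>
    mul_le_of_le_one_right (h0 z) (ev_le_one hs z)).trans h1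
  have key : ∀ k ≤ K, ∑ y, cen PG s y * Yv y ^ k = ∑ y, PG y * (ev s y * Yv y ^ k) - η * mom n k :=
    fun k hk => by
      rw [sum_cen_mul, Ex_ev_mul_pow s (by omega), ← hη]; ring
  have hfirst : ∀ k ≤ K, |∑ y, cen PG s y * Yv y ^ k| ≤ γ := fun k hk => by
    obtain ⟨h2, h3⟩ := h k hk
    have e : ∑ y, cen PG s y * Yv y ^ k = 1 / 2 * ∑ y, PG y * (Yv y ^ k - mom n k)
        + s / 2 * ∑ y, PG y * (chi univ y * (Yv y ^ k - mom n k)) := by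
      rw [key k hk, hη, sum_mul, ← sum_sub_distrib, mul_sum, mul_sum, ← sum_add_distrib]
      refine sum_congr rfl fun y _ => ?_
      unfold ev; ring
    rw [e]
    have := abs_le.1 h2
    have := abs_le.1 h3
    rcases hs with rfl | rfl <;> rw [abs_le] <;> constructor <;> linarith
  refine ⟨hfirst, fun k hk => ?_⟩
  have h4 := (abs_le.1 (hfirst _ hk)).2
  rw [key _ hk] at h4
  calc ∑ y, |cen PG s y| * Yv y ^ (2 * k)
      ≤ ∑ y, (PG y * (ev s y * Yv y ^ (2 * k)) + 2 * η * (ev s y * Yv y ^ (2 * k) / 2 ^ n)) := by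
        refine sum_le_sum fun y _ => ?_
        have h5 : |cen PG s y| ≤ ev s y * (PG y + 2 * η / 2 ^ n) := by
          rw [cen, abs_mul, abs_of_nonneg (ev_nonneg hs y)]
          gcongr
          · exact ev_nonneg hs y
          · have : 0 ≤ 2 * η / 2 ^ n := by positivity
            have := h0 y
            rw [← hη, abs_le]; constructor <;> linarith
        have h6 : 0 ≤ Yv y ^ (2 * k) := by rw [pow_mul]; positivity
        exact (mul_le_mul_of_nonneg_right h5 h6).trans_eq (by ring)
    _ = ∑ y, PG y * (ev s y * Yv y ^ (2 * k)) + η * mom n (2 * k) := by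
        rw [sum_add_distrib, ← mul_sum, sum_div_two_pow (fun y => ev s y * Yv y ^ (2 * k)),
          Ex_ev_mul_pow s (by omega)]; ring
    _ ≤ _ := by
        have := mom_even_nonneg (n := n) k
        nlinarith [mul_le_mul_of_nonneg_right hη1 this]

lemma evens_eq (hn : 0 < n) (y : Fin n → Bool) : evens n y = 2 * ev 1 y / 2 ^ n := by
  have h : ∀ z : Fin n → Bool, (if z ∈ univ.filter (fun x : Fin n → Bool => Even (hw x)) then
      (1 : ℝ) else 0) = ev 1 z := fun z => by
    rw [ev_eq (Or.inl rfl), wt_univ_eq, par]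
    by_cases he : Even (hw z)
    · have he' : Even (hw z : ℤ) := by exact_mod_cast he
      rw [if_pos (by simpa using he), if_pos he', if_pos rfl]
    · have he' : ¬ Even (hw z : ℤ) := by exact_mod_cast he
      rw [if_neg (by simpa using he), if_neg he', if_neg (by norm_num)]
  have hc := card_div_eq_Ex (univ.filter (fun x : Fin n → Bool => Even (hw x)))
  simp_rw [h] at hc
  rw [Ex_ev 1 hn, div_eq_iff (by positivity)] at hc
  unfold evens unifOn
  rw [← h y, hc]
  split_ifs <;> simp [mul_comm, div_eq_mul_inv]

lemma odds_eq (hn : 0 < n) (y : Fin n → Bool) : odds n y = 2 * ev (-1) y / 2 ^ n := by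
  have h : ∀ z : Fin n → Bool, (if z ∈ univ.filter (fun x : Fin n → Bool => Odd (hw x)) then
      (1 : ℝ) else 0) = ev (-1) z := fun z => by
    rw [ev_eq (Or.inr rfl), wt_univ_eq, par]
    by_cases he : Even (hw z)
    · have he' : Even (hw z : ℤ) := by exact_mod_cast he
      rw [if_neg (by simpa using he), if_pos he', if_neg (by norm_num)]
    · have he' : ¬ Even (hw z : ℤ) := by exact_mod_cast he
      rw [if_pos (by simpa using he), if_neg he', if_pos rfl]
  have hc := card_div_eq_Ex (univ.filter (fun x : Fin n → Bool => Odd (hw x)))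
  simp_rw [h] at hc
  rw [Ex_ev (-1) hn, div_eq_iff (by positivity)] at hc
  unfold odds unifOn
  rw [← h y, hc]
  split_ifs <;> simp [mul_comm, div_eq_mul_inv]

lemma tvd_triangle {α : Type} [Fintype α] (A B D : α → ℝ) : tvd A D ≤ tvd A B + tvd B D := by
  unfold tvd
  rw [← add_div, ← sum_add_distrib]
  gcongr with x
  exact abs_sub_le _ _ _

/-- Two functions of the weight are distinguished by a function of the weight. -/
lemma tvd_of_weight {D M : (Fin n → Bool) → ℝ} {F : ℕ → ℝ} (hF : ∀ y, D y - M y = F (hw y)) :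
    ∃ φ : ℤ → ℝ, (∀ k, |φ k| ≤ 1) ∧
      2 * tvd D M = ∑ y, D y * φ (wt univ y) - ∑ y, M y * φ (wt univ y) := by
  refine ⟨fun w => if 0 ≤ F w.toNat then 1 else -1, fun k => by dsimp only; split_ifs <;> simp, ?_⟩
  unfold tvd
  rw [mul_div_cancel₀ _ two_ne_zero, ← sum_sub_distrib]
  refine sum_congr rfl fun y _ => ?_
  rw [← sub_mul, hF, wt_univ_eq]
  simp only [Int.toNat_natCast]
  split_ifs with h
  · rw [abs_of_nonneg h, mul_one]
  · rw [abs_of_neg (not_le.1 h)]; ring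

end Mixture

section Final

variable {n : ℕ}

/-- The identity is local. -/
lemma loc_id {d : ℕ} (hd : 1 ≤ d) : Loc d (fun y : Fin n → Bool => y) :=
  ⟨fun i => {i}, fun i => by simpa using hd, fun i x y h => h i (by simp)⟩

lemma law_id (y : Fin n → Bool) : law (fun y : Fin n → Bool => y) y = unifOn univ y := by
  unfold law unifOn Ex
  simp

/-- The mass of the non-Gaussian parts is controlled by the distance to a uniform distribution. -/
lemma sum_bad_le {P PG PB PL : (Fin n → Bool) → ℝ} {C E : Finset (Fin n → Bool)} {α θ μ D : ℝ}
    (hG : ∀ y, 0 ≤ PG y) (hL : ∀ y, 0 ≤ PL y) (hP : ∀ y, P y = PG y + PB y + PL y)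
    (hα : 0 < α) (hC : α ≤ (C.card : ℝ) / 2 ^ n) (hμ : ∑ y, PL y ≤ μ)
    (hθ : ∑ y, PB y * (if y ∈ E then 0 else 1) ≤ θ) (hE : (E.card : ℝ) / 2 ^ n ≤ D) :
    ∑ y, (PB y + PL y) ≤ 2 * tvd P (unifOn C) + D / α + θ + μ := by
  have h1 := (abs_le.1 (abs_sum_sub_mul_le P (unifOn C)
    (τ := fun y => if y ∈ E then (1 : ℝ) else 0) fun y => by split_ifs <;> simp)).2
  have h2 : ∑ y, unifOn C y * (if y ∈ E then (1 : ℝ) else 0) ≤ D / α := by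
    rw [sum_unifOn_mul, ← card_div_eq_Ex C]
    have h3 : Ex (fun y => (if y ∈ C then (1 : ℝ) else 0) * (if y ∈ E then (1 : ℝ) else 0)) ≤ D := by
      refine le_trans (Ex_mono fun y => ?_) ((card_div_eq_Ex E).ge.trans hE)
      split_ifs <;> simp
    have h4 : 0 ≤ D := le_trans (by positivity) hE
    exact div_le_div₀ h4 h3 hα hC
  have h3 : ∑ y, PB y ≤ ∑ y, P y * (if y ∈ E then (1 : ℝ) else 0)
      + ∑ y, PB y * (if y ∈ E then 0 else 1) := by
    rw [← sum_add_distrib]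
    refine sum_le_sum fun y _ => ?_
    have := hG y
    have := hL y
    rw [hP]
    split_ifs <;> linarith
  rw [sum_add_distrib]
  linarith

/-- The theorem for weight sets of non-negligible measure. -/
theorem large_slices {d : ℕ} (hd : 1 ≤ d) {α : ℝ} (hα : 0 < α) {δ : ℝ} (hδ : 0 < δ) : ∃ c > 0,
    ∃ N : ℕ, ∀ n, N ≤ n → ∀ (ι : Type) [Fintype ι] [DecidableEq ι]
    (f : (ι → Bool) → (Fin n → Bool)), Loc d f → ∀ Ψ ⊆ range (n + 1),
    (∃ s ∈ Ψ, |(s : ℝ) - n / 2| ≤ c * n) → α ≤ ((slices n Ψ).card : ℝ) / 2 ^ n →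
    ∃ η : ℝ, 0 ≤ η ∧ η ≤ 1 ∧ tvd (law f) (fun x => η * evens n x + (1 - η) * odds n x)
      ≤ 13 * tvd (law f) (unifOn (slices n Ψ)) + 13 * δ := by
  obtain ⟨c, hc, B, hB, HB⟩ := micro_smooth d
  obtain ⟨c', hc', N1, H1⟩ := card_slices_ge hc
  obtain ⟨N2, H2⟩ := HB δ hδ
  set τ : ℝ := δ / (3 * (B + 1)) with hτ
  have hτ0 : 0 < τ := by positivity
  obtain ⟨K, γ, hγ, -, H3⟩ := parity_class_small hδ hτ0
  obtain ⟨D, hD, H4⟩ := macro_decomp d K hγ hδ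
  set θ : ℝ := δ / (D / α + 1) with hθ
  have hθ0 : 0 < θ := by positivity
  obtain ⟨N3, H5⟩ := H4 θ hθ0
  obtain ⟨N4, hN4⟩ := exists_nat_ge ((2 / τ) ^ 2)
  refine ⟨c', hc', N1 + N2 + N3 + N4 + K + 1, fun n hn ι _ _ f hf Ψ hΨ hs hαC => ?_⟩
  have hn0 : 0 < n := by omega
  have hsq : 2 ≤ τ * √n := by
    have h1 : 2 / τ ≤ √n := Real.le_sqrt_of_sq_le (hN4.trans (by
      have : N4 ≤ n := by omega
      exact_mod_cast this))
    rw [div_le_iff₀ hτ0] at h1; linarith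
  have hsqpos : 0 < √(n : ℝ) := Real.sqrt_pos.2 (by exact_mod_cast hn0)
  have hCard := H1 n (by omega) Ψ hΨ hs
  set C := slices n Ψ with hC
  set ε := tvd (law f) (unifOn C) with hε
  have hε0 : 0 ≤ ε := tvd_nonneg _ _
  obtain ⟨PG, PB, PL, hPG, hPB, hPL, hP, hL, hmom, E, hEθ, hE⟩ := H5 n (by omega) ι f hf
  set ρ := ∑ y, (PB y + PL y) with hρ
  have hρ0 : 0 ≤ ρ := sum_nonneg fun y _ => add_nonneg (hPB y) (hPL y)
  have hρ1 : ρ ≤ 2 * ε + 2 * δ := by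
    have h1 := sum_bad_le hPG hPL hP hα hαC hL hEθ hE
    have h2 : D * θ / α + θ = δ := by rw [hθ]; field_simp
    linarith
  have hmass : ∑ y, PG y = 1 - ρ := by
    have h1 := sum_law_mul f (fun _ => (1 : ℝ))
    rw [Ex_const] at h1
    simp_rw [mul_one, hP] at h1
    rw [hρ, ← h1, ← sum_sub_distrib]
    exact sum_congr rfl fun y _ => by ring
  have hPGclose : ∀ g : (Fin n → Bool) → ℝ, (∀ y, |g y| ≤ 1) →
      |∑ y, law f y * g y - ∑ y, PG y * g y| ≤ ρ := fun g hg => by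
    rw [← sum_sub_distrib]
    refine (abs_sum_le_sum_abs _ _).trans (sum_le_sum fun y _ => ?_)
    rw [← sub_mul, hP, abs_mul, show PG y + PB y + PL y - PG y = PB y + PL y by ring,
      abs_of_nonneg (add_nonneg (hPB y) (hPL y))]
    exact mul_le_of_le_one_right (add_nonneg (hPB y) (hPL y)) (hg y)
  have hη0 : ∀ s : ℝ, s = 1 ∨ s = -1 → 0 ≤ ∑ z, PG z * ev s z := fun s hs =>
    sum_nonneg fun z _ => mul_nonneg (hPG z) (ev_nonneg hs z)
  have hη1 : ∀ s : ℝ, s = 1 ∨ s = -1 → ∑ z, PG z * ev s z ≤ 1 := fun s hs =>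
    (sum_le_sum fun z _ => mul_le_of_le_one_right (hPG z) (ev_le_one hs z)).trans
      (by linarith)
  have hcen : ∀ s : ℝ, s = 1 ∨ s = -1 → ∀ φ : ℤ → ℝ, (∀ k, |φ k| ≤ 1) →
      |∑ y, cen PG s y * φ (wt univ y)| ≤ 8 * ε + 9 * δ := by
    intro s hs φ hφ
    refine (H3 n (cen PG s) (momSmall_cen (by omega) hPG (by linarith) hmom hs) hsq s
      (fun y hy => ?_) φ hφ (8 * ε + 8 * δ) fun j hj => ?_).trans (by linarith)
    · by_contra h
      exact hy (by rw [cen, ev_eq hs, if_neg h, zero_mul])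
    · set ψ : ℤ → ℝ := fun w => (if par w = s then 1 else 0) * φ w with hψ
      have hψ1 : ∀ k, |ψ k| ≤ 1 := fun k => by
        simp only [hψ]; split_ifs
        · simpa using hφ k
        · simp
      have hj' : j * (B / √n) ≤ δ / 3 := by
        calc j * (B / √n) ≤ τ * √n * (B / √n) := by gcongr
          _ = δ / 3 * (B / (B + 1)) := by rw [hτ]; field_simp
          _ ≤ δ / 3 * 1 := by
              gcongr
              rw [div_le_one (by positivity)]; linarith
          _ = _ := by ring
      have hf1 := H2 n (by omega) ι f hf C hCard j ψ hψ1
      have hid := H2 n (by omega) (Fin n) (fun y => y) (loc_id hd) univ (by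
        rw [card_univ, Fintype.card_fun, Fintype.card_bool, Fintype.card_fin]
        push_cast
        refine mul_le_of_le_one_left (by positivity) (Real.exp_le_one_iff.2 ?_)
        have : 0 ≤ c * n := by positivity
        linarith) j ψ hψ1
      have htv : tvd (law fun y : Fin n → Bool => y) (unifOn univ) = 0 := by
        unfold tvd; simp [law_id]
      rw [htv] at hid
      rw [← sum_law_mul f (fun y => ψ (wt univ y)),
        ← sum_law_mul f (fun y => ψ (wt univ y + 2 * j))] at hf1
      have e1 : ∀ y : Fin n → Bool, ev s y * φ (wt univ y) = ψ (wt univ y) := fun y => by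
        rw [ev_eq hs]
      have e2 : ∀ y : Fin n → Bool, ev s y * φ (wt univ y + 2 * j) = ψ (wt univ y + 2 * j) :=
        fun y => by rw [ev_eq hs]; simp only [hψ]; rw [par_add_two_mul]
      rw [sum_cen_mul PG s (fun y => φ (wt univ y)),
        sum_cen_mul PG s (fun y => φ (wt univ y + 2 * j))]
      simp_rw [e1, e2]
      have hc1 := hPGclose (fun y => ψ (wt univ y)) fun y => hψ1 _
      have hc2 := hPGclose (fun y => ψ (wt univ y + 2 * j)) fun y => hψ1 _
      set η := ∑ z, PG z * ev s z
      have h0 := hη0 s hs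
      have h1 := hη1 s hs
      have hu : |2 * η * (Ex (fun y : Fin n → Bool => ψ (wt univ y))
          - Ex (fun y : Fin n → Bool => ψ (wt univ y + 2 * j)))| ≤ 2 * (δ / 3 + δ) := by
        rw [abs_mul, abs_of_nonneg (by positivity)]
        have : 2 * η ≤ 2 := by linarith
        gcongr
        linarith
      rw [mul_sub] at hu
      have hc1' := abs_le.1 hc1
      have hc2' := abs_le.1 hc2
      have hf1' := abs_le.1 hf1
      have hu' := abs_le.1 hu
      rw [abs_le]
      constructor <;> linarith
  set η := ∑ z, PG z * ev 1 z with hη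
  set η' := ∑ z, PG z * ev (-1) z with hη'
  have hηη' : η + η' = 1 - ρ := by
    rw [hη, hη', ← sum_add_distrib, ← hmass]
    exact sum_congr rfl fun y _ => by rw [← mul_add, ev_add_ev, mul_one]
  have hηnn : 0 ≤ η := hη0 1 (Or.inl rfl)
  have hηle : η ≤ 1 := hη1 1 (Or.inl rfl)
  clear_value η η'
  set M : (Fin n → Bool) → ℝ := fun x => η * evens n x + (1 - η) * odds n x with hM
  have hmain : ∀ φ : ℤ → ℝ, (∀ k, |φ k| ≤ 1) →
      |∑ y, law f y * φ (wt univ y) - ∑ y, M y * φ (wt univ y)| ≤ 22 * ε + 24 * δ := by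
    intro φ hφ
    have h1 := hPGclose (fun y => φ (wt univ y)) fun y => hφ _
    have h2 := hcen 1 (Or.inl rfl) φ hφ
    have h3 := hcen (-1) (Or.inr rfl) φ hφ
    rw [sum_cen_mul PG _ (fun y => φ (wt univ y)), ← hη] at h2
    rw [sum_cen_mul PG _ (fun y => φ (wt univ y)), ← hη'] at h3
    have h4 : ∑ y, PG y * φ (wt univ y) = ∑ y, PG y * (ev 1 y * φ (wt univ y))
        + ∑ y, PG y * (ev (-1) y * φ (wt univ y)) := by
      rw [← sum_add_distrib]
      refine sum_congr rfl fun y _ => ?_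
      rw [← mul_add, ← add_mul, ev_add_ev, one_mul]
    have h5 : ∑ y, M y * φ (wt univ y) = 2 * η * Ex (fun y : Fin n → Bool => ev 1 y * φ (wt univ y))
        + 2 * (1 - η) * Ex (fun y : Fin n → Bool => ev (-1) y * φ (wt univ y)) := by
      rw [← sum_div_two_pow, ← sum_div_two_pow, mul_sum, mul_sum, ← sum_add_distrib]
      refine sum_congr rfl fun y _ => ?_
      simp only [hM]
      rw [evens_eq hn0, odds_eq hn0]; ring
    have h6 : |Ex (fun y : Fin n → Bool => ev (-1) y * φ (wt univ y))| ≤ 1 / 2 := by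
      rw [← Ex_ev (-1) hn0]
      refine (abs_Ex_le _).trans (Ex_mono fun y => ?_)
      rw [abs_mul, abs_of_nonneg (ev_nonneg (Or.inr rfl) y)]
      exact mul_le_of_le_one_right (ev_nonneg (Or.inr rfl) y) (hφ _)
    have h7 : |2 * ρ * Ex (fun y : Fin n → Bool => ev (-1) y * φ (wt univ y))| ≤ ρ := by
      rw [abs_mul, abs_of_nonneg (by positivity)]
      nlinarith
    rw [h5, show 1 - η = η' + ρ by linarith]
    have h1' := abs_le.1 h1
    have h2' := abs_le.1 h2
    have h3' := abs_le.1 h3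
    have h7' := abs_le.1 h7
    rw [abs_le]
    constructor <;> linarith
  refine ⟨η, hηnn, hηle, ?_⟩
  obtain ⟨φ, hφ, hφe⟩ := tvd_of_weight (D := unifOn C) (M := M)
    (F := fun k => (if k ∈ Ψ then (C.card : ℝ)⁻¹ else 0) - (η * (if Even k then
      ((univ.filter fun x : Fin n → Bool => Even (hw x)).card : ℝ)⁻¹ else 0) + (1 - η) *
      (if Odd k then ((univ.filter fun x : Fin n → Bool => Odd (hw x)).card : ℝ)⁻¹ else 0)))
    (fun y => by simp [hM, unifOn, evens, odds, hC, slices])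
  have h1 := abs_le.1 (hmain φ hφ)
  have h2 := abs_le.1 (abs_sum_sub_mul_le (law f) (unifOn C)
    (τ := fun y => φ (wt univ y)) fun y => hφ _)
  have h3 := tvd_triangle (law f) (unifOn C) M
  linarith

end Final

section Transfer

variable {m n : ℕ}

lemma IsLocal.loc {d : ℕ} {f : (Fin m → Bool) → (Fin n → Bool)} (h : IsLocal d f) : Loc d f := by
  choose T hT hf using h
  exact ⟨T, hT, fun i x y hxy => hf i x y hxy⟩

lemma pushf_unifOn_univ (f : (Fin m → Bool) → (Fin n → Bool)) : pushf f (unifOn univ) = law f := by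
  funext y
  unfold pushf law unifOn Ex
  simp [div_eq_mul_inv]

/-- The mixture is at distance at most one from any law. -/
lemma tvd_law_mixture_le_one (hn : 0 < n) (f : (Fin m → Bool) → (Fin n → Bool)) {η : ℝ} (h0 : 0 ≤ η)
    (h1 : η ≤ 1) : tvd (law f) (fun x => η * evens n x + (1 - η) * odds n x) ≤ 1 := by
  have hs : ∑ y, law f y = 1 := by
    have := sum_law_mul f (fun _ => (1 : ℝ))
    rw [Ex_const] at this
    simpa using this
  have hM : ∀ y : Fin n → Bool, η * evens n y + (1 - η) * odds n y
      = (2 * η * ev 1 y + 2 * (1 - η) * ev (-1) y) / 2 ^ n := fun y => by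
    rw [evens_eq hn, odds_eq hn]; ring
  have hM0 : ∀ y : Fin n → Bool, 0 ≤ η * evens n y + (1 - η) * odds n y := fun y => by
    rw [hM]
    have := ev_nonneg (Or.inl rfl : (1 : ℝ) = 1 ∨ (1 : ℝ) = -1) y
    have := ev_nonneg (Or.inr rfl : (-1 : ℝ) = 1 ∨ (-1 : ℝ) = -1) y
    have : 0 ≤ 1 - η := by linarith
    positivity
  have hMs : ∑ y : Fin n → Bool, (η * evens n y + (1 - η) * odds n y) = 1 := by
    simp_rw [hM]
    rw [sum_div_two_pow (fun y => 2 * η * ev 1 y + 2 * (1 - η) * ev (-1) y), Ex_add, Ex_mul_left,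
      Ex_mul_left, Ex_ev _ hn, Ex_ev _ hn]
    ring
  unfold tvd
  rw [div_le_one two_pos]
  calc _ ≤ ∑ y, (law f y + (η * evens n y + (1 - η) * odds n y)) := by
        refine sum_le_sum fun y _ => ?_
        have := law_nonneg f y
        have := hM0 y
        rw [abs_le]; constructor <;> linarith
    _ = 2 := by rw [sum_add_distrib, hs, hMs]; norm_num

end Transfer

/-- Any low-depth sampleable distribution close to a roughly centered `D_Ψ` is close to a
mixture of `evens` and `odds`. -/
theorem stmt0 :
    ∃ C : ℝ, 0 < C ∧ ∀ δ : ℝ, 0 < δ → ∀ d : ℕ, 1 ≤ d →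
    ∃ c : ℝ, 0 < c ∧ ∃ N : ℕ, ∀ n : ℕ, N ≤ n → ∀ m : ℕ,
    ∀ f : (Fin m → Bool) → (Fin n → Bool), IsLocal d f →
    ∀ Ψ : Finset ℕ, Ψ ⊆ Finset.range (n + 1) →
    (∃ s ∈ Ψ, |(s : ℝ) - n / 2| ≤ c * n) →
    ∃ η : ℝ, 0 ≤ η ∧ η ≤ 1 ∧
      tvd (pushf f (unifOn (Finset.univ : Finset (Fin m → Bool))))
          (fun x => η * evens n x + (1 - η) * odds n x)
        ≤ C * tvd (pushf f (unifOn (Finset.univ : Finset (Fin m → Bool)))) (DPsi n Ψ) + δ := by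
  refine ⟨40, by norm_num, fun δ hδ d hd => ?_⟩
  obtain ⟨α, hα, c₁, hc₁, N₁, H₁⟩ := small_slices d
  obtain ⟨c₂, hc₂, N₂, H₂⟩ := large_slices hd hα (show 0 < δ / 13 by positivity)
  refine ⟨min c₁ c₂, lt_min hc₁ hc₂, N₁ + N₂ + 1, fun n hn m f hf Ψ hΨ ⟨s, hs, hsn⟩ => ?_⟩
  rw [pushf_unifOn_univ, show DPsi n Ψ = unifOn (slices n Ψ) from rfl]
  have hmono : ∀ c, min c₁ c₂ ≤ c → ∃ s ∈ Ψ, |(s : ℝ) - n / 2| ≤ c * n := fun c hc =>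
    ⟨s, hs, hsn.trans (by gcongr)⟩
  have h0 := tvd_nonneg (law f) (unifOn (slices n Ψ))
  rcases le_total (((slices n Ψ).card : ℝ) / 2 ^ n) α with h | h
  · have h1 := H₁ n (by omega) (Fin m) f hf.loc Ψ hΨ (hmono _ (min_le_left _ _)) h
    refine ⟨1, zero_le_one, le_rfl,
      (tvd_law_mixture_le_one (by omega) f zero_le_one le_rfl).trans ?_⟩
    linarith
  · obtain ⟨η, hη0, hη1, h1⟩ := H₂ n (by omega) (Fin m) f hf.loc Ψ hΨ (hmono _ (min_le_right _ _)) h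
    exact ⟨η, hη0, hη1, by linarith⟩
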